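/- For every ε > 0 there is a constant C_ε such that for all X ≥ 1, the sum of #Cl_3(−D) over squarefree positive integers D < X with D ≡ 2 (mod 4) satisfies |Σ #Cl_3(−D) − (4/π²)·X| ≤ C_ε·X^{19/20+ε}. -/

import Mathlib

open scoped Classical

/-- The quadratic field `ℚ(√D)`, realized inside `ℂ`. -/
noncomputable def QuadField (D : ℤ) : IntermediateField ℚ ℂ :=
  IntermediateField.adjoin ℚ {(D : ℂ) ^ ((1 : ℂ)/2)}

/-- `#Cl_3(D)`: the number of 3-torsion elements of the ideal class group of `ℚ(√D)`. -/
noncomputable def h3 (D : ℤ) : ℕ :=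
  Nat.card {x : ClassGroup (NumberField.RingOfIntegers (QuadField D)) // x ^ 3 = 1}

section RingOfIntegers

lemma quadField_gen_sq (D : ℕ) :
    (((-(D : ℤ) : ℤ) : ℂ) ^ ((1 : ℂ)/2)) * (((-(D : ℤ) : ℤ) : ℂ) ^ ((1 : ℂ)/2)) = -(D : ℂ) := by
  rw [← pow_two]
  simp

lemma quadField_gen_conj (D : ℕ) (hD : 0 < D) :
    (starRingEnd ℂ) (((-(D : ℤ) : ℤ) : ℂ) ^ ((1 : ℂ)/2)) =
      - (((-(D : ℤ) : ℤ) : ℂ) ^ ((1 : ℂ)/2)) := by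
  set t := (((-(D : ℤ) : ℤ) : ℂ) ^ ((1 : ℂ)/2)) with ht
  have h : t * t = -(D : ℂ) := quadField_gen_sq D
  have hre := congrArg Complex.re h
  have him := congrArg Complex.im h
  simp at hre him
  have h0 : t.re = 0 := by
    by_contra hne
    have : t.im = 0 := by
      have : t.re * t.im = 0 := by linarith
      rcases mul_eq_zero.1 this with h | h
      · exact absurd h hne
      · exact h
    rw [this] at hre
    have : (0:ℝ) < D := by exact_mod_cast hD
    nlinarith [mul_self_nonneg t.re]
  apply Complex.ext <;> simp [h0]

lemma quadField_mem_repr (D : ℕ) {x : ℂ} (hx : x ∈ QuadField (-(D : ℤ))) :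
    ∃ p q : ℚ, x = p + q * (((-(D : ℤ) : ℤ) : ℂ) ^ ((1 : ℂ)/2)) := by
  set t := (((-(D : ℤ) : ℤ) : ℂ) ^ ((1 : ℂ)/2)) with ht
  have h : t * t = -(D : ℂ) := quadField_gen_sq D
  have hint : IsIntegral ℚ t := by
    refine ⟨Polynomial.X ^ 2 + Polynomial.C (D : ℚ), ?_, ?_⟩
    · exact Polynomial.monic_X_pow_add_C _ (by norm_num)
    · simp [pow_two, h]
  unfold QuadField at hx
  rw [← ht, ← IntermediateField.mem_toSubalgebra,
    IntermediateField.adjoin_simple_toSubalgebra_of_isAlgebraic hint.isAlgebraic] at hx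
  induction hx using Algebra.adjoin_induction with
  | mem y hy =>
    rw [Set.mem_singleton_iff] at hy
    exact ⟨0, 1, by simp [hy]⟩
  | algebraMap r => exact ⟨r, 0, by simp⟩
  | add y z _ _ hy hz =>
    obtain ⟨p, q, rfl⟩ := hy
    obtain ⟨p', q', rfl⟩ := hz
    exact ⟨p + p', q + q', by push_cast; ring⟩
  | mul y z _ _ hy hz =>
    obtain ⟨p, q, rfl⟩ := hy
    obtain ⟨p', q', rfl⟩ := hz
    refine ⟨p * p' - D * q * q', p * q' + q * p', ?_⟩
    push_cast
    linear_combination (q : ℂ) * q' * h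

lemma rat_int_of_isIntegral {p : ℚ} (h : IsIntegral ℤ (p : ℂ)) : ∃ n : ℤ, (n : ℚ) = p := by
  have h' : IsIntegral ℤ p := by
    have : (p : ℂ) = algebraMap ℚ ℂ p := by simp
    rw [this] at h
    exact (isIntegral_algebraMap_iff (algebraMap ℚ ℂ).injective).1 h
  obtain ⟨n, hn⟩ := IsIntegrallyClosed.isIntegral_iff.1 h'
  exact ⟨n, by simpa using hn⟩

lemma rat_int_of_squarefree_mul {D : ℕ} (hD : Squarefree D) {r : ℚ} {n : ℤ}
    (h : (D : ℚ) * r ^ 2 = n) : ∃ k : ℤ, (k : ℚ) = r := by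
  have hden : (r.den : ℚ) ≠ 0 := by exact_mod_cast r.den_nz
  have h1 : (D : ℤ) * r.num ^ 2 = n * (r.den : ℤ) ^ 2 := by
    have h2 : (r.num : ℚ) = r * r.den := (Rat.mul_den_eq_num r).symm
    have : (D : ℚ) * (r.num : ℚ) ^ 2 = n * (r.den : ℚ) ^ 2 := by
      rw [h2, ← h]; ring
    exact_mod_cast this
  have hcop : IsCoprime ((r.den : ℤ) ^ 2) (r.num ^ 2) := by
    apply IsCoprime.pow
    rw [Int.isCoprime_iff_gcd_eq_one]
    have := r.reduced
    rw [Nat.Coprime, Nat.gcd_comm] at this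
    simpa [Int.gcd] using this
  have hd : ((r.den : ℤ) ^ 2) ∣ D := by
    apply hcop.dvd_of_dvd_mul_right
    exact ⟨n, by rw [h1]; ring⟩
  have hd' : r.den * r.den ∣ D := by
    rw [← pow_two]; exact_mod_cast hd
  have := Nat.isUnit_iff.1 (hD _ hd')
  exact ⟨r.num, by rw [← Rat.mul_den_eq_num r, this]; simp⟩

lemma quadField_integral_repr (D : ℕ) (hD : Squarefree D) (hD4 : D % 4 = 2) {x : ℂ}
    (hx : x ∈ QuadField (-(D : ℤ))) (hint : IsIntegral ℤ x) :
    ∃ m n : ℤ, x = m + n * (((-(D : ℤ) : ℤ) : ℂ) ^ ((1 : ℂ)/2)) := by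
  obtain ⟨p, q, hpq⟩ := quadField_mem_repr D hx
  have hDpos : 0 < D := by omega
  set t := (((-(D : ℤ) : ℤ) : ℂ) ^ ((1 : ℂ)/2)) with ht
  have h : t * t = -(D : ℂ) := quadField_gen_sq D
  have hc := quadField_gen_conj D hDpos
  rw [← ht] at hc
  have hxc : (starRingEnd ℂ) x = p - q * t := by
    rw [hpq]; simp [hc]; ring
  have hci : IsIntegral ℤ ((starRingEnd ℂ) x) := by
    have := hint.map ((starRingEnd ℂ).toIntAlgHom)
    simpa using this
  obtain ⟨m, hm⟩ := rat_int_of_isIntegral (p := 2 * p) (by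
    have := hint.add hci
    rw [hxc, hpq] at this
    have e : ((2 * p : ℚ) : ℂ) = p + q * t + (p - q * t) := by push_cast; ring
    rw [e]; exact this)
  obtain ⟨n, hn⟩ := rat_int_of_isIntegral (p := p ^ 2 + D * q ^ 2) (by
    have := hint.mul hci
    rw [hxc, hpq] at this
    have e : ((p ^ 2 + D * q ^ 2 : ℚ) : ℂ) = (p + q * t) * (p - q * t) := by
      push_cast
      linear_combination ((q : ℂ) ^ 2) * h
    rw [e]; exact this)
  obtain ⟨k, hk⟩ := rat_int_of_squarefree_mul (r := 2 * q) (n := 4 * n - m ^ 2) hD (by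
    push_cast
    rw [hm, hn]; ring)
  have key : m ^ 2 + D * k ^ 2 = 4 * n := by
    have : (m : ℚ) ^ 2 + D * (k : ℚ) ^ 2 = 4 * n := by rw [hm, hk, hn]; ring
    exact_mod_cast this
  have hD' : ∃ e : ℤ, (D : ℤ) = 4 * e + 2 := ⟨(D / 4 : ℕ), by omega⟩
  obtain ⟨e, he⟩ := hD'
  rw [he] at key
  have hm2 : m % 2 = 0 := by
    rcases Int.emod_two_eq_zero_or_one m with h0 | h1
    · exact h0
    · exfalso
      obtain ⟨m', rfl⟩ : ∃ m', m = 2 * m' + 1 := ⟨m / 2, by omega⟩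
      ring_nf at key; omega
  obtain ⟨m', rfl⟩ : ∃ m', m = 2 * m' := ⟨m / 2, by omega⟩
  have hk2 : k % 2 = 0 := by
    rcases Int.emod_two_eq_zero_or_one k with h0 | h1
    · exact h0
    · exfalso
      obtain ⟨k', rfl⟩ : ∃ m', k = 2 * m' + 1 := ⟨k / 2, by omega⟩
      ring_nf at key; omega
  obtain ⟨k', rfl⟩ : ∃ m', k = 2 * m' := ⟨k / 2, by omega⟩
  refine ⟨m', k', ?_⟩
  have h1 : (m' : ℚ) = p := by push_cast at hm; linarith
  have h2 : (k' : ℚ) = q := by push_cast at hk; linarith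
  rw [hpq, ← h1, ← h2]; push_cast; ring

/-- The generator of `𝓞 ℚ(√-D)`. -/
noncomputable def quadGen (D : ℕ) : NumberField.RingOfIntegers (QuadField (-(D : ℤ))) :=
  ⟨⟨((-(D : ℤ) : ℤ) : ℂ) ^ ((1 : ℂ)/2),
    IntermediateField.subset_adjoin ℚ _ (Set.mem_singleton _)⟩, by
      refine ⟨Polynomial.X ^ 2 + Polynomial.C (D : ℤ), ?_, ?_⟩
      · exact Polynomial.monic_X_pow_add_C _ (by norm_num)
      · apply Subtype.ext
        simp⟩

lemma quadGen_mul_self (D : ℕ) : quadGen D * quadGen D = ((-(D : ℤ) : ℤ) : _) := by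
  apply NumberField.RingOfIntegers.ext
  apply Subtype.ext
  have := quadField_gen_sq D
  simp [quadGen] at this ⊢
  exact this

noncomputable def zsqrtdEquiv (D : ℕ) (hD : Squarefree D) (hD4 : D % 4 = 2) :
    ℤ√(-(D : ℤ)) ≃+* NumberField.RingOfIntegers (QuadField (-(D : ℤ))) :=
  RingEquiv.ofBijective (Zsqrtd.lift ⟨quadGen D, quadGen_mul_self D⟩) (by
    constructor
    · apply Zsqrtd.lift_injective
      intro n hn
      have : (0 : ℤ) < D := by omega
      nlinarith [mul_self_nonneg n]
    · intro x
      obtain ⟨m, n, hmn⟩ := quadField_integral_repr D hD hD4 (x := ((x : QuadField (-(D : ℤ))) : ℂ))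
        (x : QuadField (-(D : ℤ))).2 (by
          have := NumberField.RingOfIntegers.isIntegral_coe x
          exact this.map (QuadField (-(D : ℤ))).val.toRingHom.toIntAlgHom)
      refine ⟨⟨m, n⟩, ?_⟩
      apply NumberField.RingOfIntegers.ext
      apply Subtype.ext
      rw [hmn]
      have e : Zsqrtd.lift ⟨quadGen D, quadGen_mul_self D⟩ (⟨m, n⟩ : ℤ√(-(D : ℤ))) =
        (m : NumberField.RingOfIntegers (QuadField (-(D : ℤ)))) + n * quadGen D := by
        simp [Zsqrtd.lift]
      rw [e]
      simp only [map_add, map_mul, map_intCast]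
      have e2 : ((algebraMap _ (QuadField (-(D : ℤ))) (quadGen D) : QuadField (-(D : ℤ))) : ℂ) =
        ((-(D : ℤ) : ℤ) : ℂ) ^ ((1 : ℂ)/2) := rfl
      push_cast at e2 ⊢
      rw [e2])

lemma zsqrtd_isDomain (D : ℕ) (hD : Squarefree D) (hD4 : D % 4 = 2) :
    IsDomain (ℤ√(-(D : ℤ))) := (zsqrtdEquiv D hD hD4).toMulEquiv.isDomain _

lemma quadField_numberField (D : ℕ) : NumberField (QuadField (-(D : ℤ))) := by
  have : FiniteDimensional ℚ (QuadField (-(D : ℤ))) := by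
    apply IntermediateField.adjoin.finiteDimensional
    refine ⟨Polynomial.X ^ 2 + Polynomial.C (D : ℚ), ?_, ?_⟩
    · exact Polynomial.monic_X_pow_add_C _ (by norm_num)
    · simp
  exact ⟨⟩

lemma zsqrtd_isDedekindDomain (D : ℕ) (hD : Squarefree D) (hD4 : D % 4 = 2) :
    IsDedekindDomain (ℤ√(-(D : ℤ))) := by
  have := quadField_numberField D
  have := zsqrtd_isDomain D hD hD4
  have e := zsqrtdEquiv D hD hD4
  have := isNoetherianRing_of_ringEquiv _ e.symm
  have := Ring.DimensionLEOne.of_ringEquiv e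
  have := IsIntegrallyClosed.of_equiv e.symm
  have : IsDedekindRing (ℤ√(-(D : ℤ))) := ⟨⟩
  exact ⟨⟩

lemma h3_eq_card_zsqrtd (D : ℕ) (hD : Squarefree D) (hD4 : D % 4 = 2)
    [IsDomain (ℤ√(-(D : ℤ)))] :
    h3 (-(D : ℤ)) = Nat.card {x : ClassGroup (ℤ√(-(D : ℤ))) // x ^ 3 = 1} := by
  unfold h3
  let e := ClassGroup.mulEquiv (zsqrtdEquiv D hD hD4)
  refine (Nat.card_congr (e.toEquiv.subtypeEquiv ?_)).symm
  intro a
  simp only [MulEquiv.toEquiv_eq_coe, EquivLike.coe_coe, ← map_pow]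
  exact (map_eq_one_iff e e.injective).symm

end RingOfIntegers

section BinaryForms

variable {D : ℕ}

/-- The ideal of `ℤ[√-D]` spanned by `P` and `B + √-D`. -/
def formIdeal (D : ℕ) (P B : ℤ) : Ideal (ℤ√(-(D : ℤ))) :=
  Ideal.span {(P : ℤ√(-(D : ℤ))), ⟨B, 1⟩}

/-- Complex conjugation on `ℤ[√-D]`. -/
def zconj (D : ℕ) : ℤ√(-(D : ℤ)) ≃+* ℤ√(-(D : ℤ)) := starRingAut

lemma zconj_apply (x : ℤ√(-(D : ℤ))) : zconj D x = ⟨x.re, -x.im⟩ := by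
  cases x; rfl

lemma mem_formIdeal {P B R : ℤ} (h : P * R = B ^ 2 + D) {x : ℤ√(-(D : ℤ))} :
    x ∈ formIdeal D P B ↔ ∃ m n : ℤ, x = ⟨m * P + n * B, n⟩ := by
  unfold formIdeal
  rw [Ideal.mem_span_pair]
  constructor
  · rintro ⟨u, v, rfl⟩
    refine ⟨u.re - u.im * B - v.im * R, u.im * P + v.re + v.im * B, ?_⟩
    ext
    · simp
      linear_combination (v.im) * h
    · simp; ring
  · rintro ⟨m, n, rfl⟩
    refine ⟨m, n, ?_⟩
    ext <;> simp

lemma exists_bezout_of_squarefree (hD : Squarefree D) (hD4 : D % 4 = 2) {P B R : ℤ}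
    (h : P * R = B ^ 2 + D) : ∃ u v w : ℤ, u * P + v * (2 * B) + w * R = 1 := by
  have key : ∀ p : ℕ, p.Prime → (p : ℤ) ∣ P → (p : ℤ) ∣ 2 * B → (p : ℤ) ∣ R → False := by
    intro p hp h1 h2 h3
    rcases hp.eq_two_or_odd with rfl | hodd
    · obtain ⟨x, rfl⟩ := h1
      obtain ⟨y, rfl⟩ := h3
      have h4 : (D : ℤ) % 4 = 2 := by exact_mod_cast hD4
      have h5 : B ^ 2 % 4 = 2 := by
        have : B ^ 2 = 4 * (x * y) - D := by push_cast at h; linarith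
        omega
      rcases Int.even_or_odd' B with ⟨k, rfl | rfl⟩ <;> ring_nf at h5 <;> omega
    · have hB : (p : ℤ) ∣ B := by
        rcases (Nat.prime_iff_prime_int.1 hp).dvd_or_dvd h2 with h | h
        · have := Int.le_of_dvd (by norm_num) h
          have := hp.two_le
          have : p = 2 := by omega
          omega
        · exact h
      have : ((p * p : ℕ) : ℤ) ∣ D := by
        have e : (D : ℤ) = P * R - B * B := by linarith
        rw [e]; push_cast
        exact dvd_sub (mul_dvd_mul h1 h3) (mul_dvd_mul hB hB)
      have := hD p (by exact_mod_cast this)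
      exact hp.ne_one (Nat.isUnit_iff.1 this)
  have hg : Int.gcd (Int.gcd P (2 * B)) R = 1 := by
    by_contra hne
    obtain ⟨p, hp, hpd⟩ := Nat.exists_prime_and_dvd hne
    have h1 : (p : ℤ) ∣ (Int.gcd P (2 * B) : ℤ) :=
      (Int.natCast_dvd_natCast.2 hpd).trans (Int.gcd_dvd_left ..)
    exact key p hp (h1.trans (Int.gcd_dvd_left ..)) (h1.trans (Int.gcd_dvd_right ..))
      ((Int.natCast_dvd_natCast.2 hpd).trans (Int.gcd_dvd_right ..))
  have e1 := Int.gcd_eq_gcd_ab P (2 * B)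
  have e2 := Int.gcd_eq_gcd_ab (Int.gcd P (2 * B)) R
  rw [hg] at e2
  refine ⟨P.gcdA (2 * B) * Int.gcdA (Int.gcd P (2 * B)) R,
    P.gcdB (2 * B) * Int.gcdA (Int.gcd P (2 * B)) R, Int.gcdB (Int.gcd P (2 * B)) R, ?_⟩
  push_cast at e2
  linear_combination (-Int.gcdA (Int.gcd P (2 * B)) R) * e1 - e2

lemma map_zconj_formIdeal (P B : ℤ) : (formIdeal D P B).map (zconj D) =
    Ideal.span {(P : ℤ√(-(D : ℤ))), ⟨B, -1⟩} := by
  unfold formIdeal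
  rw [Ideal.map_span, Set.image_pair]
  simp [zconj_apply]

lemma formIdeal_mul_conj (hD : Squarefree D) (hD4 : D % 4 = 2) {P B R : ℤ}
    (h : P * R = B ^ 2 + D) :
    formIdeal D P B * (formIdeal D P B).map (zconj D) = Ideal.span {(P : ℤ√(-(D : ℤ)))} := by
  obtain ⟨u, v, w, huvw⟩ := exists_bezout_of_squarefree hD hD4 h
  rw [map_zconj_formIdeal]
  unfold formIdeal
  rw [Ideal.span_pair_mul_span_pair]
  apply le_antisymm
  · rw [Ideal.span_le]
    have hN : (⟨B, 1⟩ * ⟨B, -1⟩ : ℤ√(-(D : ℤ))) = (P : ℤ√(-(D : ℤ))) * R := by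
      ext
      · simp; linarith
      · simp
    intro x hx
    simp only [Set.mem_insert_iff, Set.mem_singleton_iff] at hx
    simp only [SetLike.mem_coe, Ideal.mem_span_singleton]
    rcases hx with rfl | rfl | rfl | rfl
    · exact Dvd.intro _ rfl
    · exact Dvd.intro _ rfl
    · exact Dvd.intro_left _ rfl
    · rw [hN]; exact Dvd.intro _ rfl
  · rw [Ideal.span_singleton_le_iff_mem]
    set S : Set (ℤ√(-(D : ℤ))) := {(P : ℤ√(-(D : ℤ))) * P, (P : ℤ√(-(D : ℤ))) * ⟨B, -1⟩,
      ⟨B, 1⟩ * (P : ℤ√(-(D : ℤ))), ⟨B, 1⟩ * ⟨B, -1⟩} with hS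
    have m1 : (P : ℤ√(-(D : ℤ))) * P ∈ Ideal.span S := Ideal.subset_span (by simp [hS])
    have m2 : (P : ℤ√(-(D : ℤ))) * ⟨B, -1⟩ ∈ Ideal.span S := Ideal.subset_span (by simp [hS])
    have m3 : ⟨B, 1⟩ * (P : ℤ√(-(D : ℤ))) ∈ Ideal.span S := Ideal.subset_span (by simp [hS])
    have m4 : (⟨B, 1⟩ * ⟨B, -1⟩ : ℤ√(-(D : ℤ))) ∈ Ideal.span S := Ideal.subset_span (by simp [hS])
    have := Ideal.add_mem _ (Ideal.add_mem _ (Ideal.mul_mem_left _ (u : ℤ√(-(D : ℤ))) m1)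
      (Ideal.mul_mem_left _ (v : ℤ√(-(D : ℤ))) (Ideal.add_mem _ m2 m3)))
      (Ideal.mul_mem_left _ (w : ℤ√(-(D : ℤ))) m4)
    convert this using 1
    ext
    · simp
      linear_combination (-P) * huvw + w * h
    · simp

lemma zsqrtd_norm_pos (hD : 0 < D) {x : ℤ√(-(D : ℤ))} (hx : x ≠ 0) : 0 < x.norm := by
  have h1 : x.norm = x.re * x.re + D * (x.im * x.im) := by rw [Zsqrtd.norm_def]; ring
  rw [h1]
  by_contra hn
  have hD' : (0 : ℤ) < D := by exact_mod_cast hD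
  have h2 := mul_self_nonneg x.re
  have h3 := mul_self_nonneg x.im
  have h4 : x.im * x.im = 0 := by nlinarith
  have h5 : x.re * x.re = 0 := by nlinarith
  apply hx
  ext
  · simpa using h5
  · simpa using h4

lemma mul_zconj (x : ℤ√(-(D : ℤ))) : x * zconj D x = (x.norm : ℤ√(-(D : ℤ))) := by
  rw [zconj_apply]
  ext
  · simp [Zsqrtd.norm_def]
  · simp; ring

lemma zsqrtd_int_dvd {m n : ℤ} : (m : ℤ√(-(D : ℤ))) ∣ (n : ℤ√(-(D : ℤ))) ↔ m ∣ n :=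
  Zsqrtd.intCast_dvd_intCast _ _

lemma int_eq_of_span_eq {m n : ℤ} (hm : 0 ≤ m) (hn : 0 ≤ n)
    (h : Ideal.span {(m : ℤ√(-(D : ℤ)))} = Ideal.span {(n : ℤ√(-(D : ℤ)))}) : m = n := by
  apply Int.dvd_antisymm hm hn
  · rw [← zsqrtd_int_dvd (D := D), ← Ideal.span_singleton_le_span_singleton, h]
  · rw [← zsqrtd_int_dvd (D := D), ← Ideal.span_singleton_le_span_singleton, h]

lemma zsqrtd_eq_of_span_eq [IsDomain (ℤ√(-(D : ℤ)))] (hD : 2 ≤ D) {x y : ℤ√(-(D : ℤ))}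
    (h : Ideal.span {x} = Ideal.span {y}) : x = y ∨ x = -y := by
  rw [Ideal.span_singleton_eq_span_singleton] at h
  obtain ⟨u, hu⟩ := h
  have h1 : IsUnit (u : ℤ√(-(D : ℤ))) := u.isUnit
  rw [Zsqrtd.isUnit_iff_norm_isUnit, Int.isUnit_iff] at h1
  have h2 : ((u : ℤ√(-(D : ℤ))).re) ^ 2 + D * ((u : ℤ√(-(D : ℤ))).im) ^ 2 = 1 := by
    have h3 := zsqrtd_norm_pos (D := D) (by omega) u.isUnit.ne_zero
    have h4 : (u : ℤ√(-(D : ℤ))).norm = 1 := by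
      rcases h1 with h1 | h1 <;> omega
    rw [Zsqrtd.norm_def] at h4
    linarith
  set r := (u : ℤ√(-(D : ℤ))).re with hr
  set s := (u : ℤ√(-(D : ℤ))).im with hs
  have hD' : (2 : ℤ) ≤ D := by exact_mod_cast hD
  have hs0 : s = 0 := by
    by_contra hne
    have : 0 < s ^ 2 := by positivity
    nlinarith [sq_nonneg r]
  rw [hs0] at h2
  have hr1 : r = 1 ∨ r = -1 := by
    have : (r - 1) * (r + 1) = 0 := by nlinarith
    rcases mul_eq_zero.1 this with h | h
    · left; linarith
    · right; linarith
  rcases hr1 with h | h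
  · left
    have : (u : ℤ√(-(D : ℤ))) = 1 := by ext <;> simp [← hr, ← hs, h, hs0]
    rw [← hu, this, mul_one]
  · right
    have : (u : ℤ√(-(D : ℤ))) = -1 := by ext <;> simp [← hr, ← hs, h, hs0]
    rw [← hu, this]; simp

end BinaryForms

section ReducedForms

variable {D : ℕ}

/-- The form with coefficients `P`, `2 * B`, `R` is reduced. -/
def RedForm (P B R : ℤ) : Prop :=
  0 < P ∧ -P < 2 * B ∧ 2 * B ≤ P ∧ P ≤ R ∧ (P = R → 0 ≤ B)

lemma exists_min_pos {S : Set ℤ} (h0 : ∃ x ∈ S, 0 < x)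
    (hsub : ∀ x ∈ S, ∀ y ∈ S, ∀ k : ℤ, x - k * y ∈ S) :
    ∃ c ∈ S, 0 < c ∧ ∀ x ∈ S, c ∣ x := by
  obtain ⟨x, hx, hxpos⟩ := h0
  have hex : ∃ n : ℕ, 0 < n ∧ (n : ℤ) ∈ S := ⟨x.toNat, by omega, by
    rwa [Int.toNat_of_nonneg hxpos.le]⟩
  obtain ⟨hc1, hc2⟩ := Nat.find_spec hex
  refine ⟨Nat.find hex, hc2, by exact_mod_cast hc1, fun y hy => ?_⟩
  set c : ℕ := Nat.find hex with hc
  have h1 := hsub y hy c hc2 (y / c)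
  have h2 : y - y / c * c = y % c := by
    have := Int.emod_add_mul_ediv y c; linarith
  rw [h2] at h1
  have hcpos : (0 : ℤ) < c := by exact_mod_cast hc1
  have h3 := Int.emod_nonneg y hcpos.ne'
  have h4 := Int.emod_lt_of_pos y hcpos
  by_contra hnd
  have h5 : 0 < y % c := lt_of_le_of_ne h3 (fun h => hnd (Int.dvd_of_emod_eq_zero h.symm))
  have := Nat.find_min' hex (m := (y % c).toNat) ⟨by omega, by rwa [Int.toNat_of_nonneg h3]⟩
  omega

lemma exists_formIdeal_of_ne_bot [IsDomain (ℤ√(-(D : ℤ)))] {I : Ideal (ℤ√(-(D : ℤ)))}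
    (hI : I ≠ ⊥) (hD : 0 < D) : ∃ c P B R : ℤ, 0 < c ∧ 0 < P ∧ P * R = B ^ 2 + D ∧
      I = Ideal.span {(c : ℤ√(-(D : ℤ)))} * formIdeal D P B := by
  obtain ⟨z, hz, hz0⟩ := Submodule.exists_mem_ne_zero_of_ne_bot hI
  have hzN : (⟨z.norm, 0⟩ : ℤ√(-(D : ℤ))) ∈ I := by
    have := Ideal.mul_mem_right (zconj D z) I hz
    rw [mul_zconj] at this
    convert this using 1
    ext <;> simp
  have hNpos := zsqrtd_norm_pos hD hz0
  have hmulθ : ∀ {x y : ℤ}, (⟨x, y⟩ : ℤ√(-(D : ℤ))) ∈ I → (⟨-D * y, x⟩ : ℤ√(-(D : ℤ))) ∈ I := by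
    intro x y h
    have := Ideal.mul_mem_left I (⟨0, 1⟩ : ℤ√(-(D : ℤ))) h
    convert this using 1
    ext <;> simp
  have hlin : ∀ {x y x' y' : ℤ} (k : ℤ), (⟨x, y⟩ : ℤ√(-(D : ℤ))) ∈ I →
      (⟨x', y'⟩ : ℤ√(-(D : ℤ))) ∈ I → (⟨x - k * x', y - k * y'⟩ : ℤ√(-(D : ℤ))) ∈ I := by
    intro x y x' y' k h h'
    have := I.sub_mem h (Ideal.mul_mem_left I (k : ℤ√(-(D : ℤ))) h')
    convert this using 1
    ext <;> simp
  obtain ⟨c, ⟨b, hcb⟩, hc, hcmin⟩ := exists_min_pos (S := {y | ∃ x, (⟨x, y⟩ : ℤ√(-(D : ℤ))) ∈ I})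
    ⟨z.norm, ⟨_, hmulθ hzN⟩, hNpos⟩ (by
      rintro x ⟨x', hx⟩ y ⟨y', hy⟩ k
      exact ⟨_, hlin k hx hy⟩)
  obtain ⟨n, hn, hnpos, hnmin⟩ := exists_min_pos (S := {x | (⟨x, 0⟩ : ℤ√(-(D : ℤ))) ∈ I})
    ⟨z.norm, hzN, hNpos⟩ (by
      intro x hx y hy k
      have := hlin k hx hy
      simpa using this)
  obtain ⟨P, rfl⟩ : c ∣ n := hcmin _ ⟨_, hmulθ hn⟩
  obtain ⟨B, rfl⟩ : c ∣ b := hcmin _ ⟨_, hmulθ hcb⟩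
  have hP : 0 < P := by
    by_contra h
    nlinarith
  have hd : c * P ∣ c * (B ^ 2 + D) := by
    apply hnmin
    have h1 := hlin B (hmulθ hcb) hcb
    have h2 := hlin 2 h1 h1
    rw [Set.mem_ofPred_eq]
    convert h2 using 1
    ext
    · simp; ring
    · simp; ring
  obtain ⟨R, hR⟩ := Int.dvd_of_mul_dvd_mul_left hc.ne' hd
  refine ⟨c, P, B, R, hc, hP, hR.symm, ?_⟩
  ext ⟨x, y⟩
  rw [Ideal.mem_span_singleton_mul]
  constructor
  · intro hx
    obtain ⟨k, rfl⟩ := hcmin y ⟨x, hx⟩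
    have h1 := hlin k hx hcb
    have h2 : (⟨x - k * (c * B), 0⟩ : ℤ√(-(D : ℤ))) ∈ I := by
      convert h1 using 2; ring
    obtain ⟨m, hm⟩ := hnmin _ h2
    refine ⟨⟨m * P + k * B, k⟩, (mem_formIdeal hR.symm).2 ⟨m, k, rfl⟩, ?_⟩
    ext
    · simp; linarith
    · simp
  · rintro ⟨w, hw, h⟩
    obtain ⟨m, k, rfl⟩ := (mem_formIdeal hR.symm).1 hw
    rw [← h]
    have h1 := hlin (-m) (hlin (-k) (I.zero_mem : (⟨0, 0⟩ : ℤ√(-(D : ℤ))) ∈ I) hcb) hn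
    convert h1 using 1
    ext
    · simp; ring
    · simp; ring

lemma formIdeal_ne_bot {P B : ℤ} : formIdeal D P B ≠ ⊥ := by
  intro h
  have : (⟨B, 1⟩ : ℤ√(-(D : ℤ))) ∈ formIdeal D P B := Ideal.subset_span (by simp)
  rw [h, Ideal.mem_bot] at this
  have := congrArg Zsqrtd.im this
  simp at this

/-- The ideal class of a binary form. -/
noncomputable def formClass [IsDedekindDomain (ℤ√(-(D : ℤ)))] (P B : ℤ) :
    ClassGroup (ℤ√(-(D : ℤ))) :=
  ClassGroup.mk0 ⟨formIdeal D P B, mem_nonZeroDivisors_iff_ne_zero.2 formIdeal_ne_bot⟩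

lemma formClass_eq_iff [IsDedekindDomain (ℤ√(-(D : ℤ)))] {P B P' B' : ℤ} :
    formClass (D := D) P B = formClass P' B' ↔ ∃ x y : ℤ√(-(D : ℤ)), x ≠ 0 ∧ y ≠ 0 ∧
      Ideal.span {x} * formIdeal D P B = Ideal.span {y} * formIdeal D P' B' := by
  unfold formClass
  rw [ClassGroup.mk0_eq_mk0_iff]
  constructor
  · rintro ⟨x, y, hx, hy, h⟩
    exact ⟨x, y, hx, hy, h⟩
  · rintro ⟨x, y, hx, hy, h⟩
    exact ⟨x, y, hx, hy, h⟩

lemma formClass_add [IsDedekindDomain (ℤ√(-(D : ℤ)))] {P B R : ℤ} (h : P * R = B ^ 2 + D) (k : ℤ) :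
    formClass (D := D) P (B + k * P) = formClass P B := by
  have h' : P * (R + 2 * k * B + k ^ 2 * P) = (B + k * P) ^ 2 + D := by linear_combination h
  rw [formClass_eq_iff]
  refine ⟨1, 1, one_ne_zero, one_ne_zero, ?_⟩
  congr 1
  ext x
  rw [mem_formIdeal h, mem_formIdeal h']
  constructor
  · rintro ⟨m, n, rfl⟩
    exact ⟨m + n * k, n, by ext <;> simp; ring⟩
  · rintro ⟨m, n, rfl⟩
    exact ⟨m - n * k, n, by ext <;> simp; ring⟩

lemma formClass_flip [IsDedekindDomain (ℤ√(-(D : ℤ)))] {P B R : ℤ} (h : P * R = B ^ 2 + D)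
    (hP : 0 < P) : formClass (D := D) R (-B) = formClass P B := by
  have h' : R * P = (-B) ^ 2 + D := by linear_combination h
  rw [formClass_eq_iff]
  refine ⟨(P : ℤ√(-(D : ℤ))), ⟨-B, 1⟩, ?_, ?_, ?_⟩
  · intro h0
    have := congrArg Zsqrtd.re h0
    simp at this; omega
  · intro h0
    have := congrArg Zsqrtd.im h0
    simp at this
  · ext x
    rw [Ideal.mem_span_singleton_mul, Ideal.mem_span_singleton_mul]
    constructor
    · rintro ⟨w, hw, rfl⟩
      obtain ⟨m, n, rfl⟩ := (mem_formIdeal h').1 hw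
      refine ⟨_, (mem_formIdeal h).2 ⟨n, -m, rfl⟩, ?_⟩
      ext
      · simp; linear_combination (-m) * h
      · simp; ring
    · rintro ⟨w, hw, rfl⟩
      obtain ⟨m, n, rfl⟩ := (mem_formIdeal h).1 hw
      refine ⟨_, (mem_formIdeal h').2 ⟨-n, m, rfl⟩, ?_⟩
      ext
      · simp; linear_combination (-n) * h
      · simp; ring

lemma exists_redForm [IsDedekindDomain (ℤ√(-(D : ℤ)))] (hD : 0 < D)
    (C : ClassGroup (ℤ√(-(D : ℤ)))) :
    ∃ P B R : ℤ, P * R = B ^ 2 + D ∧ RedForm P B R ∧ formClass P B = C := by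
  have hex : ∃ p : ℕ, 0 < p ∧ ∃ B R : ℤ, (p : ℤ) * R = B ^ 2 + D ∧ formClass (p : ℤ) B = C := by
    obtain ⟨⟨I, hI⟩, rfl⟩ := ClassGroup.mk0_surjective C
    obtain ⟨c, P, B, R, hc, hP, hR, h⟩ := exists_formIdeal_of_ne_bot
      (mem_nonZeroDivisors_iff_ne_zero.1 hI) hD
    refine ⟨P.toNat, by omega, B, R, by rwa [Int.toNat_of_nonneg hP.le], ?_⟩
    rw [Int.toNat_of_nonneg hP.le]
    unfold formClass
    rw [ClassGroup.mk0_eq_mk0_iff]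
    refine ⟨(c : ℤ√(-(D : ℤ))), 1, ?_, one_ne_zero, ?_⟩
    · intro h0
      have := congrArg Zsqrtd.re h0
      simp at this; omega
    · simp [h]
  obtain ⟨hp, B₀, R₀, h₀, hC₀⟩ := Nat.find_spec hex
  set p := Nat.find hex with hpdef
  have hmin : ∀ P B R : ℤ, 0 < P → P * R = B ^ 2 + D → formClass P B = C → (p : ℤ) ≤ P := by
    intro P B R hP h hC
    have := Nat.find_min' hex (m := P.toNat) ⟨by omega, B, R, by
      rwa [Int.toNat_of_nonneg hP.le], by rwa [Int.toNat_of_nonneg hP.le]⟩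
    omega
  have hppos : (0 : ℤ) < p := by exact_mod_cast hp
  have hDpos : (0 : ℤ) < D := by exact_mod_cast hD
  obtain ⟨k, hk1, hk2⟩ : ∃ k : ℤ, -p < 2 * (B₀ + k * p) ∧ 2 * (B₀ + k * p) ≤ p := by
    refine ⟨-((2 * B₀ + p - 1) / (2 * p)), ?_, ?_⟩
    · have := Int.emod_add_mul_ediv (2 * B₀ + p - 1) (2 * p)
      have := Int.emod_nonneg (2 * B₀ + p - 1) (b := 2 * p) (by omega)
      nlinarith
    · have := Int.emod_add_mul_ediv (2 * B₀ + p - 1) (2 * p)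
      have := Int.emod_lt_of_pos (2 * B₀ + p - 1) (b := 2 * p) (by omega)
      nlinarith
  set B := B₀ + k * p with hB
  set R := R₀ + 2 * k * B₀ + k ^ 2 * p with hR
  have h : (p : ℤ) * R = B ^ 2 + D := by rw [hB, hR]; linear_combination h₀
  have hC : formClass (p : ℤ) B = C := by rw [hB, formClass_add h₀, hC₀]
  have hRpos : 0 < R := by
    by_contra hn
    nlinarith [sq_nonneg B]
  have hflip : formClass R (-B) = C := by rw [formClass_flip h hppos, hC]
  have hpR : (p : ℤ) ≤ R := hmin R (-B) p hRpos (by linear_combination h) hflip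
  by_cases hcase : (p : ℤ) = R ∧ B < 0
  · refine ⟨p, -B, R, by linear_combination h, ⟨hppos, by omega, by omega, hpR, by omega⟩, ?_⟩
    rw [hcase.1]; exact hflip
  · exact ⟨p, B, R, h, ⟨hppos, hk1, hk2, hpR, fun e => by
      by_contra hn; exact hcase ⟨e, by omega⟩⟩, hC⟩

end ReducedForms

section FormUniqueness

variable {D : ℕ}

lemma redForm_value_ge {P B R m n : ℤ} (h : RedForm P B R) (hmn : m ≠ 0 ∨ n ≠ 0) :
    P ≤ P * m ^ 2 + 2 * B * m * n + R * n ^ 2 := by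
  obtain ⟨hP, h1, h2, h3, -⟩ := h
  have h4 : -(P * |m * n|) ≤ 2 * B * (m * n) := by
    have := abs_mul (2 * B) (m * n)
    have h5 : |2 * B| ≤ P := abs_le.2 ⟨by linarith, h2⟩
    have h6 := neg_abs_le (2 * B * (m * n))
    have := mul_le_mul_of_nonneg_right h5 (abs_nonneg (m * n))
    linarith
  have h5 : 1 ≤ m ^ 2 - |m * n| + n ^ 2 := by
    rw [abs_mul, ← sq_abs m, ← sq_abs n]
    rcases hmn with h | h
    · have := Int.one_le_abs h
      have := abs_nonneg n
      nlinarith [sq_nonneg (|m| - |n|), sq_nonneg (|n| - 1)]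
    · have := Int.one_le_abs h
      have := abs_nonneg m
      nlinarith [sq_nonneg (|m| - |n|), sq_nonneg (|m| - 1)]
  nlinarith [mul_le_mul_of_nonneg_right h3 (sq_nonneg n)]

lemma redForm_value_eq {P B R m n : ℤ} (h : RedForm P B R) (hPR : P < R)
    (he : P * m ^ 2 + 2 * B * m * n + R * n ^ 2 = P) : n = 0 ∧ (m = 1 ∨ m = -1) := by
  have hn : n = 0 := by
    by_contra hn
    have h1 : RedForm P B P ∨ B < 0 := by
      by_cases hB : B < 0
      · exact Or.inr hB
      · exact Or.inl ⟨h.1, h.2.1, h.2.2.1, le_refl _, fun _ => by omega⟩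
    have h2 : P ≤ P * m ^ 2 + 2 * B * m * n + P * n ^ 2 := by
      rcases h1 with h1 | h1
      · exact redForm_value_ge h1 (Or.inr hn)
      · have h3 : RedForm P (-B) P :=
          ⟨h.1, by linarith [h.2.1, h.1], by linarith [h.2.1], le_refl _, fun _ => by omega⟩
        have := redForm_value_ge h3 (m := m) (n := -n) (Or.inr (neg_ne_zero.2 hn))
        nlinarith
    have : 0 < n ^ 2 := by positivity
    nlinarith
  subst hn
  refine ⟨rfl, ?_⟩
  have hP := h.1
  have h2 : P * (m ^ 2 - 1) = 0 := by linear_combination he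
  rcases mul_eq_zero.1 h2 with h3 | h3
  · omega
  · have : (m - 1) * (m + 1) = 0 := by linear_combination h3
    rcases mul_eq_zero.1 this with h | h
    · left; linarith
    · right; linarith

lemma norm_formIdeal_elem {P B R m n : ℤ} (h : P * R = B ^ 2 + D) :
    (⟨m * P + n * B, n⟩ : ℤ√(-(D : ℤ))).norm = P * (P * m ^ 2 + 2 * B * m * n + R * n ^ 2) := by
  rw [Zsqrtd.norm_def]
  linear_combination (-n ^ 2) * h

lemma map_zconj_span (x : ℤ√(-(D : ℤ))) :
    (Ideal.span {x}).map (zconj D) = Ideal.span {zconj D x} := by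
  rw [Ideal.map_span, Set.image_singleton]

section Unique

variable {P B R P' B' R' : ℤ} {x y : ℤ√(-(D : ℤ))}

lemma norm_mul_eq (hD : Squarefree D) (hD4 : D % 4 = 2)
    (h : P * R = B ^ 2 + D) (h' : P' * R' = B' ^ 2 + D) (hP : 0 < P) (hP' : 0 < P')
    (hx : x ≠ 0) (hy : y ≠ 0)
    (e : Ideal.span {x} * formIdeal D P B = Ideal.span {y} * formIdeal D P' B') :
    x.norm * P = y.norm * P' := by
  have hD0 : 0 < D := by omega
  have e2 := congrArg (Ideal.map (zconj D)) e
  rw [Ideal.map_mul, Ideal.map_mul, map_zconj_span, map_zconj_span] at e2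
  have e3 : (Ideal.span {x} * Ideal.span {zconj D x}) *
      (formIdeal D P B * (formIdeal D P B).map (zconj D)) =
      (Ideal.span {y} * Ideal.span {zconj D y}) *
      (formIdeal D P' B' * (formIdeal D P' B').map (zconj D)) := by
    calc _ = (Ideal.span {x} * formIdeal D P B) *
          (Ideal.span {zconj D x} * (formIdeal D P B).map (zconj D)) := by ring
      _ = _ := by rw [e, e2]; ring
  rw [formIdeal_mul_conj hD hD4 h, formIdeal_mul_conj hD hD4 h', Ideal.span_singleton_mul_span_singleton,
    Ideal.span_singleton_mul_span_singleton, Ideal.span_singleton_mul_span_singleton,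
    Ideal.span_singleton_mul_span_singleton, mul_zconj, mul_zconj, ← Int.cast_mul, ← Int.cast_mul] at e3
  apply int_eq_of_span_eq _ _ e3
  · exact (mul_pos (zsqrtd_norm_pos hD0 hx) hP).le
  · exact (mul_pos (zsqrtd_norm_pos hD0 hy) hP').le

lemma exists_repr_of_span_eq (h' : P' * R' = B' ^ 2 + D)
    (e : Ideal.span {x} * formIdeal D P B = Ideal.span {y} * formIdeal D P' B') :
    ∃ m n : ℤ, x * (P : ℤ√(-(D : ℤ))) = y * ⟨m * P' + n * B', n⟩ := by
  have h1 : x * (P : ℤ√(-(D : ℤ))) ∈ Ideal.span {y} * formIdeal D P' B' := by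
    rw [← e]
    exact Ideal.mul_mem_mul (Ideal.mem_span_singleton_self x) (Ideal.subset_span (by simp))
  obtain ⟨z, hz, h2⟩ := Ideal.mem_span_singleton_mul.1 h1
  obtain ⟨m, n, rfl⟩ := (mem_formIdeal h').1 hz
  exact ⟨m, n, h2.symm⟩

lemma norm_intCast_sq (P : ℤ) : (P : ℤ√(-(D : ℤ))).norm = P ^ 2 := by
  rw [Zsqrtd.norm_def]; simp; ring

lemma form_value_eq (hD0 : 0 < D) (h' : P' * R' = B' ^ 2 + D) (hP' : 0 < P') (hy : y ≠ 0)
    (hxy : x.norm * P = y.norm * P') {m n : ℤ}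
    (e : x * (P : ℤ√(-(D : ℤ))) = y * ⟨m * P' + n * B', n⟩) :
    P' * m ^ 2 + 2 * B' * m * n + R' * n ^ 2 = P := by
  have h1 := congrArg Zsqrtd.norm e
  rw [Zsqrtd.norm_mul, Zsqrtd.norm_mul, norm_formIdeal_elem h', norm_intCast_sq] at h1
  have h2 := zsqrtd_norm_pos hD0 hy
  have h3 : y.norm * P' ≠ 0 := (mul_pos h2 hP').ne'
  apply mul_left_cancel₀ h3
  linear_combination (-1 : ℤ) * h1 + P * hxy

lemma value_ge_of_span_eq (hD : Squarefree D) (hD4 : D % 4 = 2)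
    (h : P * R = B ^ 2 + D) (h' : P' * R' = B' ^ 2 + D) (hr : RedForm P B R)
    (hr' : RedForm P' B' R') (hx : x ≠ 0) (hy : y ≠ 0)
    (e : Ideal.span {x} * formIdeal D P B = Ideal.span {y} * formIdeal D P' B') : P' ≤ P := by
  have hxy := norm_mul_eq hD hD4 h h' hr.1 hr'.1 hx hy e
  obtain ⟨m, n, hmn⟩ := exists_repr_of_span_eq h' e
  have hv := form_value_eq (by omega) h' hr'.1 hy hxy hmn
  rw [← hv]
  apply redForm_value_ge hr'
  by_contra hc
  push Not at hc
  rw [hc.1, hc.2] at hv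
  have := hr.1
  simp at hv
  omega

lemma eq_of_span_eq_of_lt [IsDomain (ℤ√(-(D : ℤ)))] (hD : Squarefree D) (hD4 : D % 4 = 2)
    (h : P * R = B ^ 2 + D) (h' : P' * R' = B' ^ 2 + D) (hr : RedForm P B R)
    (hr' : RedForm P' B' R') (hx : x ≠ 0) (hy : y ≠ 0)
    (e : Ideal.span {x} * formIdeal D P B = Ideal.span {y} * formIdeal D P' B') (hPP : P = P')
    (hlt : P' < R') : B = B' := by
  have hxy := norm_mul_eq hD hD4 h h' hr.1 hr'.1 hx hy e
  obtain ⟨m, n, hmn⟩ := exists_repr_of_span_eq h' e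
  have hv := form_value_eq (by omega) h' hr'.1 hy hxy hmn
  rw [hPP] at hv
  obtain ⟨rfl, hm⟩ := redForm_value_eq hr' hlt hv
  have hP0 : (P : ℤ√(-(D : ℤ))) ≠ 0 := by
    intro h0
    have h1 := congrArg Zsqrtd.re h0
    have := hr.1
    simp at h1; omega
  have hspan : Ideal.span {x} = Ideal.span {y} := by
    rcases hm with rfl | rfl
    · have e1 : x * (P : ℤ√(-(D : ℤ))) = y * P := by
        rw [hmn, hPP]; congr 1; ext <;> simp
      rw [mul_right_cancel₀ hP0 e1]
    · have e1 : x * (P : ℤ√(-(D : ℤ))) = (-y) * P := by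
        rw [hmn, hPP]; ext <;> simp
      rw [mul_right_cancel₀ hP0 e1, Ideal.span_singleton_neg]
  rw [hspan] at e
  have e2 : formIdeal D P B = formIdeal D P' B' := by
    ext z
    have := Ideal.ext_iff.1 e (y * z)
    rwa [Ideal.mem_span_singleton_mul, Ideal.mem_span_singleton_mul,
      exists_congr (fun w => and_congr_right (fun _ => mul_right_inj' hy)),
      exists_congr (fun w => and_congr_right (fun _ => mul_right_inj' hy)), exists_eq_right,
      exists_eq_right] at this
  have h1 : (⟨B, 1⟩ : ℤ√(-(D : ℤ))) ∈ formIdeal D P' B' := by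
    rw [← e2]; exact Ideal.subset_span (by simp)
  obtain ⟨k, n, hk⟩ := (mem_formIdeal h').1 h1
  have hk1 : B = k * P' + n * B' := congrArg Zsqrtd.re hk
  have hk2 : 1 = n := congrArg Zsqrtd.im hk
  subst hk2
  obtain ⟨p1, p2, p3, -⟩ := hr
  obtain ⟨q1, q2, q3, -⟩ := hr'
  have : k = 0 := by
    by_contra hk0
    rcases lt_or_gt_of_ne hk0 with hlt | hgt <;> nlinarith
  rw [hk1, this]; ring

lemma redForm_unique [IsDedekindDomain (ℤ√(-(D : ℤ)))] (hD : Squarefree D) (hD4 : D % 4 = 2)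
    (h : P * R = B ^ 2 + D) (h' : P' * R' = B' ^ 2 + D) (hr : RedForm P B R)
    (hr' : RedForm P' B' R') (e : formClass (D := D) P B = formClass P' B') :
    P = P' ∧ B = B' ∧ R = R' := by
  obtain ⟨x, y, hx, hy, e⟩ := formClass_eq_iff.1 e
  have hPP : P = P' := le_antisymm (value_ge_of_span_eq hD hD4 h' h hr' hr hy hx e.symm)
    (value_ge_of_span_eq hD hD4 h h' hr hr' hx hy e)
  have hBB : B = B' := by
    by_cases h1 : P' < R'
    · exact eq_of_span_eq_of_lt hD hD4 h h' hr hr' hx hy e hPP h1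
    by_cases h2 : P < R
    · exact (eq_of_span_eq_of_lt hD hD4 h' h hr' hr hy hx e.symm hPP.symm h2).symm
    have e1 : P' = R' := le_antisymm hr'.2.2.2.1 (not_lt.1 h1)
    have e2 : P = R := le_antisymm hr.2.2.2.1 (not_lt.1 h2)
    have b1 := hr'.2.2.2.2 e1
    have b2 := hr.2.2.2.2 e2
    rw [← e1] at h'
    rw [← e2, hPP] at h
    have : (B - B') * (B + B') = 0 := by linear_combination h' - h
    rcases mul_eq_zero.1 this with h | h <;> omega
  refine ⟨hPP, hBB, ?_⟩
  rw [hBB, ← h', hPP] at h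
  exact mul_left_cancel₀ hr'.1.ne' h

end Unique

end FormUniqueness

section CubicForms

/-- The first coefficient of the Hessian of the binary cubic form with coefficients
`f 0`, `3 * f 1`, `3 * f 2`, `f 3`. -/
def hP {S : Type*} [CommRing S] (f : Fin 4 → S) : S := f 1 ^ 2 - f 0 * f 2

/-- The middle coefficient of the Hessian. -/
def hQ {S : Type*} [CommRing S] (f : Fin 4 → S) : S := f 1 * f 2 - f 0 * f 3

/-- The last coefficient of the Hessian. -/
def hR {S : Type*} [CommRing S] (f : Fin 4 → S) : S := f 2 ^ 2 - f 1 * f 3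

/-- Minus the discriminant of the Hessian. -/
def dsc {S : Type*} [CommRing S] (f : Fin 4 → S) : S :=
  4 * hP f * hR f - hQ f ^ 2

/-- A cubic form whose Hessian is reduced. -/
def RedCubic (f : Fin 4 → ℤ) : Prop :=
  0 < hP f ∧ -hP f < hQ f ∧ hQ f ≤ hP f ∧ hP f ≤ hR f ∧ (hP f = hR f → 0 ≤ hQ f)

variable {D : ℕ} {P B R : ℤ}

lemma formIdeal_cube (P B : ℤ) : formIdeal D P B ^ 3 = Ideal.span
    {(P : ℤ√(-(D : ℤ))) ^ 3, (P : ℤ√(-(D : ℤ))) ^ 2 * ⟨B, 1⟩, (P : ℤ√(-(D : ℤ))) * ⟨B, 1⟩ ^ 2,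
      ⟨B, 1⟩ ^ 3} := by
  unfold formIdeal
  rw [pow_succ, pow_two, Ideal.span_pair_mul_span_pair]
  rw [Ideal.span_mul_span']
  congr 1
  ext x
  simp only [Set.mem_mul, Set.mem_insert_iff, Set.mem_singleton_iff]
  constructor
  · rintro ⟨u, (rfl | rfl | rfl | rfl), v, (rfl | rfl), rfl⟩ <;> ring_nf <;> simp
  · rintro (rfl | rfl | rfl | rfl)
    · exact ⟨_, Or.inl rfl, _, Or.inl rfl, by ring⟩
    · exact ⟨_, Or.inl rfl, _, Or.inr rfl, by ring⟩
    · exact ⟨_, Or.inr (Or.inr (Or.inr rfl)), _, Or.inl rfl, by ring⟩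
    · exact ⟨_, Or.inr (Or.inr (Or.inr rfl)), _, Or.inr rfl, by ring⟩

/-- The generator of the cube of the ideal attached to a cubic form. -/
def cubeGen (D : ℕ) (P B : ℤ) (f : Fin 4 → ℤ) : ℤ√(-(D : ℤ)) := ⟨P * f 1 - f 0 * B, -f 0⟩

lemma norm_cubeGen {f : Fin 4 → ℤ} (h : P * R = B ^ 2 + D) (h1 : hP f = P) (h2 : hQ f = 2 * B)
    (h3 : hR f = R) : (cubeGen D P B f).norm = P ^ 3 := by
  rw [Zsqrtd.norm_def, cubeGen]
  simp only [hP, hQ, hR] at h1 h2 h3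
  subst h1 h3
  have h' : (D : ℤ) = (f 1 ^ 2 - f 0 * f 2) * (f 2 ^ 2 - f 1 * f 3) - B ^ 2 := by linarith
  rw [h']
  simp only
  linear_combination (f 0) * (f 1) * (f 1 ^ 2 - f 0 * f 2) * h2

lemma span_cubeGen [IsDedekindDomain (ℤ√(-(D : ℤ)))] (hD : Squarefree D) (hD4 : D % 4 = 2)
    {f : Fin 4 → ℤ} (h : P * R = B ^ 2 + D) (h0 : 0 < P) (h1 : hP f = P) (h2 : hQ f = 2 * B)
    (h3 : hR f = R) : formIdeal D P B ^ 3 = Ideal.span {cubeGen D P B f} := by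
  have hN := norm_cubeGen h h1 h2 h3
  have hle : formIdeal D P B ^ 3 ≤ Ideal.span {cubeGen D P B f} := by
    rw [formIdeal_cube, Ideal.span_le]
    simp only [hP, hQ, hR] at h1 h2 h3
    have hDe : (D : ℤ) = P * R - B ^ 2 := by linarith
    intro x hx
    simp only [Set.mem_insert_iff, Set.mem_singleton_iff] at hx
    simp only [SetLike.mem_coe, Ideal.mem_span_singleton, cubeGen]
    rcases hx with rfl | rfl | rfl | rfl
    · refine ⟨⟨P * f 1 - f 0 * B, f 0⟩, ?_⟩
      have e := mul_zconj (cubeGen D P B f)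
      rw [hN, zconj_apply] at e
      simp only [cubeGen, neg_neg] at e
      rw [e]; simp
    · refine ⟨⟨P * f 2 - f 1 * B, f 1⟩, ?_⟩
      ext
      · simp [pow_two, hDe]
        grind
      · simp [pow_two]
        grind
    · refine ⟨⟨P * f 3 - f 2 * B, f 2⟩, ?_⟩
      ext
      · simp [pow_two, hDe]
        grind
      · simp [pow_two]
        grind
    · refine ⟨⟨B * f 3 - f 2 * R, f 3⟩, ?_⟩
      ext
      · simp [pow_succ, hDe]
        grind
      · simp [pow_succ, hDe]
        grind
  obtain ⟨J, hJ⟩ := Ideal.dvd_iff_le.2 hle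
  have hJ' := congrArg (Ideal.map (zconj D)) hJ
  rw [Ideal.map_mul, Ideal.map_pow, map_zconj_span] at hJ'
  have e1 : Ideal.span {((P ^ 3 : ℤ) : ℤ√(-(D : ℤ)))} * (J * J.map (zconj D)) =
      Ideal.span {((P ^ 3 : ℤ) : ℤ√(-(D : ℤ)))} * 1 := by
    have e2 : (formIdeal D P B * (formIdeal D P B).map (zconj D)) ^ 3 =
        Ideal.span {((P ^ 3 : ℤ) : ℤ√(-(D : ℤ)))} := by
      rw [formIdeal_mul_conj hD hD4 h, Ideal.span_singleton_pow]; push_cast; rfl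
    rw [mul_one]
    nth_rw 2 [← e2]
    rw [mul_pow, hJ, hJ', ← hN, ← mul_zconj, ← Ideal.span_singleton_mul_span_singleton]
    ring
  have hne : Ideal.span {((P ^ 3 : ℤ) : ℤ√(-(D : ℤ)))} ≠ 0 := by
    intro hz
    rw [Ideal.zero_eq_bot, Ideal.span_singleton_eq_bot] at hz
    have h4 := congrArg Zsqrtd.re hz
    rw [Zsqrtd.re_intCast] at h4
    have h5 : 0 < P ^ 3 := by positivity
    exact h5.ne' h4
  have e3 := mul_left_cancel₀ hne e1
  have e4 : J = 1 := by
    have : J ∣ 1 := ⟨_, e3.symm⟩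
    rw [Ideal.one_eq_top]
    exact Ideal.isUnit_iff.1 (isUnit_of_dvd_one this)
  rw [hJ, e4, mul_one]

lemma exists_cubic_of_span_eq [IsDomain (ℤ√(-(D : ℤ)))] (hD : Squarefree D) (hD4 : D % 4 = 2)
    (h : P * R = B ^ 2 + D) (h0 : 0 < P) {δ : ℤ√(-(D : ℤ))}
    (hδ : formIdeal D P B ^ 3 = Ideal.span {δ}) :
    ∃ f : Fin 4 → ℤ, hP f = P ∧ hQ f = 2 * B ∧ hR f = R ∧ cubeGen D P B f = δ := by
  have hPne : ((P : ℤ) : ℤ√(-(D : ℤ))) ≠ 0 := by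
    intro hz
    have := congrArg Zsqrtd.re hz
    simp at this; omega
  have hδ0 : δ ≠ 0 := by
    rintro rfl
    rw [formIdeal_cube] at hδ
    have h1 : (P : ℤ√(-(D : ℤ))) ^ 3 ∈ Ideal.span {(0 : ℤ√(-(D : ℤ)))} := by
      rw [← hδ]; exact Ideal.subset_span (by simp)
    rw [Ideal.mem_span_singleton, zero_dvd_iff] at h1
    exact hPne (pow_eq_zero_iff (by norm_num) |>.1 h1)
  have hN : δ.norm = P ^ 3 := by
    have e1 := congrArg (Ideal.map (zconj D)) hδ
    rw [Ideal.map_pow, map_zconj_span] at e1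
    apply int_eq_of_span_eq (zsqrtd_norm_pos (by omega) hδ0).le (by positivity) (D := D)
    rw [← mul_zconj, ← Ideal.span_singleton_mul_span_singleton, ← e1, ← hδ, ← mul_pow,
      formIdeal_mul_conj hD hD4 h, Ideal.span_singleton_pow]
    push_cast; rfl
  have hmem : ∀ x ∈ ({(P : ℤ√(-(D : ℤ))) ^ 3, (P : ℤ√(-(D : ℤ))) ^ 2 * ⟨B, 1⟩,
      (P : ℤ√(-(D : ℤ))) * ⟨B, 1⟩ ^ 2, ⟨B, 1⟩ ^ 3} : Set (ℤ√(-(D : ℤ)))), δ ∣ x := by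
    intro x hx
    rw [← Ideal.mem_span_singleton, ← hδ, formIdeal_cube]
    exact Ideal.subset_span hx
  have e0 : (P : ℤ√(-(D : ℤ))) ^ 3 = δ * zconj D δ := by
    rw [mul_zconj, hN]; push_cast; rfl
  obtain ⟨ε₁, e1⟩ := hmem ((P : ℤ√(-(D : ℤ))) ^ 2 * ⟨B, 1⟩) (by simp)
  obtain ⟨ε₂, e2⟩ := hmem ((P : ℤ√(-(D : ℤ))) * ⟨B, 1⟩ ^ 2) (by simp)
  have r1 : (P : ℤ√(-(D : ℤ))) * ε₁ = ⟨B, 1⟩ * zconj D δ := by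
    apply mul_left_cancel₀ hδ0
    linear_combination (⟨B, 1⟩ : ℤ√(-(D : ℤ))) * e0 - (P : ℤ√(-(D : ℤ))) * e1
  have r2 : (P : ℤ√(-(D : ℤ))) * ε₂ = ⟨B, 1⟩ * ε₁ := by
    apply mul_left_cancel₀ hδ0
    linear_combination (⟨B, 1⟩ : ℤ√(-(D : ℤ))) * e1 - (P : ℤ√(-(D : ℤ))) * e2
  obtain ⟨ε₃, e3⟩ := hmem ((⟨B, 1⟩ : ℤ√(-(D : ℤ))) ^ 3) (by simp)
  have r3 : (P : ℤ√(-(D : ℤ))) * ε₃ = ⟨B, 1⟩ * ε₂ := by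
    apply mul_left_cancel₀ hδ0
    linear_combination (⟨B, 1⟩ : ℤ√(-(D : ℤ))) * e2 - (P : ℤ√(-(D : ℤ))) * e3
  obtain ⟨l, a⟩ := δ
  obtain ⟨E1, b⟩ := ε₁
  obtain ⟨E2, c⟩ := ε₂
  obtain ⟨E3, d⟩ := ε₃
  obtain ⟨a, rfl⟩ : ∃ a', a = -a' := ⟨-a, by ring⟩
  rw [zconj_apply] at r1
  have r1r := congrArg Zsqrtd.re r1
  have r1i := congrArg Zsqrtd.im r1
  have r2r := congrArg Zsqrtd.re r2
  have r2i := congrArg Zsqrtd.im r2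
  have r3i := congrArg Zsqrtd.im r3
  have hN' := hN
  rw [Zsqrtd.norm_def] at hN'
  simp at r1r r1i r2r r2i r3i hN'
  have hP0 := h0.ne'
  have c1 : P * c = 2 * B * b - R * a := by
    apply mul_left_cancel₀ hP0
    linear_combination P * r2i + r1r - B * r1i + a * h
  have c2 : P * d = 2 * B * c - R * b := by
    apply mul_left_cancel₀ hP0
    linear_combination P * r3i + r2r - B * r2i + b * h
  have hb : b ^ 2 - a * c = P := by
    apply mul_left_cancel₀ (pow_ne_zero 2 hP0)
    linear_combination (P * b + B * a + l - 2 * a * B) * r1i - P * a * c1 + hN' + a ^ 2 * h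
  have hb2 : b * c - a * d = 2 * B := by
    apply mul_left_cancel₀ hP0
    linear_combination b * c1 - a * c2 + 2 * B * hb
  have hb3 : c ^ 2 - b * d = R := by
    apply mul_left_cancel₀ hP0
    linear_combination c * c1 - b * c2 + R * hb
  refine ⟨![a, b, c, d], hb, hb2, hb3, ?_⟩
  ext
  · simp [cubeGen]; linarith
  · simp [cubeGen]

end CubicForms

section ClassNumber

variable {D : ℕ}

lemma formClass_pow_three_eq_one_iff [IsDedekindDomain (ℤ√(-(D : ℤ)))] {P B : ℤ} :
    (formClass (D := D) P B) ^ 3 = 1 ↔ ∃ δ, formIdeal D P B ^ 3 = Ideal.span {δ} := by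
  unfold formClass
  rw [← map_pow, ClassGroup.mk0_eq_one_iff]
  constructor
  · rintro ⟨δ, h⟩
    exact ⟨δ, by simpa using h⟩
  · rintro ⟨δ, h⟩
    exact ⟨δ, by simpa using h⟩

lemma hess_rel_c {S : Type*} [CommRing S] (f : Fin 4 → S) : hP f * f 2 = hQ f * f 1 - hR f * f 0 := by
  simp only [hP, hQ, hR]; ring

lemma hess_rel_d {S : Type*} [CommRing S] (f : Fin 4 → S) : hP f * f 3 = hQ f * f 2 - hR f * f 1 := by
  simp only [hP, hQ, hR]; ring

lemma hP_neg {S : Type*} [CommRing S] (f : Fin 4 → S) : hP (-f) = hP f := by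
  simp [hP]

lemma hQ_neg {S : Type*} [CommRing S] (f : Fin 4 → S) : hQ (-f) = hQ f := by
  simp [hQ]

lemma hR_neg {S : Type*} [CommRing S] (f : Fin 4 → S) : hR (-f) = hR f := by
  simp [hR]

lemma dsc_neg {S : Type*} [CommRing S] (f : Fin 4 → S) : dsc (-f) = dsc f := by
  simp [dsc, hP_neg, hQ_neg, hR_neg]

lemma RedCubic.neg {f : Fin 4 → ℤ} (h : RedCubic f) : RedCubic (-f) := by
  simpa only [RedCubic, hP_neg, hQ_neg, hR_neg] using h

lemma hess_of_dsc {f : Fin 4 → ℤ} (h : dsc f = 4 * D) :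
    hQ f = 2 * (hQ f / 2) ∧ hP f * hR f = (hQ f / 2) ^ 2 + D := by
  have h1 : hQ f % 2 = 0 := by
    rcases Int.even_or_odd' (hQ f) with ⟨k, hk | hk⟩
    · omega
    · exfalso
      simp only [dsc] at h
      rw [hk] at h
      ring_nf at h
      omega
  have h2 : hQ f = 2 * (hQ f / 2) := by omega
  refine ⟨h2, ?_⟩
  simp only [dsc] at h
  rw [h2] at h
  linarith

lemma cubic_ext {f g : Fin 4 → ℤ} (h0 : hP f ≠ 0) (h1 : hP f = hP g) (h2 : hQ f = hQ g)
    (h3 : hR f = hR g) (h4 : f 0 = g 0) (h5 : f 1 = g 1) : f = g := by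
  have e1 := hess_rel_c f
  have e2 := hess_rel_c g
  have e3 := hess_rel_d f
  have e4 := hess_rel_d g
  have h6 : f 2 = g 2 := by
    apply mul_left_cancel₀ h0
    rw [e1, h1, e2, h2, h3, h4, h5]
  have h7 : f 3 = g 3 := by
    apply mul_left_cancel₀ h0
    rw [e3, h1, e4, h2, h3, h6, h5]
  ext i
  fin_cases i <;> assumption

lemma cubic_lead_zero (hD : Squarefree D) (hD4 : D % 4 = 2) {f : Fin 4 → ℤ} :
    (RedCubic f ∧ dsc f = 4 * D ∧ f 0 = 0 ∧ 0 < f 1) ↔ f = ![0, 1, 0, -(D : ℤ)] := by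
  constructor
  · rintro ⟨⟨r1, r2, r3, -, -⟩, h, h0, hb⟩
    obtain ⟨hq, -⟩ := hess_of_dsc h
    simp only [hP, hQ, hR, dsc, h0] at r1 r2 r3 h hq
    ring_nf at r1 r2 r3 h hq
    have hbo : f 1 % 2 = 1 := by
      by_contra hne
      obtain ⟨k, hk⟩ : ∃ k, f 1 = 2 * k := ⟨f 1 / 2, by omega⟩
      have e : (D : ℤ) = k ^ 2 * (3 * f 2 ^ 2 - 8 * k * f 3) := by
        rw [hk] at h; linarith
      have hk1 : ((k.natAbs * k.natAbs : ℕ) : ℤ) ∣ D := by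
        rw [e]; push_cast
        rw [← pow_two, sq_abs]; exact Dvd.intro _ rfl
      have := Nat.isUnit_iff.1 (hD _ (by exact_mod_cast hk1))
      have hk2 : k = 1 := by omega
      rw [hk2] at e
      rcases Int.even_or_odd' (f 2) with ⟨m, hm | hm⟩ <;> rw [hm] at e <;> ring_nf at e <;> omega
    have hb1 : f 1 = 1 := by
      obtain ⟨k, hk⟩ : ∃ k, f 1 = 2 * k + 1 := ⟨f 1 / 2, by omega⟩
      have hd : f 1 ^ 2 ∣ 4 * D := ⟨3 * f 2 ^ 2 - 4 * f 1 * f 3, by linarith⟩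
      have hco : IsCoprime (f 1 ^ 2) (4 : ℤ) := by
        have h2 : IsCoprime (f 1) (2 : ℤ) := ⟨1, -k, by rw [hk]; ring⟩
        exact (h2.pow (m := 2) (n := 2))
      have hd2 := hco.dvd_of_dvd_mul_left hd
      have hk1 : (((f 1).natAbs * (f 1).natAbs : ℕ) : ℤ) ∣ D := by
        push_cast
        rwa [← pow_two, sq_abs]
      have := Nat.isUnit_iff.1 (hD _ (by exact_mod_cast hk1))
      omega
    rw [hb1] at r1 r2 r3 h hq
    have hc : f 2 = 0 := by omega
    rw [hc] at h
    ext i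
    fin_cases i
    · simpa using h0
    · simpa using hb1
    · simpa using hc
    · simp; linarith
  · rintro rfl
    have : (2 : ℤ) ≤ D := by omega
    refine ⟨⟨?_, ?_, ?_, ?_, ?_⟩, ?_, ?_, ?_⟩ <;> simp [hP, hQ, hR, dsc]
    omega

theorem h3_eq_one_add (hD : Squarefree D) (hD4 : D % 4 = 2) :
    {f : Fin 4 → ℤ | RedCubic f ∧ dsc f = 4 * D ∧ 0 < f 0}.Finite ∧ h3 (-(D : ℤ)) =
      1 + {f : Fin 4 → ℤ | RedCubic f ∧ dsc f = 4 * D ∧ 0 < f 0}.ncard := by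
  have := zsqrtd_isDedekindDomain D hD hD4
  have := quadField_numberField D
  set S := {f : Fin 4 → ℤ | RedCubic f ∧ dsc f = 4 * D ∧ (0 < f 0 ∨ (f 0 = 0 ∧ 0 < f 1))} with hS
  set S' := {f : Fin 4 → ℤ | RedCubic f ∧ dsc f = 4 * D ∧ 0 < f 0} with hS'
  have hSS : S = insert ![0, 1, 0, -(D : ℤ)] S' := by
    ext f
    rw [Set.mem_insert_iff, ← cubic_lead_zero hD hD4]
    simp only [hS, hS', Set.mem_ofPred_eq]
    tauto
  have hnot : ![0, 1, 0, -(D : ℤ)] ∉ S' := by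
    simp [hS']
  have hfinT : Finite {x : ClassGroup (ℤ√(-(D : ℤ))) // x ^ 3 = 1} := by
    have : Finite (ClassGroup (ℤ√(-(D : ℤ)))) :=
      Finite.of_equiv _ (ClassGroup.mulEquiv (zsqrtdEquiv D hD hD4)).symm.toEquiv
    infer_instance
  have hmem : ∀ f ∈ S, (formClass (D := D) (hP f) (hQ f / 2)) ^ 3 = 1 := by
    rintro f ⟨hr, hd, -⟩
    obtain ⟨h1, h2⟩ := hess_of_dsc hd
    exact formClass_pow_three_eq_one_iff.2 ⟨_, span_cubeGen hD hD4 h2 hr.1 rfl h1 rfl⟩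
  have hred : ∀ f ∈ S, RedForm (hP f) (hQ f / 2) (hR f) := by
    rintro f ⟨hr, hd, -⟩
    obtain ⟨h1, h2⟩ := hess_of_dsc hd
    obtain ⟨r1, r2, r3, r4, r5⟩ := hr
    exact ⟨r1, by omega, by omega, r4, fun e => by have := r5 e; omega⟩
  let Ψ : S → {x : ClassGroup (ℤ√(-(D : ℤ))) // x ^ 3 = 1} := fun f => ⟨_, hmem f.1 f.2⟩
  have hinj : Function.Injective Ψ := by
    rintro ⟨f, hf⟩ ⟨g, hg⟩ hfg
    have hfg' : formClass (D := D) (hP f) (hQ f / 2) = formClass (hP g) (hQ g / 2) :=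
      congrArg Subtype.val hfg
    obtain ⟨f1, f2⟩ := hess_of_dsc hf.2.1
    obtain ⟨g1, g2⟩ := hess_of_dsc hg.2.1
    obtain ⟨e1, e2, e3⟩ := redForm_unique hD hD4 f2 g2 (hred f hf) (hred g hg) hfg'
    have s1 := span_cubeGen hD hD4 f2 hf.1.1 rfl f1 rfl
    have s2 := span_cubeGen hD hD4 g2 hg.1.1 rfl g1 rfl
    rw [e1, e2, s2] at s1
    have hpos := hg.1.1
    apply Subtype.ext
    rcases zsqrtd_eq_of_span_eq (by omega) s1 with h | h
    · have i1 := congrArg Zsqrtd.re h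
      have i2 := congrArg Zsqrtd.im h
      simp only [cubeGen] at i1 i2
      have i3 : f 0 = g 0 := by linarith
      refine cubic_ext hf.1.1.ne' e1 (by rw [f1, g1, e2]) e3 i3 ?_
      apply mul_left_cancel₀ hpos.ne'
      rw [i3] at i1
      linarith
    · exfalso
      have i1 := congrArg Zsqrtd.re h
      have i2 := congrArg Zsqrtd.im h
      simp only [cubeGen, Zsqrtd.re_neg, Zsqrtd.im_neg] at i1 i2
      have i3 : g 0 = - f 0 := by linarith
      have i4 : g 1 = - f 1 := by
        apply mul_left_cancel₀ hpos.ne'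
        rw [i3] at i1
        linarith
      have q1 := hf.2.2
      have q2 := hg.2.2
      omega
  have hsurj : Function.Surjective Ψ := by
    rintro ⟨C, hC⟩
    obtain ⟨P, B, R, h, hr, rfl⟩ := exists_redForm (by omega) C
    obtain ⟨δ, hδ⟩ := formClass_pow_three_eq_one_iff.1 hC
    obtain ⟨f, h1, h2, h3, -⟩ := exists_cubic_of_span_eq hD hD4 h hr.1 hδ
    have hrf : RedCubic f := by
      obtain ⟨r1, r2, r3, r4, r5⟩ := hr
      rw [RedCubic, h1, h2, h3]
      exact ⟨r1, r2, r3, r4, fun e => by have := r5 e; omega⟩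
    have hdf : dsc f = 4 * D := by rw [dsc, h1, h2, h3]; linear_combination 4 * h
    have key : ∀ g ∈ S, hP g = P → hQ g = 2 * B → ∃ a, Ψ a = ⟨formClass P B, hC⟩ := by
      intro g hg g1 g2
      refine ⟨⟨g, hg⟩, Subtype.ext ?_⟩
      simp only [Ψ]
      rw [g1, g2]
      congr 1
      omega
    by_cases hs : 0 < f 0 ∨ (f 0 = 0 ∧ 0 < f 1)
    · exact key f ⟨hrf, hdf, hs⟩ h1 h2
    · refine key (-f) ⟨hrf.neg, by rw [dsc_neg, hdf], ?_⟩ (by rw [hP_neg, h1]) (by rw [hQ_neg, h2])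
      simp only [Pi.neg_apply]
      by_contra hn
      have z0 : f 0 = 0 := by omega
      have z1 : f 1 = 0 := by omega
      have := hrf.1
      simp [hP, z0, z1] at this
  have hbij : Function.Bijective Ψ := ⟨hinj, hsurj⟩
  have hfinS : S.Finite := Set.finite_coe_iff.1 (Finite.of_injective Ψ hinj)
  have hfinS' : S'.Finite := hfinS.subset (by rw [hSS]; exact Set.subset_insert _ _)
  refine ⟨hfinS', ?_⟩
  rw [h3_eq_card_zsqrtd D hD hD4, ← Nat.card_congr (Equiv.ofBijective Ψ hbij),
    Nat.card_coe_set_eq, hSS, Set.ncard_insert_of_notMem hnot hfinS', add_comm]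

end ClassNumber

section LocalDensity

/-- Quadruples as functions on `Fin 4`. -/
def finFourEquiv (S : Type*) : S × S × S × S ≃ (Fin 4 → S) where
  toFun x := ![x.1, x.2.1, x.2.2.1, x.2.2.2]
  invFun f := (f 0, f 1, f 2, f 3)
  left_inv x := rfl
  right_inv f := by ext i; fin_cases i <;> rfl

lemma card_dsc_eq_sum (S : Type*) [CommRing S] [Fintype S] :
    Nat.card {v : Fin 4 → S // dsc v = 0} =
      ∑ a : S, ∑ b : S, ∑ c : S, ∑ d : S, if dsc ![a, b, c, d] = 0 then 1 else 0 := by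
  rw [Nat.card_eq_fintype_card, Fintype.card_subtype, Finset.card_filter,
    ← (finFourEquiv S).sum_comp, Fintype.sum_prod_type]
  refine Finset.sum_congr rfl fun a _ => ?_
  rw [Fintype.sum_prod_type]
  refine Finset.sum_congr rfl fun b _ => ?_
  rw [Fintype.sum_prod_type]
  rfl

variable {S : Type*} [CommRing S] [Fintype S]

lemma sum_unit_linear {M : Type*} [AddCommMonoid M] {u : S} (hu : IsUnit u) (v : S) (F : S → M) :
    ∑ x, F (u * x + v) = ∑ x, F x := by
  obtain ⟨u, rfl⟩ := hu
  exact (u.mulLeft.trans (Equiv.addRight v)).sum_comp F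

lemma sum_ite_unit (F : S → ℕ) (x y : ℕ) (h1 : ∀ a, IsUnit a → F a = x)
    (h2 : ∀ a, ¬ IsUnit a → F a = y) :
    ∑ a, F a = Fintype.card {a : S // IsUnit a} * x + Fintype.card {a : S // ¬ IsUnit a} * y := by
  rw [← Finset.sum_filter_add_sum_filter_not Finset.univ (fun a : S => IsUnit a)]
  rw [Finset.sum_congr rfl (g := fun _ => x) (fun a ha => h1 a (Finset.mem_filter.1 ha).2)]
  rw [Finset.sum_congr (s₁ := Finset.univ.filter fun a : S => ¬ IsUnit a) rfl (g := fun _ => y)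
    (fun a ha => h2 a (Finset.mem_filter.1 ha).2)]
  simp [Fintype.card_subtype]

section SquareZero

local notation "𝓊" => Fintype.card {a : S // IsUnit a}
local notation "𝓂" => Fintype.card {a : S // ¬ IsUnit a}

lemma sum_ite_eq_zero_unit_linear {u : S} (hu : IsUnit u) (v : S) :
    (∑ x : S, if u * x + v = 0 then 1 else 0) = 1 := by
  rw [sum_unit_linear hu v (fun x => if x = 0 then 1 else 0)]
  simp

lemma sum_nonunit (F : S → ℕ) (y : ℕ) (h : ∀ a, ¬ IsUnit a → F a = y) :
    ∑ a : S, (if IsUnit a then 0 else F a) = 𝓂 * y := by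
  rw [sum_ite_unit _ 0 y (fun a h => if_pos h) (fun a ha => by rw [if_neg ha, h a ha])]
  simp

variable [Nontrivial S]

lemma sq_eq_zero_iff_not_isUnit {S : Type*} [CommRing S] [Nontrivial S]
    (hN : ∀ x y : S, ¬ IsUnit x → ¬ IsUnit y → x * y = 0) (x : S) : x ^ 2 = 0 ↔ ¬ IsUnit x := by
  constructor
  · intro h hu
    have := hu.pow 2
    rw [h] at this
    exact not_isUnit_zero this
  · intro h
    rw [pow_two]; exact hN x x h h

lemma sum_cusp_curve (hN : ∀ x y : S, ¬ IsUnit x → ¬ IsUnit y → x * y = 0) (h2 : IsUnit (2 : S)) :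
    (∑ P : S, ∑ G : S, if 4 * P ^ 3 - G ^ 2 = 0 then 1 else 0) = 𝓂 ^ 2 + 𝓊 := by
  have h4 : IsUnit (4 : S) := by
    have := h2.mul h2; norm_num at this; exact this
  have e1 : ∀ P : S, (∑ G : S, if 4 * P ^ 3 - G ^ 2 = 0 then 1 else 0) =
      (if IsUnit P then 0 else 𝓂) +
        ∑ t : S, if IsUnit P ∧ 4 * P - t ^ 2 = 0 then 1 else 0 := by
    intro P
    by_cases hP : IsUnit P
    · simp only [hP, if_true, zero_add, true_and]
      rw [← sum_unit_linear hP 0]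
      refine Finset.sum_congr rfl fun t _ => ?_
      have : 4 * P ^ 3 - (P * t + 0) ^ 2 = P ^ 2 * (4 * P - t ^ 2) := by ring
      simp only [this, (hP.pow 2).mul_right_eq_zero]
    · have h3 : P ^ 3 = 0 := by
        rw [pow_succ, (sq_eq_zero_iff_not_isUnit hN P).2 hP, zero_mul]
      simp only [hP, if_false, false_and, h3, mul_zero, zero_sub, neg_eq_zero,
        sq_eq_zero_iff_not_isUnit hN, Finset.sum_const_zero, add_zero]
      rw [← Finset.card_filter, Fintype.card_subtype]
  simp only [e1]
  rw [Finset.sum_add_distrib, Finset.sum_comm, sum_nonunit (fun _ => 𝓂) 𝓂 (fun _ _ => rfl),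
    sum_ite_unit _ 1 0]
  · ring
  · intro t ht
    have : ∀ P : S, (IsUnit P ∧ 4 * P - t ^ 2 = 0) ↔ 4 * P + (-t ^ 2) = 0 := by
      intro P
      rw [← sub_eq_add_neg]
      refine ⟨fun h => h.2, fun h => ⟨?_, h⟩⟩
      have h5 : IsUnit (4 * P) := by rw [sub_eq_zero.1 h]; exact ht.pow 2
      exact isUnit_of_mul_isUnit_right h5
    simp only [this]
    exact sum_ite_eq_zero_unit_linear h4 _
  · intro t ht
    apply Finset.sum_eq_zero
    intro P _
    rw [if_neg]
    rintro ⟨hP, h⟩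
    rw [(sq_eq_zero_iff_not_isUnit hN t).2 ht, sub_zero] at h
    have := h4.mul hP
    rw [h] at this
    exact not_isUnit_zero this

lemma sum_dsc_of_isUnit (hN : ∀ x y : S, ¬ IsUnit x → ¬ IsUnit y → x * y = 0) (h2 : IsUnit (2 : S))
    {a : S} (ha : IsUnit a) :
    (∑ b : S, ∑ c : S, ∑ d : S, if dsc ![a, b, c, d] = 0 then 1 else 0) =
      (𝓊 + 𝓂) * (𝓂 ^ 2 + 𝓊) := by
  rw [sum_ite_unit _ (𝓂 ^ 2 + 𝓊) (𝓂 ^ 2 + 𝓊), ← add_mul]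
  all_goals
    intro b _
    rw [← sum_cusp_curve hN h2, ← sum_unit_linear ha.neg (b ^ 2)
      (fun P => ∑ G : S, if 4 * P ^ 3 - G ^ 2 = 0 then 1 else 0)]
    refine Finset.sum_congr rfl fun c _ => ?_
    rw [← sum_unit_linear (ha.pow 2) (2 * b ^ 3 - 3 * a * b * c)
      (fun G => if 4 * (-a * c + b ^ 2) ^ 3 - G ^ 2 = 0 then 1 else 0)]
    refine Finset.sum_congr rfl fun d _ => ?_
    have : 4 * (-a * c + b ^ 2) ^ 3 - (a ^ 2 * d + (2 * b ^ 3 - 3 * a * b * c)) ^ 2 =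
        a ^ 2 * dsc ![a, b, c, d] := by
      simp [dsc, hP, hQ, hR]; ring
    rw [this, (ha.pow 2).mul_right_eq_zero]

lemma sum_dsc_of_not_isUnit (hN : ∀ x y : S, ¬ IsUnit x → ¬ IsUnit y → x * y = 0) (h2 : IsUnit (2 : S)) :
    (∑ a : S, if IsUnit a then 0 else
      ∑ b : S, ∑ c : S, ∑ d : S, if dsc ![a, b, c, d] = 0 then 1 else 0) =
      𝓂 * (𝓊 * (𝓊 + 𝓂)) + 𝓂 * (𝓊 + 𝓂) * (𝓂 ^ 2 + 𝓊) := by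
  have h4 : IsUnit (4 : S) := by
    have := h2.mul h2; norm_num at this; exact this
  have hcard : Fintype.card S = 𝓊 + 𝓂 := by
    rw [Fintype.card_subtype_compl]
    have := Fintype.card_subtype_le (fun a : S => IsUnit a)
    omega
  have e1 : ∀ a : S, (if IsUnit a then 0 else
      ∑ b : S, ∑ c : S, ∑ d : S, if dsc ![a, b, c, d] = 0 then 1 else 0) =
      (if IsUnit a then 0 else 𝓊 * (𝓊 + 𝓂)) + 𝓂 * (𝓊 + 𝓂) *
        ∑ c : S, if ¬ IsUnit a ∧ a * c ^ 3 = 0 then 1 else 0 := by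
    intro a
    by_cases ha : IsUnit a
    · simp [ha]
    simp only [ha, if_false, not_false_eq_true, true_and]
    rw [sum_ite_unit _ (𝓊 + 𝓂) ((𝓊 + 𝓂) * ∑ c : S, if a * c ^ 3 = 0 then 1 else 0)]
    · ring
    · intro b hb
      rw [← hcard, ← Finset.card_univ, Finset.card_eq_sum_ones]
      refine Finset.sum_congr rfl fun c _ => ?_
      have ha2 := hN a a ha ha
      have e : ∀ d, dsc ![a, b, c, d] = (-4 * b ^ 3 + a * (6 * b * c)) * d +
          (4 * c ^ 2 * (b ^ 2 - a * c) - b ^ 2 * c ^ 2) := by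
        intro d
        simp [dsc, hP, hQ, hR]
        linear_combination (-d ^ 2) * ha2
      simp only [e]
      apply sum_ite_eq_zero_unit_linear
      have hnil : IsNilpotent (a * (6 * b * c)) := ⟨2, by
        linear_combination (6 * b * c) ^ 2 * ha2⟩
      exact hnil.isUnit_add_left_of_commute (h4.neg.mul (hb.pow 3)) (Commute.all _ _)
    · intro b hb
      rw [Finset.mul_sum]
      refine Finset.sum_congr rfl fun c _ => ?_
      have ha2 := hN a a ha ha
      have hab := hN a b ha hb
      have hb2 := hN b b hb hb
      have e : ∀ d, dsc ![a, b, c, d] = -4 * (a * c ^ 3) := by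
        intro d
        simp [dsc, hP, hQ, hR]
        linear_combination (-d ^ 2) * ha2 + (6 * c * d) * hab + (3 * c ^ 2 - 4 * b * d) * hb2
      simp only [e, h4.neg.mul_right_eq_zero]
      rw [Finset.sum_const, Finset.card_univ, hcard, smul_eq_mul]
  simp only [e1]
  rw [Finset.sum_add_distrib, ← Finset.mul_sum, Finset.sum_comm,
    sum_nonunit (fun _ => 𝓊 * (𝓊 + 𝓂)) _ (fun _ _ => rfl)]
  congr 2
  rw [sum_ite_unit _ 1 𝓂]
  · ring
  · intro c hc
    simp only [(hc.pow 3).mul_left_eq_zero]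
    rw [Finset.sum_eq_single 0]
    · simp
    · intro b _ hb
      simp [hb]
    · simp
  · intro c hc
    have h3 : c ^ 3 = 0 := by
      rw [pow_succ, (sq_eq_zero_iff_not_isUnit hN c).2 hc, zero_mul]
    simp only [h3, mul_zero, and_true]
    rw [← Finset.card_filter, Fintype.card_subtype]

lemma card_dsc_eq_zero (hN : ∀ x y : S, ¬ IsUnit x → ¬ IsUnit y → x * y = 0) (h2 : IsUnit (2 : S)) :
    Nat.card {v : Fin 4 → S // dsc v = 0} =
      𝓊 * ((𝓊 + 𝓂) * (𝓂 ^ 2 + 𝓊)) +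
      (𝓂 * (𝓊 * (𝓊 + 𝓂)) + 𝓂 * (𝓊 + 𝓂) * (𝓂 ^ 2 + 𝓊)) := by
  rw [card_dsc_eq_sum, ← sum_dsc_of_not_isUnit hN h2]
  have e : ∀ a : S, (∑ b : S, ∑ c : S, ∑ d : S, if dsc ![a, b, c, d] = 0 then 1 else 0) =
    (if IsUnit a then (𝓊 + 𝓂) * (𝓂 ^ 2 + 𝓊) else 0) + (if IsUnit a then 0 else
      ∑ b : S, ∑ c : S, ∑ d : S, if dsc ![a, b, c, d] = 0 then 1 else 0) := by
    intro a
    by_cases ha : IsUnit a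
    · simp only [ha, if_true, add_zero]; exact sum_dsc_of_isUnit hN h2 ha
    · simp [ha]
  rw [Finset.sum_congr rfl (fun a _ => e a), Finset.sum_add_distrib,
    sum_ite_unit _ ((𝓊 + 𝓂) * (𝓂 ^ 2 + 𝓊)) 0 (fun a h => if_pos h) (fun a h => if_neg h)]
  ring

end SquareZero

lemma card_dsc_zmod_prime_sq {p : ℕ} (hp : p.Prime) (hp2 : p ≠ 2) :
    Nat.card {v : Fin 4 → ZMod (p ^ 2) // dsc v = 0} + p ^ 4 = 2 * p ^ 6 := by
  have : NeZero (p ^ 2) := ⟨pow_ne_zero _ hp.ne_zero⟩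
  have : Fact (1 < p ^ 2) := ⟨Nat.one_lt_pow (by norm_num) hp.one_lt⟩
  have hu : ∀ x : ZMod (p ^ 2), ¬ IsUnit x → ∃ k : ℕ, x = (p * k : ℕ) := by
    intro x hx
    rw [← ZMod.natCast_zmod_val x, ZMod.isUnit_iff_coprime, Nat.coprime_pow_right_iff (by norm_num),
      Nat.coprime_comm, hp.coprime_iff_not_dvd, not_not] at hx
    obtain ⟨k, hk⟩ := hx
    exact ⟨k, by rw [← hk, ZMod.natCast_zmod_val]⟩
  have hN : ∀ x y : ZMod (p ^ 2), ¬ IsUnit x → ¬ IsUnit y → x * y = 0 := by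
    intro x y hx hy
    obtain ⟨k, rfl⟩ := hu x hx
    obtain ⟨l, rfl⟩ := hu y hy
    rw [← Nat.cast_mul, ZMod.natCast_eq_zero_iff]
    exact ⟨k * l, by ring⟩
  have h2 : IsUnit (2 : ZMod (p ^ 2)) := by
    have : ((2 : ℕ) : ZMod (p ^ 2)) = 2 := by norm_cast
    rw [← this, ZMod.isUnit_iff_coprime]
    exact Nat.Coprime.pow_right 2 ((Nat.coprime_primes Nat.prime_two hp).2 (Ne.symm hp2))
  have c1 : Fintype.card {a : ZMod (p ^ 2) // IsUnit a} = p * (p - 1) := by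
    have e : (ZMod (p ^ 2))ˣ ≃ {a : ZMod (p ^ 2) // IsUnit a} :=
      { toFun := fun u => ⟨u, u.isUnit⟩
        invFun := fun a => a.2.unit
        left_inv := fun u => Units.ext rfl
        right_inv := fun a => rfl }
    rw [← Fintype.card_congr e, ZMod.card_units_eq_totient, Nat.totient_prime_pow hp (by norm_num)]
    simp
  have c2 : Fintype.card {a : ZMod (p ^ 2) // ¬ IsUnit a} = p := by
    rw [Fintype.card_subtype_compl, c1, ZMod.card]
    obtain ⟨k, rfl⟩ : ∃ k, p = k + 1 := ⟨p - 1, by have := hp.pos; omega⟩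
    simp only [Nat.add_sub_cancel]
    have : (k + 1) ^ 2 = (k + 1) * k + (k + 1) := by ring
    omega
  rw [card_dsc_eq_zero hN h2]
  simp only [← Nat.card_eq_fintype_card] at c1 c2 ⊢
  rw [c1, c2]
  obtain ⟨k, rfl⟩ : ∃ k, p = k + 1 := ⟨p - 1, by have := hp.pos; omega⟩
  simp only [Nat.add_sub_cancel]
  ring

end LocalDensity

section Multiplicativity

lemma map_dsc {S T : Type*} [CommRing S] [CommRing T] (g : S →+* T) (v : Fin 4 → S) :
    g (dsc v) = dsc (fun i => g (v i)) := by
  simp [dsc, hP, hQ, hR, map_ofNat]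

/-- The number of quadruples modulo `q ^ 2` at which the discriminant vanishes. -/
noncomputable def dscRoots (q : ℕ) : ℕ := Nat.card {v : Fin 4 → ZMod (q ^ 2) // dsc v = 0}

lemma dscRoots_one : dscRoots 1 = 1 := by
  unfold dscRoots
  have : Subsingleton (ZMod (1 ^ 2)) := by rw [one_pow]; infer_instance
  rw [Nat.card_eq_one_iff_unique]
  exact ⟨inferInstance, ⟨⟨0, Subsingleton.elim _ _⟩⟩⟩

lemma dscRoots_mul {m n : ℕ} (h : m.Coprime n) :
    dscRoots (m * n) = dscRoots m * dscRoots n := by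
  unfold dscRoots
  rw [← Nat.card_prod]
  have e0 : (m * n) ^ 2 = m ^ 2 * n ^ 2 := by ring
  let e := (ZMod.ringEquivCongr e0).trans (ZMod.chineseRemainder (Nat.Coprime.pow 2 2 h))
  refine Nat.card_congr
    { toFun := fun v => (⟨fun i => (e (v.1 i)).1, ?_⟩, ⟨fun i => (e (v.1 i)).2, ?_⟩)
      invFun := fun w => ⟨fun i => e.symm (w.1.1 i, w.2.1 i), ?_⟩
      left_inv := fun v => ?_
      right_inv := fun w => ?_ }
  · have := map_dsc ((RingHom.fst _ _).comp e.toRingHom) v.1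
    rw [v.2, map_zero] at this
    exact this.symm
  · have := map_dsc ((RingHom.snd _ _).comp e.toRingHom) v.1
    rw [v.2, map_zero] at this
    exact this.symm
  · apply e.injective
    rw [map_zero]
    have := map_dsc e.toRingHom (fun i => e.symm (w.1.1 i, w.2.1 i))
    simp only [RingEquiv.toRingHom_eq_coe, RingHom.coe_coe, RingEquiv.apply_symm_apply] at this
    rw [this]
    ext
    · rw [← RingHom.coe_fst, map_dsc]; exact w.1.2
    · rw [← RingHom.coe_snd, map_dsc]; exact w.2.2
  · ext i; simp
  · ext i <;> simp

lemma dscRoots_prime {p : ℕ} (hp : p.Prime) (hp2 : p ≠ 2) :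
    dscRoots p + p ^ 4 = 2 * p ^ 6 := card_dsc_zmod_prime_sq hp hp2

/-- The congruence conditions modulo `4 * q ^ 2` for discriminants that are `8` modulo `16` and
divisible by `q ^ 2`. -/
def GoodClass (q : ℕ) (v : Fin 4 → ZMod (4 * q ^ 2)) : Prop :=
  dsc (fun i => ZMod.castHom (Dvd.intro_left 4 rfl) (ZMod (q ^ 2)) (v i)) = 0 ∧
  dsc (fun i => ((ZMod.castHom (Dvd.intro _ rfl) (ZMod 4) (v i)).val : ℤ)) % 16 = 8

lemma card_mod_four :
    Nat.card {v : Fin 4 → ZMod 4 // dsc (fun i => ((v i).val : ℤ)) % 16 = 8} = 24 := by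
  rw [Nat.card_eq_fintype_card, Fintype.card_subtype, Finset.card_filter,
    ← (finFourEquiv (ZMod 4)).sum_comp]
  have : ∀ x : ZMod 4 × ZMod 4 × ZMod 4 × ZMod 4,
      dsc (fun i => ((finFourEquiv (ZMod 4) x i).val : ℤ)) =
      4 * (x.2.1.val ^ 2 - x.1.val * x.2.2.1.val) *
        (x.2.2.1.val ^ 2 - x.2.1.val * x.2.2.2.val) -
      (x.2.1.val * x.2.2.1.val - x.1.val * x.2.2.2.val) ^ 2 := fun x => rfl
  simp only [this]
  have e : ∀ P : Prop, ∀ h1 h2 : Decidable P, (@ite _ P h1 1 0) = (@ite _ P h2 1 0) := by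
    intro P h1 h2; congr
  calc _ = ∑ x : ZMod 4 × ZMod 4 × ZMod 4 × ZMod 4, @ite ℕ ((4 * ((x.2.1.val : ℤ) ^ 2 - x.1.val * x.2.2.1.val) *
        ((x.2.2.1.val : ℤ) ^ 2 - x.2.1.val * x.2.2.2.val) -
      ((x.2.1.val : ℤ) * x.2.2.1.val - x.1.val * x.2.2.2.val) ^ 2) % 16 = 8) (Int.instDecidableEq _ _) 1 0 := by
        refine Finset.sum_congr rfl fun x _ => e _ _ _
    _ = 24 := by decide +kernel

lemma card_goodClass {q : ℕ} (hq : Odd q) :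
    Nat.card {v : Fin 4 → ZMod (4 * q ^ 2) // GoodClass q v} = 24 * dscRoots q := by
  unfold dscRoots
  rw [← card_mod_four, ← Nat.card_prod]
  have hc : Nat.Coprime 4 (q ^ 2) := by
    have : Nat.Coprime (2 ^ 2) (q ^ 2) := Nat.Coprime.pow _ _ (Nat.coprime_two_left.2 hq)
    simpa using this
  let e := ZMod.chineseRemainder hc
  have h1 : ∀ x, ZMod.castHom (Dvd.intro _ rfl) (ZMod 4) x = (e x).1 := by
    intro x
    exact congrFun (congrArg DFunLike.coe (Subsingleton.elim
      (ZMod.castHom (Dvd.intro _ rfl) (ZMod 4)) ((RingHom.fst _ _).comp e.toRingHom))) x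
  have h2 : ∀ x, ZMod.castHom (Dvd.intro_left 4 rfl) (ZMod (q ^ 2)) x = (e x).2 := by
    intro x
    exact congrFun (congrArg DFunLike.coe (Subsingleton.elim
      (ZMod.castHom (Dvd.intro_left 4 rfl) (ZMod (q ^ 2)))
      ((RingHom.snd _ _).comp e.toRingHom))) x
  unfold GoodClass
  simp only [h1, h2]
  exact Nat.card_congr
    { toFun := fun v => (⟨fun i => (e (v.1 i)).1, v.2.2⟩, ⟨fun i => (e (v.1 i)).2, v.2.1⟩)
      invFun := fun w => ⟨fun i => e.symm (w.1.1 i, w.2.1 i), by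
        simpa using w.2.2, by simpa using w.1.2⟩
      left_inv := fun v => by ext i; simp
      right_inv := fun w => by ext i <;> simp }

lemma dsc_emod_sixteen_iff {f g : Fin 4 → ℤ} (k : Fin 4 → ℤ) (hk : ∀ i, g i = f i + 4 * k i) :
  dsc g % 16 = 8 ↔ dsc f % 16 = 8 := by
  obtain ⟨x, hx⟩ : ∃ x, hP g = hP f + 4 * x :=
    ⟨2 * f 1 * k 1 + 4 * k 1 ^ 2 - f 0 * k 2 - k 0 * f 2 - 4 * k 0 * k 2, by
      simp only [hP, hk]; ring⟩
  obtain ⟨y, hy⟩ : ∃ y, hR g = hR f + 4 * y :=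
    ⟨2 * f 2 * k 2 + 4 * k 2 ^ 2 - f 1 * k 3 - k 1 * f 3 - 4 * k 1 * k 3, by
      simp only [hR, hk]; ring⟩
  obtain ⟨m, hm⟩ : ∃ m, hQ g = hQ f + 4 * m :=
    ⟨f 1 * k 2 + k 1 * f 2 + 4 * k 1 * k 2 - f 0 * k 3 - k 0 * f 3 - 4 * k 0 * k 3, by
      simp only [hQ, hk]; ring⟩
  have e : dsc g = dsc f + 16 * (hP f * y + x * hR f + 4 * x * y - m ^ 2) - 8 * (hQ f * m) := by
    rw [dsc, hx, hy, hm, dsc]; ring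
  have e2 : dsc f = 4 * (hP f * hR f) - hQ f ^ 2 := by rw [dsc]; ring
  rcases Int.even_or_odd' (hQ f) with ⟨t, ht | ht⟩
  · have : hQ f * m = 2 * (t * m) := by rw [ht]; ring
    omega
  · have : hQ f ^ 2 = 4 * (t ^ 2 + t) + 1 := by rw [ht]; ring
    omega

lemma goodClass_intCast (q : ℕ) (f : Fin 4 → ℤ) :
    GoodClass q (fun i => (f i : ZMod (4 * q ^ 2))) ↔
      (q : ℤ) ^ 2 ∣ dsc f ∧ dsc f % 16 = 8 := by
  unfold GoodClass
  simp only [map_intCast]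
  have h1 := map_dsc (Int.castRingHom (ZMod (q ^ 2))) f
  simp only [eq_intCast] at h1
  rw [← h1, ZMod.intCast_zmod_eq_zero_iff_dvd]
  refine and_congr (by push_cast; rfl) ?_
  have hv : ∀ i, ∃ k : ℤ, (((f i : ZMod 4)).val : ℤ) = f i + 4 * k := by
    intro i
    refine ⟨-(f i / 4), ?_⟩
    rw [ZMod.val_intCast]
    have := Int.emod_add_mul_ediv (f i) 4
    push_cast
    linarith
  choose k hk using hv
  exact dsc_emod_sixteen_iff k hk

end Multiplicativity

section Series

/-- Exponentials of the number of prime factors grow slower than any power. -/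
lemma exists_pow_card_primeFactors_le {K ε : ℝ} (hK : 1 ≤ K) (hε : 0 < ε) :
    ∃ C : ℝ, 1 ≤ C ∧ ∀ n : ℕ, n ≠ 0 → K ^ n.primeFactors.card ≤ C * (n : ℝ) ^ ε := by
  obtain ⟨m, hm⟩ := exists_nat_ge (K ^ (1 / ε))
  refine ⟨K ^ m, one_le_pow₀ hK, fun n hn => ?_⟩
  have hK0 : 0 < K := by linarith
  have h1 : ∀ p ∈ n.primeFactors, K ≤ (if p < m then K else 1) * (p : ℝ) ^ ε := by
    intro p hp
    have hp1 : (1 : ℝ) ≤ p := by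
      exact_mod_cast (Nat.prime_of_mem_primeFactors hp).one_lt.le
    split_ifs with h
    · nlinarith [Real.one_le_rpow hp1 hε.le]
    · have h2 : K ^ (1 / ε) ≤ p := hm.trans (by exact_mod_cast not_lt.1 h)
      calc K = (K ^ (1 / ε)) ^ ε := by
            rw [← Real.rpow_mul hK0.le, one_div_mul_cancel hε.ne', Real.rpow_one]
        _ ≤ (p : ℝ) ^ ε := Real.rpow_le_rpow (by positivity) h2 hε.le
        _ = _ := by rw [one_mul]
  calc K ^ n.primeFactors.card = ∏ p ∈ n.primeFactors, K := by rw [Finset.prod_const]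
    _ ≤ ∏ p ∈ n.primeFactors, (if p < m then K else 1) * (p : ℝ) ^ ε :=
        Finset.prod_le_prod (fun _ _ => hK0.le) h1
    _ = (∏ p ∈ n.primeFactors, if p < m then K else 1) * (∏ p ∈ n.primeFactors, (p : ℝ)) ^ ε := by
        rw [Finset.prod_mul_distrib, Real.finsetProd_rpow _ _ (fun _ _ => by positivity)]
    _ ≤ K ^ m * (n : ℝ) ^ ε := by
        refine mul_le_mul ?_ ?_ (by positivity) (by positivity)
        · rw [Finset.prod_ite, Finset.prod_const, Finset.prod_const_one, mul_one]
          refine pow_le_pow_right₀ hK ?_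
          calc _ ≤ (Finset.range m).card := Finset.card_le_card (fun p hp => by
                simp only [Finset.mem_filter] at hp
                exact Finset.mem_range.2 hp.2)
            _ = m := Finset.card_range m
        · refine Real.rpow_le_rpow (by positivity) ?_ hε.le
          rw [← Nat.cast_prod]
          exact_mod_cast Nat.le_of_dvd (Nat.pos_of_ne_zero hn) (Nat.prod_primeFactors_dvd n)

lemma dscRoots_le {q : ℕ} (hq : Squarefree q) (h2 : Odd q) :
    (dscRoots q : ℝ) ≤ 2 ^ q.primeFactors.card * (q : ℝ) ^ 6 := by
  induction q using Nat.recOnPosPrimePosCoprime with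
  | prime_pow p n hp hn =>
    have : n = 1 := by
      rcases (Nat.squarefree_pow_iff hp.ne_one hn.ne').1 hq with h
      exact h.2
    subst this
    rw [pow_one] at *
    have hp2 : p ≠ 2 := by rintro rfl; exact absurd h2 (by decide)
    rw [hp.primeFactors, Finset.card_singleton, pow_one]
    have := dscRoots_prime hp hp2
    exact_mod_cast (by omega : dscRoots p ≤ 2 * p ^ 6)
  | zero => simp at h2
  | one => simp [dscRoots_one]
  | coprime a b ha hb hab iha ihb =>
    rw [dscRoots_mul hab, Nat.primeFactors_mul (by omega) (by omega),
      Finset.card_union_of_disjoint hab.disjoint_primeFactors, pow_add]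
    have h := Nat.squarefree_mul_iff.1 hq
    rw [Nat.odd_mul] at h2
    have := mul_le_mul (iha h.2.1 h2.1) (ihb h.2.2 h2.2) (by positivity) (by positivity)
    push_cast
    calc _ ≤ _ := this
      _ = _ := by ring

open ArithmeticFunction in
/-- The value of a Möbius sum over odd integers with prescribed local factors. -/
lemma tsum_odd_moebius (w : ℕ → ℝ) (k : ℕ) (h1 : w 1 = 1)
    (hw : ∀ m n : ℕ, m.Coprime n → w (m * n) = w m * w n)
    (hp : ∀ p : ℕ, p.Prime → p ≠ 2 → 1 - w p = (1 - ((p : ℝ) ^ 2)⁻¹) ^ k)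
    (hs : Summable fun n : ℕ => if Odd n then (moebius n : ℝ) * w n else 0) :
    ∑' n : ℕ, (if Odd n then (moebius n : ℝ) * w n else 0) = (8 / Real.pi ^ 2) ^ k := by
  set f : ℕ → ℝ := fun n => if Odd n then (moebius n : ℝ) * w n else 0 with hf
  have hprod := EulerProduct.eulerProduct_hasProd (f := f) (by simp [hf, h1])
    (fun {m n} hmn => by
      simp only [hf, Nat.odd_mul, isMultiplicative_moebius.map_mul_of_coprime hmn, hw m n hmn]
      by_cases ho : Odd m <;> by_cases ho' : Odd n <;> simp [ho, ho']
      ring) hs.norm (by simp [hf])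
  have hloc : ∀ p : Nat.Primes, ∑' e, f ((p : ℕ) ^ e) =
      if (p : ℕ) = 2 then 1 else (1 - ((p : ℝ) ^ 2)⁻¹) ^ k := by
    intro p
    have h0 : f 1 = 1 := by simp [hf, h1]
    have h2 : ∀ e ∉ Finset.range 2, f ((p : ℕ) ^ e) = 0 := by
      intro e he
      simp only [Finset.mem_range, not_lt] at he
      simp only [hf, moebius_apply_prime_pow p.2 (by omega : e ≠ 0), if_neg (by omega : e ≠ 1)]
      simp
    rw [tsum_eq_sum h2, Finset.sum_range_succ, Finset.sum_range_one, pow_zero, pow_one, h0]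
    split_ifs with hp2
    · simp [hf, hp2]
    · rw [← hp p p.2 hp2]
      simp [hf, moebius_apply_prime p.2, p.2.odd_of_ne_two hp2]
      ring
  simp only [hloc] at hprod
  have hz : HasProd (fun p : Nat.Primes => (1 - ((p : ℝ) ^ 2)⁻¹)⁻¹) (Real.pi ^ 2 / 6) := by
    have := riemannZeta_eulerProduct_hasProd (s := 2) (by norm_num)
    rw [riemannZeta_two] at this
    have e : (fun p : Nat.Primes => (1 - (p : ℂ) ^ (-2 : ℂ))⁻¹) =
        fun p : Nat.Primes => (((1 - ((p : ℝ) ^ 2)⁻¹)⁻¹ : ℝ) : ℂ) := by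
      funext p
      push_cast
      rw [Complex.cpow_neg, Complex.cpow_ofNat]
    rw [e] at this
    have e2 : (Real.pi : ℂ) ^ 2 / 6 = ((Real.pi ^ 2 / 6 : ℝ) : ℂ) := by push_cast; rfl
    rw [e2] at this
    unfold HasProd at this ⊢
    simp only [← Complex.ofReal_prod] at this
    exact Filter.tendsto_ofReal_iff.1 this
  have hzk : HasProd (fun p : Nat.Primes => ((1 - ((p : ℝ) ^ 2)⁻¹)⁻¹) ^ k)
      ((Real.pi ^ 2 / 6) ^ k) := by
    exact hz.pow k
  have hne : ∀ p : Nat.Primes, (1 - ((p : ℝ) ^ 2)⁻¹) ≠ 0 := by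
    intro p
    have hp2 : (2 : ℝ) ≤ p := by exact_mod_cast p.2.two_le
    have : ((p : ℝ) ^ 2)⁻¹ < 1 := inv_lt_one_of_one_lt₀ (by nlinarith)
    linarith
  have hm := hprod.mul hzk
  have h43 : HasProd (fun p : Nat.Primes => if (p : ℕ) = 2 then ((4 / 3 : ℝ)) ^ k else 1)
      ((4 / 3) ^ k) := by
    have := hasProd_single (⟨2, Nat.prime_two⟩ : Nat.Primes)
      (f := fun p : Nat.Primes => if (p : ℕ) = 2 then ((4 / 3 : ℝ)) ^ k else 1)
      (fun p hp => if_neg fun h => hp (Subtype.ext h))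
    rw [if_pos rfl] at this
    exact this
  have e : (fun p : Nat.Primes => (if (p : ℕ) = 2 then 1 else (1 - ((p : ℝ) ^ 2)⁻¹) ^ k) *
      ((1 - ((p : ℝ) ^ 2)⁻¹)⁻¹) ^ k) =
      fun p : Nat.Primes => if (p : ℕ) = 2 then ((4 / 3 : ℝ)) ^ k else 1 := by
    funext p
    by_cases h : (p : ℕ) = 2
    · rw [if_pos h, if_pos h, h]
      norm_num
    · rw [if_neg h, if_neg h, ← mul_pow,
        mul_inv_cancel₀ (hne p), one_pow]
  rw [e] at hm
  have := hm.unique h43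
  have hpi := Real.pi_pos
  rw [← eq_div_iff (by positivity), ← div_pow] at this
  rw [this]
  congr 1
  field_simp
  norm_num

end Series

section Truncation

open ArithmeticFunction

lemma abs_moebius_le_one (n : ℕ) : |(moebius n : ℝ)| ≤ 1 := by
  have := ArithmeticFunction.abs_moebius_le_one (n := n)
  exact_mod_cast this

lemma sum_moebius_truncated (w : ℕ → ℝ) (k : ℕ) (h1 : w 1 = 1)
    (hw : ∀ m n : ℕ, m.Coprime n → w (m * n) = w m * w n)
    (hp : ∀ p : ℕ, p.Prime → p ≠ 2 → 1 - w p = (1 - ((p : ℝ) ^ 2)⁻¹) ^ k)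
    {ε B : ℝ} (hε : 0 < ε) (hε1 : ε ≤ 1 / 2)
    (hB : ∀ n : ℕ, Odd n → Squarefree n → |w n| ≤ B * (n : ℝ) ^ (-2 + ε)) :
    ∃ C : ℝ, 0 ≤ C ∧ ∀ Q : ℕ, 1 ≤ Q →
      |∑ q ∈ Finset.Icc 1 Q, (if Odd q then (moebius q : ℝ) * w q else 0) -
        (8 / Real.pi ^ 2) ^ k| ≤ C * (Q : ℝ) ^ (-1 + 2 * ε) := by
  set f : ℕ → ℝ := fun n => if Odd n then (moebius n : ℝ) * w n else 0 with hf
  have hB0 : 0 ≤ B := by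
    have := (abs_nonneg _).trans (hB 1 odd_one squarefree_one)
    simpa using this
  have hfb : ∀ n : ℕ, |f n| ≤ B * (n : ℝ) ^ (-2 + ε) := by
    intro n
    simp only [hf]
    split_ifs with h
    · by_cases hs : Squarefree n
      · rw [abs_mul]
        calc _ ≤ 1 * |w n| := by
              gcongr; exact abs_moebius_le_one n
          _ ≤ _ := by rw [one_mul]; exact hB n h hs
      · rw [moebius_eq_zero_of_not_squarefree hs]
        simp only [Int.cast_zero, zero_mul, abs_zero]
        positivity
    · rw [abs_zero]; positivity
  have hsz : Summable fun n : ℕ => (n : ℝ) ^ (-1 - ε) :=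
    Real.summable_nat_rpow.2 (by linarith)
  have hsum : Summable f := by
    refine Summable.of_norm_bounded (g := fun n : ℕ => B * (n : ℝ) ^ (-2 + ε)) ?_ hfb
    exact (Real.summable_nat_rpow.2 (by linarith)).mul_left B
  have htot := tsum_odd_moebius w k h1 hw hp hsum
  refine ⟨B * ∑' n : ℕ, (n : ℝ) ^ (-1 - ε), by positivity, fun Q hQ => ?_⟩
  have e1 : ∑ q ∈ Finset.Icc 1 Q, f q = ∑ q ∈ Finset.range (Q + 1), f q := by
    rw [Finset.range_eq_Ico, Finset.sum_eq_sum_Ico_succ_bot (by omega)]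
    simp only [hf, Nat.not_odd_zero, if_false, zero_add]
    rfl
  have hQ0 : (0 : ℝ) < Q := by exact_mod_cast hQ
  rw [e1, ← htot, ← hsum.sum_add_tsum_nat_add (Q + 1), sub_add_cancel_left, abs_neg]
  have hb : ∀ i : ℕ, |f (i + (Q + 1))| ≤
      B * (Q : ℝ) ^ (-1 + 2 * ε) * ((i + (Q + 1) : ℕ) : ℝ) ^ (-1 - ε) := by
    intro i
    refine (hfb _).trans ?_
    have hpos : (0 : ℝ) < ((i + (Q + 1) : ℕ) : ℝ) := by positivity
    have : -2 + ε = (-1 + 2 * ε) + (-1 - ε) := by ring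
    rw [this, Real.rpow_add hpos, mul_assoc]
    gcongr B * (?_ * _)
    refine Real.rpow_le_rpow_of_nonpos hQ0 ?_ (by linarith)
    exact_mod_cast (by omega)
  have hs2 : Summable fun i : ℕ => ((i + (Q + 1) : ℕ) : ℝ) ^ (-1 - ε) :=
    (summable_nat_add_iff (Q + 1)).2 hsz
  calc |∑' i, f (i + (Q + 1))| ≤
      ∑' i : ℕ, B * (Q : ℝ) ^ (-1 + 2 * ε) * ((i + (Q + 1) : ℕ) : ℝ) ^ (-1 - ε) :=
        tsum_of_norm_bounded (f := fun i => f (i + (Q + 1))) (hs2.mul_left _).hasSum hb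
    _ = B * (Q : ℝ) ^ (-1 + 2 * ε) * ∑' i : ℕ, ((i + (Q + 1) : ℕ) : ℝ) ^ (-1 - ε) := tsum_mul_left
    _ ≤ B * (Q : ℝ) ^ (-1 + 2 * ε) * ∑' n : ℕ, (n : ℝ) ^ (-1 - ε) := by
        refine mul_le_mul_of_nonneg_left ?_ (by positivity)
        rw [← hsz.sum_add_tsum_nat_add (Q + 1)]
        have : 0 ≤ ∑ i ∈ Finset.range (Q + 1), (i : ℝ) ^ (-1 - ε) :=
          Finset.sum_nonneg fun i _ => by positivity
        linarith
    _ = _ := by ring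

lemma exists_dscRoots_div_le {ε : ℝ} (hε : 0 < ε) : ∃ B : ℝ, 0 ≤ B ∧ ∀ n : ℕ, Odd n →
    Squarefree n → (dscRoots n : ℝ) / (n : ℝ) ^ 8 ≤ B * (n : ℝ) ^ (-2 + ε) := by
  obtain ⟨C, hC, h⟩ := exists_pow_card_primeFactors_le (K := 2) one_le_two hε
  refine ⟨C, by linarith, fun n ho hs => ?_⟩
  have hn : (0 : ℝ) < n := by exact_mod_cast ho.pos
  rw [div_le_iff₀ (by positivity)]
  calc (dscRoots n : ℝ) ≤ 2 ^ n.primeFactors.card * (n : ℝ) ^ 6 := dscRoots_le hs ho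
    _ ≤ C * (n : ℝ) ^ ε * (n : ℝ) ^ 6 := by
        gcongr; exact h n hs.ne_zero
    _ = _ := by
        rw [Real.rpow_add hn, Real.rpow_neg hn.le]
        norm_num
        field_simp

lemma sum_moebius_dscRoots {ε : ℝ} (hε : 0 < ε) (hε1 : ε ≤ 1 / 2) :
    ∃ C : ℝ, 0 ≤ C ∧ ∀ Q : ℕ, 1 ≤ Q →
      |∑ q ∈ Finset.Icc 1 Q, (if Odd q then (moebius q : ℝ) * (dscRoots q / (q : ℝ) ^ 8) else 0) -
        (8 / Real.pi ^ 2) ^ 2| ≤ C * (Q : ℝ) ^ (-1 + 2 * ε) := by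
  obtain ⟨B, hB, h⟩ := exists_dscRoots_div_le hε
  refine sum_moebius_truncated _ 2 (by simp [dscRoots_one]) (fun m n hmn => ?_)
    (fun p hp hp2 => ?_) hε hε1 (B := B) (fun n ho hs => ?_)
  · rw [dscRoots_mul hmn]; push_cast; rw [mul_pow, mul_div_mul_comm]
  · have hp0 : (p : ℝ) ≠ 0 := by exact_mod_cast hp.ne_zero
    have : (dscRoots p : ℝ) = 2 * p ^ 6 - p ^ 4 := by
      rw [eq_sub_iff_add_eq]; exact_mod_cast dscRoots_prime hp hp2
    rw [this]
    field_simp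
    ring
  · rw [abs_of_nonneg (by positivity)]; exact h n ho hs

lemma sum_moebius_inv_sq {ε : ℝ} (hε : 0 < ε) (hε1 : ε ≤ 1 / 2) :
    ∃ C : ℝ, 0 ≤ C ∧ ∀ Q : ℕ, 1 ≤ Q →
      |∑ q ∈ Finset.Icc 1 Q, (if Odd q then (moebius q : ℝ) * ((q : ℝ) ^ 2)⁻¹ else 0) -
        (8 / Real.pi ^ 2) ^ 1| ≤ C * (Q : ℝ) ^ (-1 + 2 * ε) := by
  refine sum_moebius_truncated (fun n => ((n : ℝ) ^ 2)⁻¹) 1 (by simp) (fun m n hmn => ?_)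
    (fun p hp hp2 => ?_) hε hε1 (B := 1) (fun n ho hs => ?_)
  · push_cast; rw [mul_pow, mul_inv]
  · rw [pow_one]
  · have hn : (1 : ℝ) ≤ n := by exact_mod_cast ho.pos
    rw [abs_of_nonneg (by positivity), one_mul, ← Real.rpow_natCast, ← Real.rpow_neg (by positivity)]
    exact Real.rpow_le_rpow_of_exponent_le hn (by push_cast; linarith)

end Truncation

section SquarefreeSieve

open ArithmeticFunction

/-- Detection of squarefree numbers by the Möbius function. -/
lemma sum_moebius_sq_dvd {D Q : ℕ} (hD : D ≠ 0) (hQ : D ≤ Q ^ 2) :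
    ∑ q ∈ Finset.Icc 1 Q, (if q ^ 2 ∣ D then (moebius q : ℝ) else 0) =
      if Squarefree D then 1 else 0 := by
  obtain ⟨s, m, hsm, hs⟩ := Nat.sq_mul_squarefree D
  have hm : m ≠ 0 := by rintro rfl; simp at hsm; exact hD hsm.symm
  have hdvd : ∀ q, q ^ 2 ∣ D ↔ q ∣ m := by
    intro q
    refine ⟨fun h => ?_, fun h => hsm ▸ Dvd.dvd.mul_right (pow_dvd_pow_of_dvd h 2) s⟩
    rw [← hsm] at h
    have hg : q.gcd m ≠ 0 := Nat.gcd_ne_zero_right hm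
    obtain ⟨a, b, hab, ha, hb⟩ := Nat.exists_coprime q m
    rw [hb, mul_pow] at h
    nth_rw 1 [ha] at h
    rw [mul_pow, mul_right_comm, Nat.mul_dvd_mul_iff_right (by positivity)] at h
    have h1 : a ^ 2 ∣ s := Nat.Coprime.dvd_of_dvd_mul_left (Nat.Coprime.pow 2 2 hab) h
    have h2 : IsUnit a := hs a (by rwa [← pow_two])
    rw [ha, Nat.isUnit_iff.1 h2, one_mul]
    exact Nat.gcd_dvd_right q m
  have hsq : Squarefree D ↔ m = 1 := by
    constructor
    · intro h
      exact Nat.isUnit_iff.1 (h m ⟨s, by rw [← hsm]; ring⟩)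
    · rintro rfl
      rw [← hsm]; simpa using hs
  have hmQ : m ≤ Q := by
    have : 0 < s := Nat.pos_of_ne_zero hs.ne_zero
    nlinarith [hsm, hQ]
  have h3 : (Finset.Icc 1 Q).filter (fun q => q ∣ m) = m.divisors := by
    ext q
    simp only [Finset.mem_filter, Finset.mem_Icc, Nat.mem_divisors]
    constructor
    · rintro ⟨_, h⟩; exact ⟨h, hm⟩
    · rintro ⟨h, _⟩
      exact ⟨⟨Nat.pos_of_dvd_of_pos h (by omega), (Nat.le_of_dvd (by omega) h).trans hmQ⟩, h⟩
  simp only [hdvd, hsq]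
  rw [← Finset.sum_filter, h3]
  have h4 := congrArg (fun g => g m) moebius_mul_coe_zeta
  simp only [coe_mul_zeta_apply, one_apply] at h4
  rw [← Int.cast_sum, h4]
  split_ifs <;> simp

lemma odd_of_sq_dvd {q D : ℕ} (h : q ^ 2 ∣ D) (hD : D % 4 = 2) : Odd q := by
  rw [← Nat.not_even_iff_odd]
  rintro ⟨r, rfl⟩
  have : 4 ∣ D := (Dvd.intro (r ^ 2) (by ring)).trans h
  omega

lemma card_sq_dvd_two_mod_four {q : ℕ} (hq : Odd q) (N : ℕ) :
    |(((Finset.range N).filter fun D => D % 4 = 2 ∧ q ^ 2 ∣ D).card : ℝ) -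
      N / 4 * ((q : ℝ) ^ 2)⁻¹| ≤ 1 := by
  have hq0 : 0 < q ^ 2 := by have := hq.pos; positivity
  obtain ⟨r, hr⟩ := hq
  have hm : ∀ k, (q ^ 2 * k) % 4 = k % 4 := by
    intro k
    have : q ^ 2 * k = 4 * ((r ^ 2 + r) * k) + k := by rw [hr]; ring
    omega
  have hcard : ((Finset.range N).filter fun D => D % 4 = 2 ∧ q ^ 2 ∣ D).card =
      ((N - 1) / q ^ 2 + 2) / 4 := by
    rw [show ((N - 1) / q ^ 2 + 2) / 4 = (Finset.range (((N - 1) / q ^ 2 + 2) / 4)).card by simp]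
    symm
    refine Finset.card_bij (fun j _ => q ^ 2 * (4 * j + 2)) ?_ ?_ ?_
    · intro j hj
      rw [Finset.mem_range] at hj
      rw [Finset.mem_filter, Finset.mem_range, hm]
      have h1 : 4 * j + 2 ≤ (N - 1) / q ^ 2 := by omega
      have h2 := (Nat.le_div_iff_mul_le hq0).1 h1
      refine ⟨?_, by omega, Dvd.intro _ rfl⟩
      rw [mul_comm] at h2
      have : 0 < q ^ 2 * (4 * j + 2) := by positivity
      omega
    · intro i _ j _ h
      have := Nat.eq_of_mul_eq_mul_left hq0 h
      omega
    · intro D hD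
      rw [Finset.mem_filter, Finset.mem_range] at hD
      obtain ⟨hDN, hD4, k, rfl⟩ := hD
      rw [hm] at hD4
      refine ⟨k / 4, ?_, ?_⟩
      · have : k ≤ (N - 1) / q ^ 2 := by
          rw [Nat.le_div_iff_mul_le hq0, mul_comm]; omega
        rw [Finset.mem_range]; omega
      · congr 1; omega
  rw [hcard]
  have hqr : (0 : ℝ) < (q : ℝ) ^ 2 := by exact_mod_cast hq0
  rcases Nat.eq_zero_or_pos N with rfl | hN
  · simp
  set A := (N - 1) / q ^ 2 with hA
  have h1 : A * q ^ 2 ≤ N - 1 := Nat.div_mul_le_self _ _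
  have h2 : N - 1 < (A + 1) * q ^ 2 := by
    have := Nat.lt_div_mul_add (a := N - 1) hq0
    rw [add_mul, one_mul]; exact this
  have h3 : (A : ℝ) ≤ N * ((q : ℝ) ^ 2)⁻¹ := by
    rw [← div_eq_mul_inv, le_div_iff₀ hqr]
    have : A * q ^ 2 ≤ N := by omega
    exact_mod_cast this
  have h4 : N * ((q : ℝ) ^ 2)⁻¹ ≤ A + 1 := by
    rw [← div_eq_mul_inv, div_le_iff₀ hqr]
    have : N ≤ (A + 1) * q ^ 2 := by omega
    exact_mod_cast this
  have h5 : (A : ℝ) ≤ 4 * (((A + 2) / 4 : ℕ) : ℝ) + 1 := by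
    exact_mod_cast (by omega : A ≤ 4 * ((A + 2) / 4) + 1)
  have h6 : 4 * (((A + 2) / 4 : ℕ) : ℝ) ≤ A + 2 := by
    exact_mod_cast (by omega : 4 * ((A + 2) / 4) ≤ A + 2)
  rw [abs_le]
  constructor <;> nlinarith

/-- The number of squarefree integers `2` modulo `4`. -/
lemma card_squarefree_two_mod_four : ∃ C : ℝ, 0 ≤ C ∧ ∀ N : ℕ, 1 ≤ N →
    |(((Finset.range N).filter fun D => Squarefree D ∧ D % 4 = 2).card : ℝ) -
      2 / Real.pi ^ 2 * N| ≤ C * (N : ℝ) ^ ((19 : ℝ) / 20) := by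
  obtain ⟨C, hC, h⟩ := sum_moebius_inv_sq (ε := 1 / 20) (by norm_num) (by norm_num)
  refine ⟨C + 2, by positivity, fun N hN => ?_⟩
  set Q := Nat.sqrt N + 1 with hQdef
  have hQ : N ≤ Q ^ 2 := (Nat.lt_succ_sqrt' N).le
  have hN0 : (0 : ℝ) < N := by exact_mod_cast hN
  have e1 : (((Finset.range N).filter fun D => Squarefree D ∧ D % 4 = 2).card : ℝ) =
      ∑ q ∈ Finset.Icc 1 Q, (if Odd q then (moebius q : ℝ) *
        (((Finset.range N).filter fun D => D % 4 = 2 ∧ q ^ 2 ∣ D).card : ℝ) else 0) := by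
    have e2 : (((Finset.range N).filter fun D => Squarefree D ∧ D % 4 = 2).card : ℝ) =
        ∑ D ∈ (Finset.range N).filter (fun D => D % 4 = 2),
          ∑ q ∈ Finset.Icc 1 Q, (if q ^ 2 ∣ D then (moebius q : ℝ) else 0) := by
      rw [Finset.sum_congr rfl (g := fun D => if Squarefree D then (1 : ℝ) else 0)]
      · rw [← Finset.sum_filter, Finset.filter_filter, Finset.sum_const, nsmul_eq_mul, mul_one]
        congr 3
        ext D
        exact and_comm
      · intro D hD
        rw [Finset.mem_filter, Finset.mem_range] at hD
        exact sum_moebius_sq_dvd (by rintro rfl; omega) (by omega)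
    rw [e2, Finset.sum_comm]
    refine Finset.sum_congr rfl fun q _ => ?_
    rw [← Finset.sum_filter, Finset.filter_filter, Finset.sum_const, nsmul_eq_mul]
    split_ifs with ho
    · rw [mul_comm]
    · rw [Finset.card_eq_zero.2, Nat.cast_zero, zero_mul]
      rw [Finset.filter_eq_empty_iff]
      intro D _ hD
      exact ho (odd_of_sq_dvd hD.2 hD.1)
  have e3 : |∑ q ∈ Finset.Icc 1 Q, (if Odd q then (moebius q : ℝ) *
        (((Finset.range N).filter fun D => D % 4 = 2 ∧ q ^ 2 ∣ D).card : ℝ) else 0) -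
      N / 4 * ∑ q ∈ Finset.Icc 1 Q, (if Odd q then (moebius q : ℝ) * ((q : ℝ) ^ 2)⁻¹ else 0)| ≤ Q := by
    rw [Finset.mul_sum, ← Finset.sum_sub_distrib]
    refine (Finset.abs_sum_le_sum_abs _ _).trans ?_
    calc _ ≤ ∑ q ∈ Finset.Icc 1 Q, (1 : ℝ) := by
          refine Finset.sum_le_sum fun q _ => ?_
          split_ifs with ho
          · rw [mul_left_comm, ← mul_sub, abs_mul]
            exact mul_le_one₀ (abs_moebius_le_one q) (abs_nonneg _) (card_sq_dvd_two_mod_four ho N)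
          · simp
      _ = Q := by simp
  have e4 := h Q (by omega)
  rw [pow_one] at e4
  have hQr : (N : ℝ) ≤ (Q : ℝ) ^ 2 := by exact_mod_cast hQ
  have hNh : ((N : ℝ) ^ ((1 : ℝ) / 2)) ≤ Q := by
    rw [← Real.sqrt_eq_rpow]; exact Real.sqrt_le_iff.2 ⟨by positivity, hQr⟩
  have h5 : (Q : ℝ) ^ (-1 + 2 * (1 / 20) : ℝ) ≤ (N : ℝ) ^ (-(1 : ℝ) / 20) := by
    calc _ ≤ ((N : ℝ) ^ ((1 : ℝ) / 2)) ^ (-1 + 2 * (1 / 20) : ℝ) :=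
          Real.rpow_le_rpow_of_nonpos (by positivity) hNh (by norm_num)
      _ = (N : ℝ) ^ ((1 : ℝ) / 2 * (-1 + 2 * (1 / 20))) := by rw [← Real.rpow_mul hN0.le]
      _ ≤ _ := Real.rpow_le_rpow_of_exponent_le (by exact_mod_cast hN) (by norm_num)
  have h6 : (N : ℝ) * (N : ℝ) ^ (-(1 : ℝ) / 20) = (N : ℝ) ^ ((19 : ℝ) / 20) := by
    nth_rw 1 [← Real.rpow_one (N : ℝ)]
    rw [← Real.rpow_add hN0]; norm_num
  have h7 : (Q : ℝ) ≤ 2 * (N : ℝ) ^ ((19 : ℝ) / 20) := by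
    have h8 : (1 : ℝ) ≤ (N : ℝ) ^ ((19 : ℝ) / 20) :=
      Real.one_le_rpow (by exact_mod_cast hN) (by norm_num)
    have h9 : ((Nat.sqrt N : ℕ) : ℝ) ≤ (N : ℝ) ^ ((1 : ℝ) / 2) := by
      rw [← Real.sqrt_eq_rpow]
      exact Real.nat_sqrt_le_real_sqrt
    have h10 : (N : ℝ) ^ ((1 : ℝ) / 2) ≤ (N : ℝ) ^ ((19 : ℝ) / 20) :=
      Real.rpow_le_rpow_of_exponent_le (by exact_mod_cast hN) (by norm_num)
    rw [hQdef]; push_cast; linarith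
  rw [e1]
  rw [abs_le] at e3 e4 ⊢
  have hpi : (2 : ℝ) / Real.pi ^ 2 * N = N / 4 * (8 / Real.pi ^ 2) := by ring
  have h11 : C * (Q : ℝ) ^ (-1 + 2 * (1 / 20) : ℝ) ≤ C * (N : ℝ) ^ (-(1 : ℝ) / 20) :=
    mul_le_mul_of_nonneg_left h5 hC
  have h12 : (N : ℝ) / 4 * (C * (Q : ℝ) ^ (-1 + 2 * (1 / 20) : ℝ)) ≤ C * (N : ℝ) ^ ((19 : ℝ) / 20) := by
    rw [← h6]
    have : 0 ≤ C * (N : ℝ) ^ (-(1 : ℝ) / 20) := by positivity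
    calc _ ≤ (N : ℝ) / 4 * (C * (N : ℝ) ^ (-(1 : ℝ) / 20)) := by gcongr
      _ ≤ N * (C * (N : ℝ) ^ (-(1 : ℝ) / 20)) := by nlinarith
      _ = _ := by ring
  have h13 : 0 ≤ (N : ℝ) / 4 := by positivity
  have h14 := mul_le_mul_of_nonneg_left e4.1 h13
  have h15 := mul_le_mul_of_nonneg_left e4.2 h13
  constructor <;> linarith

end SquarefreeSieve

section CuspCount

/-- Counting integers of an interval in one residue class. -/
lemma card_le_of_dvd_sub {s : Finset ℤ} {m : ℕ} (hm : 0 < m) {lo hi : ℝ} (hlh : lo ≤ hi)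
    (h1 : ∀ x ∈ s, lo ≤ x ∧ (x : ℝ) ≤ hi) (h2 : ∀ x ∈ s, ∀ y ∈ s, (m : ℤ) ∣ x - y) :
    (s.card : ℝ) ≤ (hi - lo) / m + 1 := by
  have hm' : (0 : ℝ) < m := by exact_mod_cast hm
  have hmz : (m : ℤ) ≠ 0 := by exact_mod_cast hm.ne'
  rcases s.eq_empty_or_nonempty with rfl | hs
  · simp only [Finset.card_empty, Nat.cast_zero]
    have := div_nonneg (sub_nonneg.2 hlh) hm'.le
    linarith
  set x₀ := s.min' hs with hx₀
  have hx₀s := s.min'_mem hs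
  have hcard : s.card ≤ (Finset.range (⌊(hi - lo) / m⌋₊ + 1)).card := by
    refine Finset.card_le_card_of_injOn (fun x => ((x - x₀) / m).toNat) ?_ ?_
    · intro x hx
      obtain ⟨k, hk⟩ := h2 x hx x₀ hx₀s
      have hle := s.min'_le x hx
      simp only [Finset.coe_range, Set.mem_Iio]
      rw [hk, Int.mul_ediv_cancel_left _ hmz, Nat.lt_succ_iff, Nat.le_floor_iff
        (div_nonneg (sub_nonneg.2 hlh) hm'.le), le_div_iff₀ hm']
      have hk0 : 0 ≤ k := by
        by_contra hneg
        have : (0 : ℤ) < m := by exact_mod_cast hm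
        nlinarith
      have e : ((k.toNat : ℕ) : ℝ) = k := by
        exact_mod_cast congrArg (Int.cast (R := ℝ)) (Int.toNat_of_nonneg hk0)
      rw [e]
      have e2 : (x : ℝ) - x₀ = m * k := by exact_mod_cast hk
      have := (h1 x hx).2
      have := (h1 x₀ hx₀s).1
      linarith
    · intro x hx y hy hxy
      obtain ⟨k, hk⟩ := h2 x hx x₀ hx₀s
      obtain ⟨l, hl⟩ := h2 y hy x₀ hx₀s
      have hlx := s.min'_le x hx
      have hly := s.min'_le y hy
      simp only [hk, hl, Int.mul_ediv_cancel_left _ hmz] at hxy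
      have hmp : (0 : ℤ) < m := by exact_mod_cast hm
      have hk0 : 0 ≤ k := by by_contra hneg; nlinarith
      have hl0 : 0 ≤ l := by by_contra hneg; nlinarith
      have : k = l := by omega
      rw [this, ← hl] at hk
      omega
  rw [Finset.card_range] at hcard
  have h3 : ((⌊(hi - lo) / m⌋₊ : ℕ) : ℝ) ≤ (hi - lo) / m :=
    Nat.floor_le (div_nonneg (sub_nonneg.2 hlh) hm'.le)
  have h4 : (s.card : ℝ) ≤ (⌊(hi - lo) / m⌋₊ : ℝ) + 1 := by exact_mod_cast hcard
  linarith

/-- The leading coefficient of the cubic covariant. -/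
def hG {S : Type*} [CommRing S] (f : Fin 4 → S) : S :=
  f 0 ^ 2 * f 3 - 3 * f 0 * f 1 * f 2 + 2 * f 1 ^ 3

lemma four_hP_cube {S : Type*} [CommRing S] (f : Fin 4 → S) :
    4 * hP f ^ 3 - hG f ^ 2 = f 0 ^ 2 * dsc f := by
  simp only [hG, dsc, hP, hQ, hR]; ring

lemma hG_eq {S : Type*} [CommRing S] (f : Fin 4 → S) :
    f 0 * hQ f = 2 * f 1 * hP f - hG f := by
  simp only [hG, hP, hQ]; ring

lemma RedCubic.three_sq_le_dsc {f : Fin 4 → ℤ} (h : RedCubic f) : 3 * hP f ^ 2 ≤ dsc f := by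
  obtain ⟨h0, h1, h2, h3, -⟩ := h
  unfold dsc
  nlinarith

lemma RedCubic.three_sq_le {f : Fin 4 → ℤ} (h : RedCubic f) : 3 * f 0 ^ 2 ≤ 4 * hP f := by
  have h1 := four_hP_cube f
  have h2 := h.three_sq_le_dsc
  have h0 := h.1
  by_contra hlt
  have h3 : f 0 ^ 2 * (3 * hP f ^ 2) ≤ f 0 ^ 2 * dsc f := by gcongr
  nlinarith [sq_nonneg (hG f), pow_pos h0 2]

lemma RedCubic.ext_of_hG {f g : Fin 4 → ℤ} (hf : RedCubic f) (hg : RedCubic g) (h0 : 0 < f 0)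
    (ha : f 0 = g 0) (hb : f 1 % f 0 = g 1 % g 0) (hPe : hP f = hP g) (hGe : hG f = hG g) :
    f = g := by
  have ha0 : f 0 ≠ 0 := h0.ne'
  obtain ⟨hf0, hf1, hf2, -⟩ := hf
  obtain ⟨-, hg1, hg2, -⟩ := hg
  rw [ha] at hb
  obtain ⟨k, hk⟩ : g 0 ∣ f 1 - g 1 := Int.ModEq.dvd (Int.ModEq.symm hb)
  have e1 := hG_eq f
  have e2 := hG_eq g
  rw [← ha, ← hPe, ← hGe] at e2
  have e3 : f 0 * (hQ f - hQ g - 2 * k * hP f) = 0 := by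
    rw [← ha] at hk
    linear_combination e1 - e2 + 2 * hP f * hk
  have e4 : hQ f - hQ g = 2 * k * hP f := by
    rcases mul_eq_zero.1 e3 with h | h
    · exact absurd h ha0
    · linarith
  have hk0 : k = 0 := by
    by_contra hne
    rcases lt_or_gt_of_ne hne with h | h
    · nlinarith
    · nlinarith
  subst hk0
  have hb1 : f 1 = g 1 := by linarith
  have hQe : hQ f = hQ g := by linarith
  have hc : f 2 = g 2 := by
    have : f 0 * f 2 = f 0 * g 2 := by
      have := hPe
      simp only [hP] at this
      rw [← ha, hb1] at this
      linarith
    exact mul_left_cancel₀ ha0 this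
  have hd : f 3 = g 3 := by
    have : f 0 * f 3 = f 0 * g 3 := by
      have := hQe
      simp only [hQ] at this
      rw [← ha, hb1, hc] at this
      linarith
    exact mul_left_cancel₀ ha0 this
  ext i
  fin_cases i
  exacts [ha, hb1, hc, hd]

lemma card_sqrt_window {a q : ℕ} (ha : 0 < a) (hq : Squarefree q) {X V : ℝ} (hX : 0 ≤ X)
    {t : ℤ} {s : Finset ℤ}
    (h : ∀ G ∈ s, V - 4 * X * (a : ℝ) ^ 2 ≤ (G : ℝ) ^ 2 ∧ (G : ℝ) ^ 2 ≤ V ∧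
      (a : ℤ) ^ 2 ∣ G - t ∧ (q : ℤ) ∣ G) :
    (s.card : ℝ) ≤ 2 * (2 * √X * (Nat.gcd a q / (a * q)) + 1) := by
  have hq0 : 0 < q := Nat.pos_of_ne_zero hq.ne_zero
  set m := Nat.lcm (a ^ 2) q with hm
  have hm0 : 0 < m := Nat.lcm_pos (by positivity) hq0
  have hgcd : Nat.gcd (a ^ 2) q = Nat.gcd a q := by
    apply Nat.dvd_antisymm
    · have h1 : Squarefree (Nat.gcd (a ^ 2) q) := hq.squarefree_of_dvd (Nat.gcd_dvd_right _ _)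
      exact Nat.dvd_gcd ((h1.dvd_pow_iff_dvd two_ne_zero).1 (Nat.gcd_dvd_left _ _))
        (Nat.gcd_dvd_right _ _)
    · exact Nat.gcd_dvd_gcd_of_dvd_left _ (dvd_pow_self a two_ne_zero)
  have hmr : (m : ℝ) * Nat.gcd a q = a ^ 2 * q := by
    have := Nat.lcm_mul_gcd (a ^ 2) q
    rw [hgcd] at this
    exact_mod_cast this
  have ha' : (0 : ℝ) < a := by exact_mod_cast ha
  have hq' : (0 : ℝ) < q := by exact_mod_cast hq0
  have hm' : (0 : ℝ) < m := by exact_mod_cast hm0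
  have hdvd : ∀ x ∈ s, ∀ y ∈ s, (m : ℤ) ∣ x - y := by
    intro x hx y hy
    have h1 : (a : ℤ) ^ 2 ∣ x - y := by
      have := dvd_sub (h x hx).2.2.1 (h y hy).2.2.1
      simpa using this
    have h2 : (q : ℤ) ∣ x - y := dvd_sub (h x hx).2.2.2 (h y hy).2.2.2
    rw [Int.natCast_dvd] at h2 ⊢
    refine Nat.lcm_dvd (Int.natCast_dvd.1 ?_) h2
    exact_mod_cast h1
  set lo := √(V - 4 * X * (a : ℝ) ^ 2)
  set hi := √V
  have hlohi : lo ≤ hi := Real.sqrt_le_sqrt (by have : 0 ≤ 4 * X * (a : ℝ) ^ 2 := by positivity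
                                                linarith)
  have hdiff : hi - lo ≤ 2 * a * √X := by
    have h1 : √(4 * X * (a : ℝ) ^ 2) = 2 * a * √X := by
      rw [show 4 * X * (a : ℝ) ^ 2 = (2 * a) ^ 2 * X by ring, Real.sqrt_mul (by positivity),
        Real.sqrt_sq (by positivity)]
    have h2 : hi ≤ lo + √(4 * X * (a : ℝ) ^ 2) := by
      refine Real.sqrt_le_iff.2 ⟨by positivity, ?_⟩
      have h3 : V - 4 * X * (a : ℝ) ^ 2 ≤ lo ^ 2 := by
        rcases le_total 0 (V - 4 * X * (a : ℝ) ^ 2) with h | h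
        · exact (Real.sq_sqrt h).ge
        · exact h.trans (sq_nonneg _)
      have h4 := Real.sq_sqrt (show 0 ≤ 4 * X * (a : ℝ) ^ 2 by positivity)
      nlinarith [Real.sqrt_nonneg (4 * X * (a : ℝ) ^ 2), Real.sqrt_nonneg (V - 4 * X * (a : ℝ) ^ 2)]
    linarith
  have hwin : ∀ G ∈ s, lo ≤ |(G : ℝ)| ∧ |(G : ℝ)| ≤ hi := by
    intro G hG
    obtain ⟨h1, h2, -⟩ := h G hG
    rw [← Real.sqrt_sq_eq_abs]
    exact ⟨Real.sqrt_le_sqrt h1, Real.sqrt_le_sqrt h2⟩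
  have hkey : (hi - lo) / m + 1 ≤ 2 * √X * (Nat.gcd a q / (a * q)) + 1 := by
    gcongr
    have : 2 * √X * (Nat.gcd a q / (a * q)) = 2 * a * √X / m := by
      field_simp
      linear_combination √X * hmr
    rw [this]
    gcongr
  have hpos := card_le_of_dvd_sub (s := s.filter (0 ≤ ·)) hm0 hlohi
    (fun x hx => by
      rw [Finset.mem_filter] at hx
      have := hwin x hx.1
      rwa [abs_of_nonneg (by exact_mod_cast hx.2)] at this)
    (fun x hx y hy => hdvd x (Finset.mem_filter.1 hx).1 y (Finset.mem_filter.1 hy).1)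
  have hneg := card_le_of_dvd_sub (s := s.filter (¬ 0 ≤ ·)) hm0 (neg_le_neg hlohi)
    (fun x hx => by
      rw [Finset.mem_filter, not_le] at hx
      have := hwin x hx.1
      rw [abs_of_neg (by exact_mod_cast hx.2)] at this
      constructor <;> linarith)
    (fun x hx y hy => hdvd x (Finset.mem_filter.1 hx).1 y (Finset.mem_filter.1 hy).1)
  rw [neg_sub_neg] at hneg
  have hc : (s.card : ℝ) = (s.filter (0 ≤ ·)).card + (s.filter (¬ 0 ≤ ·)).card := by
    exact_mod_cast (Finset.card_filter_add_card_filter_not (s := s) (0 ≤ ·)).symm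
  linarith

lemma card_squarefree_divisors (n : ℕ) (hn : n ≠ 0) :
    (n.divisors.filter Squarefree).card = 2 ^ n.primeFactors.card := by
  have := Nat.sum_divisors_filter_squarefree hn (f := fun _ => (1 : ℕ))
  simp only [Finset.sum_const, smul_eq_mul, mul_one, Finset.card_powerset] at this
  rw [this, Nat.factors_eq]
  congr 2

/-- Reduced cubic forms of bounded discriminant and Hessian minimum, with a squarefree divisor of
the Hessian. -/
def contentPairs (X M Q : ℝ) : Set ((Fin 4 → ℤ) × ℕ) :=
  {x | RedCubic x.1 ∧ 0 < x.1 0 ∧ ((dsc x.1 : ℤ) : ℝ) < 4 * X ∧ ((hP x.1 : ℤ) : ℝ) ≤ M ∧ Squarefree x.2 ∧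
    Q < x.2 ∧ (x.2 : ℤ) ∣ hP x.1 ∧ (x.2 : ℤ) ∣ hQ x.1}

/-- A finite set of parameters for `contentPairs`. -/
noncomputable def contentBox (X M Q : ℝ) : Finset (Σ _ : ℕ, Σ _ : ℕ, Σ _ : ℤ, Σ _ : ℤ, Σ _ : ℕ, ℤ) :=
  (Finset.Icc 1 ⌊2 * √M⌋₊).sigma fun a : ℕ =>
  (a.divisors.filter Squarefree).sigma fun g : ℕ =>
  ((Finset.Ico 0 (a : ℤ)).filter fun β : ℤ => (g : ℤ) ∣ β).sigma fun β : ℤ =>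
  ((Finset.Icc 1 ⌊M⌋).filter fun P : ℤ => (a : ℤ) ∣ P - β ^ 2).sigma fun P : ℤ =>
  (P.toNat.divisors.filter fun q : ℕ => Squarefree q ∧ Q < (q : ℝ) ∧ Nat.gcd a q = g).sigma fun q : ℕ =>
  (Finset.Icc (-(4 * P ^ 3)) (4 * P ^ 3)).filter fun G : ℤ =>
    (((4 * P ^ 3 : ℤ) : ℝ) - 4 * X * (a : ℝ) ^ 2 ≤ (G : ℝ) ^ 2 ∧ (G : ℝ) ^ 2 ≤ ((4 * P ^ 3 : ℤ) : ℝ) ∧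
      (a : ℤ) ^ 2 ∣ G - (3 * β * P - β ^ 3) ∧ (q : ℤ) ∣ G)

lemma contentPairs_mapsTo (X M Q : ℝ) : Set.MapsTo
    (fun x : (Fin 4 → ℤ) × ℕ => (⟨(x.1 0).toNat, Nat.gcd (x.1 0).toNat x.2, x.1 1 % x.1 0, hP x.1,
      x.2, hG x.1⟩ : Σ _ : ℕ, Σ _ : ℕ, Σ _ : ℤ, Σ _ : ℤ, Σ _ : ℕ, ℤ))
    (contentPairs X M Q) (contentBox X M Q) := by
  rintro ⟨f, q⟩ ⟨hf, h0, hX, hM, hq, hQq, hqP, hqQ⟩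
  simp only at hf h0 hX hM hq hQq hqP hqQ
  obtain ⟨a, ha⟩ : ∃ a : ℕ, f 0 = a := ⟨(f 0).toNat, by omega⟩
  have ha0 : 0 < a := by omega
  have hP0 := hf.1
  have h3 := hf.three_sq_le
  have hMr : (0 : ℝ) ≤ M := le_trans (by exact_mod_cast hP0.le) hM
  simp only [contentBox, Finset.mem_coe, Finset.mem_sigma, Finset.mem_Icc, Finset.mem_filter,
    Nat.mem_divisors, Finset.mem_Ico, ha, Int.toNat_natCast]
  have hgb : ((Nat.gcd a q : ℕ) : ℤ) ∣ f 1 := by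
    have hsq : Squarefree (Nat.gcd a q) := hq.squarefree_of_dvd (Nat.gcd_dvd_right _ _)
    have h1 : ((Nat.gcd a q : ℕ) : ℤ) ∣ f 1 ^ 2 := by
      have e : f 1 ^ 2 = hP f + f 0 * f 2 := by simp only [hP]; ring
      rw [e]
      refine dvd_add ((Int.natCast_dvd_natCast.2 (Nat.gcd_dvd_right a q)).trans hqP)
        (Dvd.dvd.mul_right ?_ _)
      rw [ha]; exact Int.natCast_dvd_natCast.2 (Nat.gcd_dvd_left a q)
    have hsq' : Squarefree ((Nat.gcd a q : ℕ) : ℤ) := Int.squarefree_natCast.2 hsq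
    exact (hsq'.dvd_pow_iff_dvd two_ne_zero).1 h1
  have hga : ((Nat.gcd a q : ℕ) : ℤ) ∣ (a : ℤ) := Int.natCast_dvd_natCast.2 (Nat.gcd_dvd_left a q)
  have hcov := four_hP_cube f
  have hd := hf.three_sq_le_dsc
  have hcovr : ((4 * hP f ^ 3 : ℤ) : ℝ) - ((hG f : ℤ) : ℝ) ^ 2 = (a : ℝ) ^ 2 * ((dsc f : ℤ) : ℝ) := by
    rw [ha] at hcov; exact_mod_cast hcov
  have hG2 : (hG f) ^ 2 ≤ 4 * hP f ^ 3 := by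
    nlinarith [mul_nonneg (sq_nonneg (f 0)) (le_trans (by positivity) hd)]
  refine ⟨⟨ha0, ?_⟩, ⟨⟨Nat.gcd_dvd_left a q, ha0.ne'⟩, hq.squarefree_of_dvd (Nat.gcd_dvd_right _ _)⟩,
    ⟨⟨Int.emod_nonneg _ (by exact_mod_cast ha0.ne'), Int.emod_lt_of_pos _ (by exact_mod_cast ha0)⟩,
    ?_⟩, ⟨⟨hP0, Int.le_floor.2 hM⟩, ?_⟩, ⟨⟨?_, by omega⟩, hq, hQq, trivial⟩, ⟨?_, ?_⟩, ?_, ?_, ?_, ?_⟩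
  · rw [Nat.le_floor_iff (by positivity)]
    have h4 : (3 : ℝ) * (a : ℝ) ^ 2 ≤ 4 * ((hP f : ℤ) : ℝ) := by rw [ha] at h3; exact_mod_cast h3
    have h5 : (a : ℝ) ^ 2 ≤ (2 * √M) ^ 2 := by
      rw [mul_pow, Real.sq_sqrt hMr]; nlinarith [sq_nonneg (a : ℝ)]
    exact le_of_sq_le_sq h5 (by positivity)
  · rw [Int.emod_def]; exact dvd_sub hgb (Dvd.dvd.mul_right hga _)
  · have e : hP f - (f 1 % a) ^ 2 = f 0 * (2 * (f 1 / a) * (f 1 % a) + a * (f 1 / a) ^ 2 - f 2) := by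
      have := Int.emod_add_mul_ediv (f 1) a
      simp only [hP]
      rw [ha]
      linear_combination (-(f 1 % a) - (a * (f 1 / a)) - f 1) * this
    rw [e, ha]; exact Dvd.intro _ rfl
  · have : (q : ℤ) ∣ (hP f).toNat := by rwa [Int.toNat_of_nonneg hP0.le]
    exact_mod_cast this
  · nlinarith [sq_nonneg (hG f + 1), abs_nonneg (hG f)]
  · nlinarith [sq_nonneg (hG f - 1)]
  · have : (a : ℝ) ^ 2 * ((dsc f : ℤ) : ℝ) ≤ (a : ℝ) ^ 2 * (4 * X) := by gcongr
    linarith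
  · exact_mod_cast hG2
  · have e := Int.emod_add_mul_ediv (f 1) a
    set β := f 1 % a
    set k := f 1 / a
    rw [ha] at hcov
    have : hG f - (3 * β * hP f - β ^ 3) = (a : ℤ) ^ 2 * (f 3 - 3 * k * f 2 + 3 * k ^ 2 * β + 2 * a * k ^ 3) := by
      simp only [hG, hP, ha, ← e]
      ring
    rw [this]; exact Dvd.intro _ rfl
  · have e : hG f = 2 * f 1 * hP f - f 0 * hQ f := by linarith [hG_eq f]
    rw [e]
    exact dvd_sub (Dvd.dvd.mul_left hqP _) (Dvd.dvd.mul_left hqQ _)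

lemma contentPairs_injOn (X M Q : ℝ) : Set.InjOn
    (fun x : (Fin 4 → ℤ) × ℕ => (⟨(x.1 0).toNat, Nat.gcd (x.1 0).toNat x.2, x.1 1 % x.1 0, hP x.1,
      x.2, hG x.1⟩ : Σ _ : ℕ, Σ _ : ℕ, Σ _ : ℤ, Σ _ : ℤ, Σ _ : ℕ, ℤ))
    (contentPairs X M Q) := by
  rintro ⟨f, q⟩ ⟨hf, h0, -⟩ ⟨f', q'⟩ ⟨hf', h0', -⟩ h
  simp only [Sigma.mk.injEq, heq_eq_eq] at h
  simp only at hf h0 hf' h0'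
  obtain ⟨h1, -, h2, h3, rfl, h4⟩ := h
  rw [hf.ext_of_hG hf' h0 (by omega) h2 h3 h4]

lemma contentPairs_finite (X M Q : ℝ) : (contentPairs X M Q).Finite :=
  Set.Finite.of_injOn (contentPairs_mapsTo X M Q) (contentPairs_injOn X M Q) (Finset.finite_toSet _)

lemma ncard_contentPairs_le_box (X M Q : ℝ) :
    (contentPairs X M Q).ncard ≤ (contentBox X M Q).card := by
  rw [← Set.ncard_coe_finset]
  exact Set.ncard_le_ncard_of_injOn _ (contentPairs_mapsTo X M Q) (contentPairs_injOn X M Q)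
    (Finset.finite_toSet _)

lemma card_contentBox_le {X M Q : ℝ} (hX : 0 ≤ X) (hM : 1 ≤ M) (hQ : 0 < Q) {W : ℝ} (hW0 : 0 ≤ W)
    (hW : ∀ n : ℕ, n ≠ 0 → (n : ℝ) ≤ 2 * M → (2 : ℝ) ^ n.primeFactors.card ≤ W) :
    ((contentBox X M Q).card : ℝ) ≤
      ∑ a ∈ Finset.Icc 1 ⌊2 * √M⌋₊, W * (6 * M * W * (2 * √X / (a * Q) + 1)) := by
  have hM0 : (0 : ℝ) < M := by linarith
  have hMs : √M ≤ M := by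
    rw [Real.sqrt_le_left hM0.le]; nlinarith
  simp only [contentBox, Finset.card_sigma, Nat.cast_sum]
  refine Finset.sum_le_sum fun a ha => ?_
  rw [Finset.mem_Icc, Nat.le_floor_iff (by positivity)] at ha
  obtain ⟨ha1, ha2⟩ := ha
  have ha0 : (0 : ℝ) < a := by exact_mod_cast ha1
  have hgc : ∀ g ∈ a.divisors.filter Squarefree,
      (∑ β ∈ (Finset.Ico 0 (a : ℤ)).filter fun β : ℤ => (g : ℤ) ∣ β,
      ∑ P ∈ (Finset.Icc 1 ⌊M⌋).filter fun P : ℤ => (a : ℤ) ∣ P - β ^ 2,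
      ∑ q ∈ P.toNat.divisors.filter fun q : ℕ => Squarefree q ∧ Q < (q : ℝ) ∧ Nat.gcd a q = g,
      ((((Finset.Icc (-(4 * P ^ 3)) (4 * P ^ 3)).filter fun G : ℤ =>
        (((4 * P ^ 3 : ℤ) : ℝ) - 4 * X * (a : ℝ) ^ 2 ≤ (G : ℝ) ^ 2 ∧ (G : ℝ) ^ 2 ≤ ((4 * P ^ 3 : ℤ) : ℝ) ∧
        (a : ℤ) ^ 2 ∣ G - (3 * β * P - β ^ 3) ∧ (q : ℤ) ∣ G)).card : ℕ) : ℝ)) ≤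
      6 * M * W * (2 * √X / (a * Q) + 1) := by
    intro g hg
    rw [Finset.mem_filter, Nat.mem_divisors] at hg
    have hg0 : 0 < g := Nat.pos_of_dvd_of_pos hg.1.1 (by omega)
    have hg0' : (0 : ℝ) < g := by exact_mod_cast hg0
    have hg1' : (1 : ℝ) ≤ g := by exact_mod_cast hg0
    have hga : (g : ℝ) ≤ a := by exact_mod_cast Nat.le_of_dvd (by omega) hg.1.1
    set T : ℝ := 2 * (2 * √X * (g / (a * Q)) + 1) with hT
    have hT0 : 0 ≤ T := by positivity
    have h1 : ∀ β ∈ (Finset.Ico 0 (a : ℤ)).filter (fun β : ℤ => (g : ℤ) ∣ β),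
        (∑ P ∈ (Finset.Icc 1 ⌊M⌋).filter fun P : ℤ => (a : ℤ) ∣ P - β ^ 2,
        ∑ q ∈ P.toNat.divisors.filter fun q : ℕ => Squarefree q ∧ Q < (q : ℝ) ∧ Nat.gcd a q = g,
        ((((Finset.Icc (-(4 * P ^ 3)) (4 * P ^ 3)).filter fun G : ℤ =>
          (((4 * P ^ 3 : ℤ) : ℝ) - 4 * X * (a : ℝ) ^ 2 ≤ (G : ℝ) ^ 2 ∧ (G : ℝ) ^ 2 ≤ ((4 * P ^ 3 : ℤ) : ℝ) ∧
          (a : ℤ) ^ 2 ∣ G - (3 * β * P - β ^ 3) ∧ (q : ℤ) ∣ G)).card : ℕ) : ℝ)) ≤ 3 * M / a * (W * T) := by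
      intro β _
      have h2 : ∀ P ∈ (Finset.Icc 1 ⌊M⌋).filter (fun P : ℤ => (a : ℤ) ∣ P - β ^ 2),
          (∑ q ∈ P.toNat.divisors.filter fun q : ℕ => Squarefree q ∧ Q < (q : ℝ) ∧ Nat.gcd a q = g,
          ((((Finset.Icc (-(4 * P ^ 3)) (4 * P ^ 3)).filter fun G : ℤ =>
            (((4 * P ^ 3 : ℤ) : ℝ) - 4 * X * (a : ℝ) ^ 2 ≤ (G : ℝ) ^ 2 ∧ (G : ℝ) ^ 2 ≤ ((4 * P ^ 3 : ℤ) : ℝ) ∧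
            (a : ℤ) ^ 2 ∣ G - (3 * β * P - β ^ 3) ∧ (q : ℤ) ∣ G)).card : ℕ) : ℝ)) ≤ W * T := by
        intro P hP
        rw [Finset.mem_filter, Finset.mem_Icc, Int.le_floor] at hP
        have hPn : P.toNat ≠ 0 := by omega
        have hPr : ((P.toNat : ℕ) : ℝ) = P := by
          exact_mod_cast congrArg (Int.cast (R := ℝ)) (Int.toNat_of_nonneg (by omega : 0 ≤ P))
        have h3 : ((P.toNat.divisors.filter fun q : ℕ => Squarefree q ∧ Q < (q : ℝ) ∧
            Nat.gcd a q = g).card : ℝ) ≤ W := by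
          refine le_trans ?_ (hW P.toNat hPn (by rw [hPr]; linarith [hP.1.2]))
          have := card_squarefree_divisors P.toNat hPn
          have h4 : (P.toNat.divisors.filter fun q : ℕ => Squarefree q ∧ Q < (q : ℝ) ∧
            Nat.gcd a q = g).card ≤ 2 ^ P.toNat.primeFactors.card := by
            rw [← this]
            exact Finset.card_le_card (Finset.monotone_filter_right _ fun q _ hq => hq.1)
          exact_mod_cast h4
        refine (Finset.sum_le_card_nsmul _ _ T ?_).trans ?_
        · intro q hq
          rw [Finset.mem_filter] at hq
          obtain ⟨-, hq1, hq2, hq3⟩ := hq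
          refine (card_sqrt_window (V := ((4 * P ^ 3 : ℤ) : ℝ)) (t := 3 * β * P - β ^ 3) ha1 hq1 hX
            (fun G hG => (Finset.mem_filter.1 hG).2)).trans ?_
          rw [hq3, hT]
          gcongr
        · rw [nsmul_eq_mul]; gcongr
      refine (Finset.sum_le_card_nsmul _ _ _ h2).trans ?_
      rw [nsmul_eq_mul]
      gcongr
      have h5 := card_le_of_dvd_sub (s := (Finset.Icc 1 ⌊M⌋).filter fun P : ℤ => (a : ℤ) ∣ P - β ^ 2)
        ha1 hM (fun P hP => by
          rw [Finset.mem_filter, Finset.mem_Icc, Int.le_floor] at hP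
          exact ⟨by exact_mod_cast hP.1.1, hP.1.2⟩) (fun x hx y hy => by
          have := dvd_sub (Finset.mem_filter.1 hx).2 (Finset.mem_filter.1 hy).2
          simpa using this)
      refine h5.trans ?_
      rw [div_add_one ha0.ne']
      gcongr
      linarith
    refine (Finset.sum_le_card_nsmul _ _ _ h1).trans ?_
    rw [nsmul_eq_mul]
    have h6 := card_le_of_dvd_sub (s := (Finset.Ico 0 (a : ℤ)).filter (fun β : ℤ => (g : ℤ) ∣ β))
        hg0 (lo := 0) (hi := a - g) (by linarith) (fun β hβ => by
          rw [Finset.mem_filter, Finset.mem_Ico] at hβ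
          refine ⟨by exact_mod_cast hβ.1.1, ?_⟩
          have : (g : ℤ) ∣ a - β := dvd_sub (Int.natCast_dvd_natCast.2 hg.1.1) hβ.2
          have := Int.le_of_dvd (by omega) this
          have h7 : β ≤ (a : ℤ) - g := by omega
          exact_mod_cast h7) (fun x hx y hy =>
          dvd_sub (Finset.mem_filter.1 hx).2 (Finset.mem_filter.1 hy).2)
    have h8 : ((a : ℝ) - g - 0) / g + 1 = a / g := by field_simp; ring
    rw [h8] at h6
    calc _ ≤ (a : ℝ) / g * (3 * M / a * (W * T)) := by gcongr
      _ = 6 * M * W * (2 * √X / (a * Q) + 1 / g) := by rw [hT]; field_simp; ring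
      _ ≤ _ := by
        gcongr
        rw [div_le_one hg0']; exact hg1'
  refine (Finset.sum_le_card_nsmul _ _ _ hgc).trans ?_
  rw [nsmul_eq_mul]
  gcongr
  rw [card_squarefree_divisors a (by omega)]
  have := hW a (by omega) (by linarith)
  exact_mod_cast this

/-- The number of reduced cubic forms with small Hessian minimum, counted with large squarefree
divisors of the Hessian. -/
theorem ncard_contentPairs_le {ε : ℝ} (hε : 0 < ε) : ∃ C : ℝ, 0 ≤ C ∧ ∀ X M Q : ℝ, 0 ≤ X → 1 ≤ M →
    0 < Q → ((contentPairs X M Q).ncard : ℝ) ≤ C * M ^ ε * (M * √X / Q + M * √M) := by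
  obtain ⟨B, hB1, hB⟩ := exists_pow_card_primeFactors_le (K := 2) (ε := ε / 3) (by norm_num)
    (by positivity)
  set c : ℝ := (2 : ℝ) ^ (ε / 3) with hc
  have hc1 : 1 ≤ c := Real.one_le_rpow (by norm_num) (by positivity)
  refine ⟨(B * c) ^ 2 * 12 * (1 + 3 / ε * c), by positivity, fun X M Q hX hM hQ => ?_⟩
  have hM0 : (0 : ℝ) < M := by linarith
  have hMs : √M ≤ M := by
    rw [Real.sqrt_le_left hM0.le]; nlinarith
  have hMs1 : 1 ≤ √M := Real.one_le_sqrt.2 hM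
  set m : ℝ := M ^ (ε / 3) with hm
  have hm1 : 1 ≤ m := Real.one_le_rpow hM (by positivity)
  have hm3 : M ^ ε = m ^ 3 := by
    rw [hm, ← Real.rpow_natCast, ← Real.rpow_mul hM0.le]; congr 1; push_cast; ring
  set W := B * (c * m) with hWd
  have hW0 : 0 ≤ W := by positivity
  have hW : ∀ n : ℕ, n ≠ 0 → (n : ℝ) ≤ 2 * M → (2 : ℝ) ^ n.primeFactors.card ≤ W := by
    intro n hn hn2
    refine (hB n hn).trans ?_
    rw [hWd, hc, hm, ← Real.mul_rpow (by norm_num) hM0.le]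
    gcongr
  have h1 := card_contentBox_le hX hM hQ hW0 hW
  have h2 : ((contentPairs X M Q).ncard : ℝ) ≤ (contentBox X M Q).card := by
    exact_mod_cast ncard_contentPairs_le_box X M Q
  refine (h2.trans h1).trans ?_
  have h3 : ∑ a ∈ Finset.Icc 1 ⌊2 * √M⌋₊, W * (6 * M * W * (2 * √X / (a * Q) + 1)) =
      6 * M * W ^ 2 * (2 * √X / Q * (∑ a ∈ Finset.Icc 1 ⌊2 * √M⌋₊, ((a : ℝ))⁻¹) + ⌊2 * √M⌋₊) := by
    have : (⌊2 * √M⌋₊ : ℝ) = ∑ a ∈ Finset.Icc 1 ⌊2 * √M⌋₊, (1 : ℝ) := by simp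
    rw [this, Finset.mul_sum, ← Finset.sum_add_distrib, Finset.mul_sum]
    refine Finset.sum_congr rfl fun a ha => ?_
    have : (a : ℝ) ≠ 0 := by
      have := (Finset.mem_Icc.1 ha).1
      exact_mod_cast (by omega : a ≠ 0)
    field_simp
  rw [h3]
  have h4 : ∑ a ∈ Finset.Icc 1 ⌊2 * √M⌋₊, ((a : ℝ))⁻¹ ≤ 1 + Real.log (2 * √M) := by
    have h5 := harmonic_le_one_add_log ⌊2 * √M⌋₊
    rw [harmonic_eq_sum_Icc] at h5
    push_cast at h5
    refine h5.trans ?_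
    gcongr
    · have : 1 ≤ ⌊2 * √M⌋₊ := (Nat.one_le_floor_iff _).2 (by linarith)
      exact_mod_cast this
    · exact Nat.floor_le (by positivity)
  have h6 : 1 + Real.log (2 * √M) ≤ (1 + 3 / ε * c) * m := by
    have h7 := Real.log_le_rpow_div (show 0 ≤ 2 * √M by positivity) (show 0 < ε / 3 by positivity)
    have h8 : (2 * √M) ^ (ε / 3) ≤ c * m := by
      rw [hc, hm, ← Real.mul_rpow (by norm_num) hM0.le]
      gcongr
    have h9 : (2 * √M) ^ (ε / 3) / (ε / 3) ≤ 3 / ε * c * m := by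
      rw [div_le_iff₀ (by positivity)]
      refine h8.trans (le_of_eq ?_)
      field_simp
    linarith
  calc _ ≤ 6 * M * W ^ 2 * (2 * √X / Q * ((1 + 3 / ε * c) * m) + 2 * √M * ((1 + 3 / ε * c) * m)) := by
        gcongr
        · exact h4.trans h6
        · refine (Nat.floor_le (by positivity)).trans ?_
          have : 1 ≤ (1 + 3 / ε * c) * m := by
            have : 0 ≤ 3 / ε * c := by positivity
            nlinarith
          exact le_mul_of_one_le_right (by positivity) this
    _ = _ := by rw [hWd, hm3]; ring

end CuspCount

section CubicParam

open MeasureTheory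

/-- Coordinates `(u, w, θ, s)` on real binary cubic forms of positive `dsc`: `s ^ 2` is the leading
coefficient of the Hessian, `u` the real part of its root, `w ^ 2` the value of `dsc`. -/
noncomputable def cubicParam (x : Fin 4 → ℝ) : Fin 4 → ℝ :=
  ![2 * x 3 ^ 3 * Real.cos (x 2) / x 1,
    x 3 * Real.sin (x 2) + x 0 * (2 * x 3 ^ 3 * Real.cos (x 2) / x 1),
    -(x 1 * Real.cos (x 2) / (2 * x 3)) + 2 * x 0 * (x 3 * Real.sin (x 2)) +
      x 0 ^ 2 * (2 * x 3 ^ 3 * Real.cos (x 2) / x 1),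
    -(x 1 ^ 2 * Real.sin (x 2) / (4 * x 3 ^ 3)) - 3 * x 0 * (x 1 * Real.cos (x 2) / (2 * x 3)) +
      3 * x 0 ^ 2 * (x 3 * Real.sin (x 2)) + x 0 ^ 3 * (2 * x 3 ^ 3 * Real.cos (x 2) / x 1)]

variable {x : Fin 4 → ℝ}

lemma hP_cubicParam (h1 : x 1 ≠ 0) (h3 : x 3 ≠ 0) : hP (cubicParam x) = x 3 ^ 2 := by
  simp only [hP, cubicParam, Matrix.cons_val]
  field_simp
  linear_combination (x 1 ^ 2) * Real.sin_sq_add_cos_sq (x 2)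

lemma hQ_cubicParam (h1 : x 1 ≠ 0) (h3 : x 3 ≠ 0) : hQ (cubicParam x) = 2 * x 3 ^ 2 * x 0 := by
  simp only [hQ, cubicParam, Matrix.cons_val]
  field_simp
  linear_combination (16 * x 1 ^ 2 * x 3 ^ 2 * x 0) * Real.sin_sq_add_cos_sq (x 2)

lemma hR_cubicParam (h1 : x 1 ≠ 0) (h3 : x 3 ≠ 0) :
    hR (cubicParam x) = x 3 ^ 2 * x 0 ^ 2 + x 1 ^ 2 / (4 * x 3 ^ 2) := by
  simp only [hR, cubicParam, Matrix.cons_val]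
  field_simp
  linear_combination (16 * x 1 ^ 2 * x 3 ^ 4 * x 0 ^ 2 + 4 * x 1 ^ 4) * Real.sin_sq_add_cos_sq (x 2)

lemma dsc_cubicParam (h1 : x 1 ≠ 0) (h3 : x 3 ≠ 0) : dsc (cubicParam x) = x 1 ^ 2 := by
  simp only [dsc, hP_cubicParam h1 h3, hQ_cubicParam h1 h3, hR_cubicParam h1 h3]
  field_simp
  ring

/-- The Jacobian matrix of `cubicParam`. -/
noncomputable def cubicParamJac (x : Fin 4 → ℝ) : Matrix (Fin 4) (Fin 4) ℝ :=
  let S := Real.sin (x 2)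
  let C := Real.cos (x 2)
  let u := x 0
  let w := x 1
  let s := x 3
  !![0, -(2 * s ^ 3 * C / w ^ 2), -(2 * s ^ 3 * S / w), 6 * s ^ 2 * C / w;
    2 * s ^ 3 * C / w, -(u * (2 * s ^ 3 * C / w ^ 2)), s * C - u * (2 * s ^ 3 * S / w),
      S + u * (6 * s ^ 2 * C / w);
    2 * (s * S + u * (2 * s ^ 3 * C / w)), -(C / (2 * s)) - u ^ 2 * (2 * s ^ 3 * C / w ^ 2),
      w * S / (2 * s) + 2 * u * (s * C) - u ^ 2 * (2 * s ^ 3 * S / w),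
      w * C / (2 * s ^ 2) + 2 * u * S + u ^ 2 * (6 * s ^ 2 * C / w);
    3 * (-(w * C / (2 * s)) + 2 * u * (s * S) + u ^ 2 * (2 * s ^ 3 * C / w)),
      -(w * S / (2 * s ^ 3)) - 3 * u * (C / (2 * s)) - u ^ 3 * (2 * s ^ 3 * C / w ^ 2),
      -(w ^ 2 * C / (4 * s ^ 3)) + 3 * u * (w * S / (2 * s)) + 3 * u ^ 2 * (s * C)
        - u ^ 3 * (2 * s ^ 3 * S / w),
      3 * w ^ 2 * S / (4 * s ^ 4) + 3 * u * (w * C / (2 * s ^ 2)) + 3 * u ^ 2 * S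
        + u ^ 3 * (6 * s ^ 2 * C / w)]

lemma abs_det_cubicParamJac (h1 : x 1 ≠ 0) (h3 : 0 < x 3) :
    |(cubicParamJac x).det| = 2 * x 3 := by
  have h : (cubicParamJac x).det = 2 * x 3 ∨ (cubicParamJac x).det = -(2 * x 3) := by
    have h3' := h3.ne'
    have hsc := Real.sin_sq (x 2)
    simp only [cubicParamJac, Matrix.det_succ_row_zero, Fin.sum_univ_succ, Matrix.of_apply,
      Matrix.submatrix_apply, Matrix.det_unique, Fin.default_eq_zero,
      Fin.succAbove, Finset.univ_unique, Finset.sum_singleton, Matrix.cons_val_zero, Matrix.cons_val_succ]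
    left
    simp [Fin.lt_def]
    field_simp
    have e4 : Real.sin (x 2) ^ 4 = (1 - Real.cos (x 2) ^ 2) ^ 2 := by rw [← hsc]; ring
    ring_nf
    rw [e4, hsc]
    ring
  rcases h with h | h <;> rw [h]
  · exact abs_of_pos (by linarith)
  · rw [abs_neg]; exact abs_of_pos (by linarith)

lemma hasFDerivAt_cubicParam (h1 : x 1 ≠ 0) (h3 : x 3 ≠ 0) :
    HasFDerivAt cubicParam (Matrix.toLin' (cubicParamJac x)).toContinuousLinearMap x := by
  have p (i : Fin 4) : HasFDerivAt (fun y : Fin 4 → ℝ => y i)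
    (ContinuousLinearMap.proj (R := ℝ) (φ := fun _ : Fin 4 => ℝ) i) x := hasFDerivAt_apply i x
  have pinv (i : Fin 4) (hi : x i ≠ 0) := (hasDerivAt_inv hi).comp_hasFDerivAt x (p i)
  have ha := ((((p 3).pow 3).const_mul 2).mul (p 2).cos).mul (pinv 1 h1)
  have hb := (p 3).mul (p 2).sin
  have hc := (((p 1).mul (p 2).cos).mul (pinv 3 h3)).const_mul (1 / 2)
  have hd := ((((p 1).pow 2).mul (p 2).sin).mul ((pinv 3 h3).pow 3)).const_mul (1 / 4)
  rw [hasFDerivAt_pi']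
  intro i
  fin_cases i
  · refine (ha.congr_fderiv ?_).congr_of_eventuallyEq (Filter.Eventually.of_forall fun y => ?_)
    · ext v
      simp [cubicParamJac, dotProduct, Fin.sum_univ_four]
      field_simp
      ring
    · simp [cubicParam, div_eq_mul_inv]
  · refine ((hb.add ((p 0).mul ha)).congr_fderiv ?_).congr_of_eventuallyEq
      (Filter.Eventually.of_forall fun y => ?_)
    · ext v
      simp [cubicParamJac, dotProduct, Fin.sum_univ_four]
      field_simp
      ring
    · simp [cubicParam, div_eq_mul_inv]
  · refine (((hc.neg.add (((p 0).const_mul 2).mul hb)).add (((p 0).pow 2).mul ha)).congr_fderiv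
      ?_).congr_of_eventuallyEq (Filter.Eventually.of_forall fun y => ?_)
    · ext v
      simp [cubicParamJac, dotProduct, Fin.sum_univ_four]
      field_simp
      ring
    · simp [cubicParam, div_eq_mul_inv]
      ring
  · refine (((hd.neg.sub (((p 0).const_mul 3).mul hc)).add ((((p 0).pow 2).const_mul 3).mul hb)).add
      (((p 0).pow 3).mul ha) |>.congr_fderiv
      ?_).congr_of_eventuallyEq (Filter.Eventually.of_forall fun y => ?_)
    · ext v
      simp [cubicParamJac, dotProduct, Fin.sum_univ_four]
      field_simp
      ring
    · simp [cubicParam, div_eq_mul_inv]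
      ring

lemma real_cubic_ext {f g : Fin 4 → ℝ} (hp : hP f ≠ 0) (h1 : hP f = hP g) (h2 : hQ f = hQ g)
    (h3 : hR f = hR g) (h4 : f 0 = g 0) (h5 : f 1 = g 1) : f = g := by
  have hc : f 2 = g 2 := by
    apply mul_left_cancel₀ hp
    rw [hess_rel_c, h1, hess_rel_c, h2, h3, h4, h5]
  have hd : f 3 = g 3 := by
    apply mul_left_cancel₀ hp
    rw [hess_rel_d, h1, hess_rel_d, h2, h3, hc, h5]
  ext i
  fin_cases i
  exacts [h4, h5, hc, hd]

lemma exists_cubicParam_eq {f : Fin 4 → ℝ} (h0 : 0 < f 0) (hp : 0 < hP f) (hd : 0 < dsc f) :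
    cubicParam ![hQ f / (2 * hP f), √(dsc f), Real.arcsin (hG f / (2 * √(hP f) ^ 3)), √(hP f)] = f := by
  set s := √(hP f) with hs
  set w := √(dsc f) with hw
  set θ := Real.arcsin (hG f / (2 * s ^ 3)) with hθ
  have hs0 : 0 < s := Real.sqrt_pos.2 hp
  have hw0 : 0 < w := Real.sqrt_pos.2 hd
  have hs2 : s ^ 2 = hP f := Real.sq_sqrt hp.le
  have hw2 : w ^ 2 = dsc f := Real.sq_sqrt hd.le
  have hcov := four_hP_cube f
  rw [← hs2, ← hw2] at hcov
  have hsq : (hG f / (2 * s ^ 3)) ^ 2 + (f 0 * w / (2 * s ^ 3)) ^ 2 = 1 := by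
    field_simp
    linarith
  have habs : |hG f / (2 * s ^ 3)| ≤ 1 := by
    rw [← sq_le_one_iff_abs_le_one]
    nlinarith [sq_nonneg (f 0 * w / (2 * s ^ 3))]
  have hsin : Real.sin θ = hG f / (2 * s ^ 3) := Real.sin_arcsin (abs_le.1 habs).1 (abs_le.1 habs).2
  have hcos : Real.cos θ = f 0 * w / (2 * s ^ 3) := by
    rw [hθ, Real.cos_arcsin]
    refine (Real.sqrt_eq_iff_mul_self_eq (by nlinarith [sq_nonneg (f 0 * w / (2 * s ^ 3))]) (by positivity)).2 ?_
    nlinarith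
  set x : Fin 4 → ℝ := ![hQ f / (2 * hP f), w, θ, s] with hx
  have x1 : x 1 ≠ 0 := hw0.ne'
  have x3 : x 3 ≠ 0 := hs0.ne'
  have e1 := hP_cubicParam x1 x3
  have e2 := hQ_cubicParam x1 x3
  have e3 := hR_cubicParam x1 x3
  have x0' : x 0 = hQ f / (2 * hP f) := rfl
  have x1' : x 1 = w := rfl
  have x2' : x 2 = θ := rfl
  have x3' : x 3 = s := rfl
  rw [x3', hs2] at e1 e2 e3
  rw [x0'] at e2 e3
  rw [x1', hw2] at e3
  have ha : cubicParam x 0 = f 0 := by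
    simp only [cubicParam, x0', x1', x2', x3', hcos, Matrix.cons_val]
    field_simp
  refine real_cubic_ext (by rw [e1]; exact hp.ne') e1 ?_ ?_ ha ?_
  · rw [e2]; field_simp
  · rw [e3]; simp only [dsc]; field_simp; ring
  · have hb : cubicParam x 1 = s * Real.sin θ + hQ f / (2 * hP f) * cubicParam x 0 := by
      simp only [cubicParam, x0', x1', x2', x3', Matrix.cons_val]
    rw [hb, ha, hsin]
    have e := hG_eq f
    rw [← hs2] at e ⊢
    field_simp
    linarith

lemma cubicParam_injOn : Set.InjOn cubicParam
    {x | 0 < x 1 ∧ |x 2| ≤ Real.pi / 2 ∧ 0 < x 3} := by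
  rintro x ⟨x1, x2, x3⟩ y ⟨y1, y2, y3⟩ h
  have p := congrArg hP h
  have q := congrArg hQ h
  have d := congrArg dsc h
  rw [hP_cubicParam x1.ne' x3.ne', hP_cubicParam y1.ne' y3.ne'] at p
  rw [hQ_cubicParam x1.ne' x3.ne', hQ_cubicParam y1.ne' y3.ne'] at q
  rw [dsc_cubicParam x1.ne' x3.ne', dsc_cubicParam y1.ne' y3.ne'] at d
  have e3 : x 3 = y 3 := by
    rwa [sq_eq_sq₀ x3.le y3.le] at p
  have e1 : x 1 = y 1 := by
    rwa [sq_eq_sq₀ x1.le y1.le] at d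
  have e0 : x 0 = y 0 := by
    rw [e3] at q
    exact mul_left_cancel₀ (by positivity) q
  have ha := congrFun h 0
  have hb := congrFun h 1
  have gb (z : Fin 4 → ℝ) : cubicParam z 1 = z 3 * Real.sin (z 2) + z 0 * cubicParam z 0 := by
    simp only [cubicParam, Matrix.cons_val]
  rw [gb, gb, ha, e3, e0] at hb
  have e2 : x 2 = y 2 := by
    refine Real.injOn_sin ?_ ?_ (mul_left_cancel₀ y3.ne' (add_right_cancel hb))
    · exact ⟨by linarith [(abs_le.1 x2).1], (abs_le.1 x2).2⟩
    · exact ⟨by linarith [(abs_le.1 y2).1], (abs_le.1 y2).2⟩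
  ext i
  fin_cases i
  exacts [e0, e1, e2, e3]

lemma lintegral_fin_cons {n : ℕ} {F : (Fin (n + 1) → ℝ) → ENNReal} (hF : Measurable F) :
    ∫⁻ x, F x = ∫⁻ a, ∫⁻ y : Fin n → ℝ, F (Fin.cons a y) := by
  have h := (volume_preserving_piFinSuccAbove (fun _ : Fin (n + 1) => ℝ) 0).symm
  rw [← h.lintegral_comp hF, Measure.volume_eq_prod, lintegral_prod]
  · simp [MeasurableEquiv.piFinSuccAbove, Fin.insertNthEquiv]
  · exact (hF.comp (MeasurableEquiv.measurable _)).aemeasurable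

lemma lintegral_fin_four {F : (Fin 4 → ℝ) → ENNReal} (hF : Measurable F) :
    ∫⁻ x, F x = ∫⁻ a, ∫⁻ b, ∫⁻ c, ∫⁻ d, F ![a, b, c, d] := by
  have hm {n : ℕ} (a : ℝ) : Measurable (fun y : Fin n → ℝ => (Fin.cons a y : Fin (n + 1) → ℝ)) :=
    (measurable_pi_iff.2 fun i => by
      refine Fin.cases ?_ (fun j => ?_) i
      · simp only [Fin.cons_zero]; exact measurable_const
      · simp only [Fin.cons_succ]; exact measurable_pi_apply j)
  rw [lintegral_fin_cons hF]
  refine lintegral_congr fun a => ?_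
  refine (lintegral_fin_cons (hF.comp (hm a))).trans (lintegral_congr fun b => ?_)
  refine (lintegral_fin_cons ((hF.comp (hm a)).comp (hm b))).trans (lintegral_congr fun c => ?_)
  refine (lintegral_fin_cons (((hF.comp (hm a)).comp (hm b)).comp (hm c))).trans
    (lintegral_congr fun d => ?_)
  rw [lintegral_unique]
  simp only [Function.comp]
  have : (volume : Measure (Fin 0 → ℝ)) Set.univ = 1 := by rw [volume_pi, Measure.pi_univ]; simp
  rw [this, mul_one]
  rfl

end CubicParam

section CubicVolume

open MeasureTheory

lemma lintegral_Icc_ofReal {f : ℝ → ℝ} {a b : ℝ} (hab : a ≤ b) (hc : ContinuousOn f (Set.Icc a b))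
    (h0 : ∀ x ∈ Set.Icc a b, 0 ≤ f x) :
    ∫⁻ x in Set.Icc a b, ENNReal.ofReal (f x) = ENNReal.ofReal (∫ x in a..b, f x) := by
  rw [intervalIntegral.integral_of_le hab, ← integral_Icc_eq_integral_Ioc]
  rw [ofReal_integral_eq_lintegral_ofReal (hc.integrableOn_compact isCompact_Icc)]
  exact (ae_restrict_iff' measurableSet_Icc).2 (Filter.Eventually.of_forall h0)

/-- The parameters `(u, w, θ, s)` with nearly reduced Hessian, and `w`, `θ`, `s` in given ranges. -/
def cubicBox (r α β μ τ : ℝ) : Set (Fin 4 → ℝ) :=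
  {x | |x 0| ≤ r ^ 2 / 2 ∧ (α ≤ x 1 ∧ x 1 ≤ β) ∧ |x 2| ≤ τ ∧ μ ≤ x 3 ∧
    4 * x 3 ^ 4 * (1 / r ^ 2 - x 0 ^ 2) ≤ x 1 ^ 2}

lemma measurableSet_cubicBox (r α β μ τ : ℝ) : MeasurableSet (cubicBox r α β μ τ) := by
  have h0 : MeasurableSet {x : Fin 4 → ℝ | |x 0| ≤ r ^ 2 / 2} :=
    measurableSet_le (by fun_prop) (by fun_prop)
  have h1 : MeasurableSet {x : Fin 4 → ℝ | α ≤ x 1} := measurableSet_le (by fun_prop) (by fun_prop)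
  have h2 : MeasurableSet {x : Fin 4 → ℝ | x 1 ≤ β} := measurableSet_le (by fun_prop) (by fun_prop)
  have h3 : MeasurableSet {x : Fin 4 → ℝ | |x 2| ≤ τ} := measurableSet_le (by fun_prop) (by fun_prop)
  have h4 : MeasurableSet {x : Fin 4 → ℝ | μ ≤ x 3} := measurableSet_le (by fun_prop) (by fun_prop)
  have h5 : MeasurableSet {x : Fin 4 → ℝ | 4 * x 3 ^ 4 * (1 / r ^ 2 - x 0 ^ 2) ≤ x 1 ^ 2} :=
    measurableSet_le (by fun_prop) (by fun_prop)
  exact h0.inter ((h1.inter h2).inter (h3.inter (h4.inter h5)))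

variable {r α β μ τ : ℝ}

lemma mul_le_one_of_abs_le (hr0 : 0 < r) (hr : r ≤ 11 / 10) {u : ℝ} (hu : |u| ≤ r ^ 2 / 2) :
    |r * u| < 1 := by
  rw [abs_mul, abs_of_pos hr0]
  have h1 : r ^ 2 ≤ (11 / 10) ^ 2 := by gcongr
  nlinarith [abs_nonneg u]

lemma integral_inv_sqrt (hr0 : 0 < r) (hr : r ≤ 11 / 10) :
    ∫ u in (-(r ^ 2 / 2))..(r ^ 2 / 2), 1 / (2 * √(1 / r ^ 2 - u ^ 2)) = Real.arcsin (r ^ 3 / 2) := by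
  have hle : -(r ^ 2 / 2) ≤ r ^ 2 / 2 := by nlinarith [sq_nonneg r]
  have key : ∀ u ∈ Set.uIcc (-(r ^ 2 / 2)) (r ^ 2 / 2), |r * u| < 1 := by
    intro u hu
    rw [Set.uIcc_of_le hle, Set.mem_Icc] at hu
    exact mul_le_one_of_abs_le hr0 hr (abs_le.2 hu)
  have pos : ∀ u, |r * u| < 1 → 0 < 1 / r ^ 2 - u ^ 2 := by
    intro u hu
    have : (r * u) ^ 2 < 1 := (sq_lt_one_iff_abs_lt_one _).2 hu
    rw [sub_pos, lt_div_iff₀ (by positivity)]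
    linarith
  have h := intervalIntegral.integral_eq_sub_of_hasDerivAt (f := fun u => Real.arcsin (r * u) / 2)
    (f' := fun u => 1 / (2 * √(1 / r ^ 2 - u ^ 2))) (a := -(r ^ 2 / 2)) (b := r ^ 2 / 2) ?_ ?_
  · rw [h]
    have e : r * -(r ^ 2 / 2) = -(r ^ 3 / 2) := by ring
    have e' : r * (r ^ 2 / 2) = r ^ 3 / 2 := by ring
    rw [e, e', Real.arcsin_neg]
    ring
  · intro u hu
    have h1 := abs_lt.1 (key u hu)
    have h2 := (Real.hasDerivAt_arcsin (x := r * id u) (by rw [id]; linarith [h1.1])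
      (by rw [id]; linarith [h1.2])).comp u
      ((hasDerivAt_id u).const_mul r)
    refine (h2.div_const 2).congr_deriv ?_
    have h3 : 1 - (r * u) ^ 2 = r ^ 2 * (1 / r ^ 2 - u ^ 2) := by field_simp
    have h4 := Real.sqrt_pos.2 (pos u (key u hu))
    rw [id, h3, Real.sqrt_mul (by positivity), Real.sqrt_sq hr0.le]
    field_simp
  · refine ContinuousOn.intervalIntegrable fun u hu => ContinuousAt.continuousWithinAt ?_
    have := Real.sqrt_pos.2 (pos u (key u hu))
    refine ContinuousAt.div continuousAt_const (by fun_prop) (by positivity)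

lemma lintegral_cubicBox_zero (hr0 : 0 < r) (hr : r ≤ 11 / 10) (hα : 0 ≤ α) (hαβ : α ≤ β)
    (hτ : 0 ≤ τ) : ∫⁻ x in cubicBox r α β 0 τ, ENNReal.ofReal (2 * x 3) =
      ENNReal.ofReal (τ * (β ^ 2 - α ^ 2) * Real.arcsin (r ^ 3 / 2)) := by
  have hle : -(r ^ 2 / 2) ≤ r ^ 2 / 2 := by nlinarith [sq_nonneg r]
  set k : ℝ → ℝ := fun u => 1 / (2 * √(1 / r ^ 2 - u ^ 2)) with hk
  have pos : ∀ u, u ∈ Set.Icc (-(r ^ 2 / 2)) (r ^ 2 / 2) → 0 < 1 / r ^ 2 - u ^ 2 := by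
    intro u hu
    have : (r * u) ^ 2 < 1 :=
      (sq_lt_one_iff_abs_lt_one _).2 (mul_le_one_of_abs_le hr0 hr (abs_le.2 hu))
    rw [sub_pos, lt_div_iff₀ (by positivity)]
    linarith
  rw [← lintegral_indicator (measurableSet_cubicBox _ _ _ _ _),
    lintegral_fin_four (Measurable.indicator (by fun_prop) (measurableSet_cubicBox _ _ _ _ _))]
  have e : ∀ a b c d : ℝ, (cubicBox r α β 0 τ).indicator (fun x => ENNReal.ofReal (2 * x 3)) ![a, b, c, d] =
      (Set.Icc (-(r ^ 2 / 2)) (r ^ 2 / 2)).indicator (fun u => (Set.Icc α β).indicator (fun w =>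
        (Set.Icc (-τ) τ).indicator (fun _ => (Set.Icc 0 √(w * k u)).indicator
          (fun s => ENNReal.ofReal (2 * s)) d) c) b) a := by
    intro a b c d
    by_cases ha : a ∈ Set.Icc (-(r ^ 2 / 2)) (r ^ 2 / 2)
    · rw [Set.indicator_of_mem ha]
      by_cases hb : b ∈ Set.Icc α β
      · rw [Set.indicator_of_mem hb]
        by_cases hc : c ∈ Set.Icc (-τ) τ
        · rw [Set.indicator_of_mem hc]
          have hiff : ![a, b, c, d] ∈ cubicBox r α β 0 τ ↔ d ∈ Set.Icc 0 √(b * k a) := by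
            simp only [cubicBox, Set.mem_ofPred_eq, Matrix.cons_val, Set.mem_Icc]
            have h1 : |a| ≤ r ^ 2 / 2 := abs_le.2 ha
            have h2 : |c| ≤ τ := abs_le.2 hc
            have h3 : α ≤ b ∧ b ≤ β := hb
            have hb0 : 0 ≤ b := hα.trans h3.1
            simp only [h1, h2, h3, true_and, and_true]
            refine and_congr_right fun hd => ?_
            set v := 1 / r ^ 2 - a ^ 2 with hv
            have hv0 : 0 < v := pos a ha
            have hsv := Real.sqrt_pos.2 hv0
            rw [Real.le_sqrt hd (by positivity), hk]
            simp only
            rw [← hv, mul_one_div, le_div_iff₀ (by positivity)]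
            have e1 : 4 * d ^ 4 * v = (d ^ 2 * (2 * √v)) ^ 2 := by
              rw [mul_pow, mul_pow, Real.sq_sqrt hv0.le]; ring
            rw [e1, sq_le_sq₀ (by positivity) hb0]
          by_cases hd : d ∈ Set.Icc 0 √(b * k a)
          · rw [Set.indicator_of_mem hd, Set.indicator_of_mem (hiff.2 hd)]
            simp
          · rw [Set.indicator_of_notMem hd, Set.indicator_of_notMem (mt hiff.1 hd)]
        · rw [Set.indicator_of_notMem hc, Set.indicator_of_notMem]
          exact fun h => hc (abs_le.1 h.2.2.1)
      · rw [Set.indicator_of_notMem hb, Set.indicator_of_notMem]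
        exact fun h => hb h.2.1
    · rw [Set.indicator_of_notMem ha, Set.indicator_of_notMem]
      exact fun h => ha (abs_le.1 h.1)
  simp only [e]
  have hk0 : ∀ u, 0 ≤ k u := fun u => by positivity
  have hs : ∀ y : ℝ, 0 ≤ y → ∫⁻ d, (Set.Icc 0 √y).indicator (fun s => ENNReal.ofReal (2 * s)) d =
      ENNReal.ofReal y := by
    intro y hy
    rw [lintegral_indicator measurableSet_Icc, lintegral_Icc_ofReal (Real.sqrt_nonneg _)
      (by fun_prop) (fun x hx => by linarith [hx.1])]
    rw [intervalIntegral.integral_const_mul, integral_id, Real.sq_sqrt hy]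
    congr 1
    ring
  have e2 : ∀ a : ℝ, (∫⁻ b, ∫⁻ c, ∫⁻ d, (Set.Icc (-(r ^ 2 / 2)) (r ^ 2 / 2)).indicator (fun u =>
      (Set.Icc α β).indicator (fun w =>
        (Set.Icc (-τ) τ).indicator (fun _ => (Set.Icc 0 √(w * k u)).indicator
          (fun s => ENNReal.ofReal (2 * s)) d) c) b) a) =
      (Set.Icc (-(r ^ 2 / 2)) (r ^ 2 / 2)).indicator
        (fun u => ENNReal.ofReal (k u) * ENNReal.ofReal (τ * (β ^ 2 - α ^ 2))) a := by
    intro a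
    by_cases ha : a ∈ Set.Icc (-(r ^ 2 / 2)) (r ^ 2 / 2)
    · simp only [Set.indicator_of_mem ha]
      have e3 : ∀ b : ℝ, (∫⁻ c, ∫⁻ d, (Set.Icc α β).indicator (fun w =>
        (Set.Icc (-τ) τ).indicator (fun _ => (Set.Icc 0 √(w * k a)).indicator
          (fun s => ENNReal.ofReal (2 * s)) d) c) b) =
          (Set.Icc α β).indicator (fun w => ENNReal.ofReal (2 * τ * k a * w)) b := by
        intro b
        by_cases hb : b ∈ Set.Icc α β
        · simp only [Set.indicator_of_mem hb]
          have hb0 : 0 ≤ b := hα.trans hb.1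
          have e4 : ∀ c : ℝ, (∫⁻ d, (Set.Icc (-τ) τ).indicator (fun _ => (Set.Icc 0 √(b * k a)).indicator
            (fun s => ENNReal.ofReal (2 * s)) d) c) =
              (Set.Icc (-τ) τ).indicator (fun _ => ENNReal.ofReal (b * k a)) c := by
            intro c
            by_cases hc : c ∈ Set.Icc (-τ) τ
            · simp only [Set.indicator_of_mem hc]
              exact hs _ (mul_nonneg hb0 (hk0 a))
            · simp only [Set.indicator_of_notMem hc, lintegral_zero]
          simp only [e4]
          rw [lintegral_indicator measurableSet_Icc, setLIntegral_const, Real.volume_Icc,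
            ← ENNReal.ofReal_mul (mul_nonneg hb0 (hk0 a))]
          congr 1
          ring
        · simp only [Set.indicator_of_notMem hb, lintegral_zero]
      simp only [e3]
      rw [lintegral_indicator measurableSet_Icc, lintegral_Icc_ofReal hαβ (by fun_prop)
        (fun x hx => by have := hα.trans hx.1; have := hk0 a; positivity),
        intervalIntegral.integral_const_mul, integral_id, ← ENNReal.ofReal_mul (hk0 a)]
      congr 1
      ring
    · simp only [Set.indicator_of_notMem ha, lintegral_zero]
  simp only [e2]
  have hkc : ContinuousOn k (Set.Icc (-(r ^ 2 / 2)) (r ^ 2 / 2)) := by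
    intro u hu
    have := Real.sqrt_pos.2 (pos u hu)
    refine ContinuousAt.continuousWithinAt ?_
    exact ContinuousAt.div continuousAt_const (by fun_prop) (by positivity)
  have hnn : 0 ≤ τ * (β ^ 2 - α ^ 2) := mul_nonneg hτ (by nlinarith)
  rw [lintegral_indicator measurableSet_Icc, lintegral_mul_const' _ _ ENNReal.ofReal_ne_top,
    lintegral_Icc_ofReal hle hkc (fun u _ => hk0 u), integral_inv_sqrt hr0 hr, mul_comm,
    ← ENNReal.ofReal_mul hnn]

lemma lintegral_cubicBox_le (hr0 : 0 < r) (hr : r ≤ 11 / 10) (hα : 0 ≤ α) (hαβ : α ≤ β)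
    (hτ : 0 ≤ τ) (hμ : 0 ≤ μ) : ∫⁻ x in cubicBox r α β μ τ, ENNReal.ofReal (2 * x 3) ≤
      ENNReal.ofReal (τ * (β ^ 2 - α ^ 2) * Real.arcsin (r ^ 3 / 2)) := by
  rw [← lintegral_cubicBox_zero hr0 hr hα hαβ hτ]
  exact lintegral_mono_set fun x hx => ⟨hx.1, hx.2.1, hx.2.2.1, hμ.trans hx.2.2.2.1, hx.2.2.2.2⟩

lemma le_lintegral_cubicBox (hr0 : 0 < r) (hr : r ≤ 11 / 10) (hα : 0 ≤ α) (hαβ : α ≤ β)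
    (hτ : 0 ≤ τ) (hμ : 0 ≤ μ) :
      ENNReal.ofReal (τ * (β ^ 2 - α ^ 2) * Real.arcsin (r ^ 3 / 2)) ≤
      (∫⁻ x in cubicBox r α β μ τ, ENNReal.ofReal (2 * x 3)) +
        ENNReal.ofReal (4 * r ^ 2 * (β - α) * τ * μ ^ 2) := by
  rw [← lintegral_cubicBox_zero hr0 hr hα hαβ hτ]
  set A := Set.pi Set.univ fun i => Set.Icc ((![-(r ^ 2 / 2), α, -τ, 0] : Fin 4 → ℝ) i)
    ((![r ^ 2 / 2, β, τ, μ] : Fin 4 → ℝ) i) with hA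
  have hAm : MeasurableSet A := MeasurableSet.univ_pi fun i => measurableSet_Icc
  have hsub : cubicBox r α β 0 τ ⊆ cubicBox r α β μ τ ∪ A := by
    rintro x ⟨h0, h1, h2, h3, h4⟩
    rcases le_total μ (x 3) with h | h
    · exact Or.inl ⟨h0, h1, h2, h, h4⟩
    · refine Or.inr fun i _ => ?_
      fin_cases i
      exacts [abs_le.1 h0, h1, abs_le.1 h2, ⟨h3, h⟩]
  refine (lintegral_mono_set hsub).trans ((lintegral_union_le _ _ _).trans ?_)
  gcongr
  calc _ ≤ ∫⁻ x in A, ENNReal.ofReal (2 * μ) := by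
        refine setLIntegral_mono' hAm fun x hx => ENNReal.ofReal_le_ofReal ?_
        have := (hx 3 trivial).2
        simp only [Matrix.cons_val] at this
        linarith
    _ = ENNReal.ofReal (2 * μ) * volume A := setLIntegral_const _ _
    _ = _ := by
        rw [hA, Set.pi_univ_Icc, Real.volume_Icc_pi, Fin.prod_univ_four]
        simp only [Matrix.cons_val]
        have h1 : 0 ≤ β - α := by linarith
        rw [← ENNReal.ofReal_mul (by nlinarith [sq_nonneg r]), ← ENNReal.ofReal_mul
          (mul_nonneg (by nlinarith [sq_nonneg r]) h1), ← ENNReal.ofReal_mul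
          (mul_nonneg (mul_nonneg (by nlinarith [sq_nonneg r]) h1) (by linarith)),
          ← ENNReal.ofReal_mul (by linarith)]
        congr 1
        ring

end CubicVolume

section CubicImage

open MeasureTheory

variable {r α β μ τ : ℝ}

lemma volume_cubicParam_image (hα : 0 < α) (hμ : 0 < μ) (hτ : τ ≤ Real.pi / 2) :
    volume (cubicParam '' cubicBox r α β μ τ) =
      ∫⁻ x in cubicBox r α β μ τ, ENNReal.ofReal (2 * x 3) := by
  have pos : ∀ x ∈ cubicBox r α β μ τ, 0 < x 1 ∧ |x 2| ≤ Real.pi / 2 ∧ 0 < x 3 :=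
    fun x hx => ⟨hα.trans_le hx.2.1.1, hx.2.2.1.trans hτ, hμ.trans_le hx.2.2.2.1⟩
  rw [← lintegral_abs_det_fderiv_eq_addHaar_image volume (measurableSet_cubicBox r α β μ τ)
    (fun x hx => (hasFDerivAt_cubicParam (pos x hx).1.ne' (pos x hx).2.2.ne').hasFDerivWithinAt)
    (cubicParam_injOn.mono pos)]
  refine setLIntegral_congr_fun (measurableSet_cubicBox r α β μ τ) fun x hx => ?_
  rw [← abs_det_cubicParamJac (pos x hx).1.ne' (pos x hx).2.2, ContinuousLinearMap.det,
    LinearMap.coe_toContinuousLinearMap, LinearMap.det_toLin']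

lemma abs_arcsin_sub_le (hr : |r - 1| ≤ 1 / 10) :
    |Real.arcsin (r ^ 3 / 2) - Real.pi / 6| ≤ 4 * |r - 1| := by
  have h6 : Real.arcsin (1 / 2) = Real.pi / 6 := by
    rw [← Real.sin_pi_div_six, Real.arcsin_sin] <;> linarith [Real.pi_pos]
  have hr' := abs_le.1 hr
  have key := Convex.norm_image_sub_le_of_norm_hasDerivWithin_le (f := Real.arcsin)
    (f' := fun x => 1 / √(1 - x ^ 2)) (s := Set.Icc (0 : ℝ) (7 / 10)) (C := 2)
    (x := 1 / 2) (y := r ^ 3 / 2) ?_ ?_ (convex_Icc _ _) ⟨by norm_num, by norm_num⟩ ?_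
  · rw [h6, Real.norm_eq_abs, Real.norm_eq_abs] at key
    refine key.trans ?_
    have : r ^ 3 / 2 - 1 / 2 = (r - 1) * ((r ^ 2 + r + 1) / 2) := by ring
    rw [this, abs_mul]
    have : |(r ^ 2 + r + 1) / 2| ≤ 2 := by
      rw [abs_le]; constructor <;> nlinarith
    nlinarith [abs_nonneg (r - 1)]
  · intro x hx
    exact (Real.hasDerivAt_arcsin (by linarith [hx.1]) (by linarith [hx.2])).hasDerivWithinAt
  · intro x hx
    have : (1 / 2 : ℝ) ≤ √(1 - x ^ 2) := Real.le_sqrt_of_sq_le (by nlinarith [hx.1, hx.2])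
    rw [Real.norm_eq_abs, abs_of_nonneg (by positivity), div_le_iff₀ (by linarith)]
    linarith
  · have h0 : 0 ≤ r := by linarith
    have h1 : r ^ 3 ≤ (11 / 10) ^ 3 := pow_le_pow_left₀ h0 (by linarith) 3
    exact ⟨by positivity, by linarith⟩

/-- Forms whose Hessian is reduced up to a factor `t`, with discriminant in `[lo, hi]`, and whose
Hessian has leading coefficient at least `m`. -/
def cubicReg (t lo hi m : ℝ) : Set (Fin 4 → ℝ) :=
  {f | |hQ f| ≤ t * hP f ∧ hP f ≤ t * hR f ∧ lo ≤ dsc f ∧ dsc f ≤ hi ∧ m ≤ hP f}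

lemma mem_image_cubicBox {t lo hi m : ℝ} (ht : 0 < t) (hlo : 0 < lo) (hm : 0 < m)
    {f : Fin 4 → ℝ} (h0 : 0 < f 0) (hf : f ∈ cubicReg t lo hi m) :
    f ∈ cubicParam '' cubicBox (√t) (√lo) (√hi) (√m) (Real.pi / 2) := by
  obtain ⟨h1, h2, h3, h4, h5⟩ := hf
  have hp : 0 < hP f := hm.trans_le h5
  have hd : 0 < dsc f := hlo.trans_le h3
  have hs : 0 < √(hP f) := Real.sqrt_pos.2 hp
  refine ⟨_, ?_, exists_cubicParam_eq h0 hp hd⟩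
  refine ⟨?_, ⟨?_, ?_⟩, ?_, ?_, ?_⟩
  · simp only [Matrix.cons_val]
    rw [Real.sq_sqrt ht.le, abs_div, abs_of_pos (show 0 < 2 * hP f by linarith),
      div_le_div_iff₀ (by linarith) (by norm_num)]
    linarith
  · exact Real.sqrt_le_sqrt h3
  · exact Real.sqrt_le_sqrt h4
  · simp only [Matrix.cons_val]
    exact abs_le.2 ⟨Real.neg_pi_div_two_le_arcsin _, Real.arcsin_le_pi_div_two _⟩
  · exact Real.sqrt_le_sqrt h5
  · simp only [Matrix.cons_val]
    rw [Real.sq_sqrt ht.le, Real.sq_sqrt hd.le,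
      show √(hP f) ^ 4 = (√(hP f) ^ 2) ^ 2 by ring, Real.sq_sqrt hp.le]
    have e : 4 * hP f ^ 2 * (1 / t - (hQ f / (2 * hP f)) ^ 2) = 4 * hP f * (hP f / t) - hQ f ^ 2 := by
      field_simp
      ring
    have : hP f / t ≤ hR f := by rw [div_le_iff₀ ht]; linarith
    rw [e, dsc]
    nlinarith

lemma mem_cubicReg_of_mem_cubicBox {t lo hi m : ℝ} (ht : 0 < t) (hlo : 0 < lo) (hm : 0 < m)
    (hhi : 0 ≤ hi) {x : Fin 4 → ℝ} (hx : x ∈ cubicBox (√t) (√lo) (√hi) (√m) τ) :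
    cubicParam x ∈ cubicReg t lo hi m := by
  obtain ⟨h1, ⟨h2, h3⟩, -, h5, h6⟩ := hx
  have x1 : 0 < x 1 := (Real.sqrt_pos.2 hlo).trans_le h2
  have x3 : 0 < x 3 := (Real.sqrt_pos.2 hm).trans_le h5
  rw [Real.sq_sqrt ht.le] at h1 h6
  simp only [cubicReg, Set.mem_ofPred_eq, hP_cubicParam x1.ne' x3.ne', hQ_cubicParam x1.ne' x3.ne',
    hR_cubicParam x1.ne' x3.ne', dsc_cubicParam x1.ne' x3.ne']
  refine ⟨?_, ?_, (Real.sqrt_le_left x1.le).1 h2, ?_, (Real.sqrt_le_left x3.le).1 h5⟩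
  · rw [abs_mul, abs_of_pos (by positivity)]
    nlinarith [sq_nonneg (x 3)]
  · have : 4 * x 3 ^ 4 / t ≤ 4 * x 3 ^ 4 * x 0 ^ 2 + x 1 ^ 2 := by
      have e : 4 * x 3 ^ 4 * (1 / t - x 0 ^ 2) = 4 * x 3 ^ 4 / t - 4 * x 3 ^ 4 * x 0 ^ 2 := by ring
      linarith
    rw [div_le_iff₀ ht] at this
    have e : t * (x 3 ^ 2 * x 0 ^ 2 + x 1 ^ 2 / (4 * x 3 ^ 2)) =
      (4 * x 3 ^ 4 * x 0 ^ 2 + x 1 ^ 2) * t / (4 * x 3 ^ 2) := by field_simp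
    rw [e, le_div_iff₀ (by positivity)]
    linarith
  · exact (Real.le_sqrt x1.le hhi).1 h3

end CubicImage

section Perturbation

variable {f e : Fin 4 → ℝ} {t lo hi m l n p : ℝ}

lemma cubicReg_hess_bounds (ht0 : 0 < t) (ht : t ≤ 11 / 10) (hl : 0 < l) (hlo : l ^ 4 ≤ lo)
    (hhi : hi ≤ 5 * l ^ 4) (hm : 0 < m) (hf : f ∈ cubicReg t lo hi m) (hp : 0 < p)
    (hpp : p ^ 2 = hP f) :
    p ≤ 5 / 4 * l ∧ |hQ f| ≤ 11 / 10 * p ^ 2 ∧ l ^ 4 ≤ 4 * p ^ 2 * hR f ∧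
      p ^ 2 * hR f ≤ 2 * l ^ 4 ∧ p ^ 2 ≤ 11 / 10 * hR f := by
  obtain ⟨h1, h2, h3, h4, h5⟩ := hf
  rw [← hpp] at h1 h2
  have hp2 : 0 < p ^ 2 := by positivity
  have hR0 : 0 < hR f := by
    by_contra hc
    nlinarith
  have hQ1 : |hQ f| ≤ 11 / 10 * p ^ 2 := h1.trans (by nlinarith)
  have hR1 : p ^ 2 ≤ 11 / 10 * hR f := h2.trans (by nlinarith)
  have hQ2 : hQ f ^ 2 ≤ (11 / 10 * p ^ 2) ^ 2 := sq_le_sq' (by linarith [(abs_le.1 hQ1).1]) (abs_le.1 hQ1).2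
  have hd : dsc f = 4 * (p ^ 2 * hR f) - hQ f ^ 2 := by rw [dsc, hpp]; ring
  have hpr : p ^ 2 * p ^ 2 ≤ p ^ 2 * (11 / 10 * hR f) := mul_le_mul_of_nonneg_left hR1 hp2.le
  have hPR : p ^ 2 * hR f ≤ 2 * l ^ 4 := by nlinarith
  refine ⟨?_, hQ1, by nlinarith [sq_nonneg (hQ f)], hPR, hR1⟩
  refine le_of_pow_le_pow_left₀ (n := 4) (by norm_num) (by positivity) ?_
  have : 0 < l ^ 4 := by positivity
  nlinarith

lemma cubicReg_coeff_bounds (ht0 : 0 < t) (ht : t ≤ 11 / 10) (hl : 0 < l) (hlo : l ^ 4 ≤ lo)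
    (hhi : hi ≤ 5 * l ^ 4) (hm : 0 < m) (hf : f ∈ cubicReg t lo hi m) (hp : 0 < p)
    (hpp : p ^ 2 = hP f) :
    |f 0| * p ≤ 10 * l ^ 2 ∧ |f 1| * p ≤ 10 * l ^ 2 ∧ |f 2| * p ≤ 10 * l ^ 2 ∧
      |f 3| * p ^ 3 ≤ 24 * l ^ 4 := by
  obtain ⟨b1, b2, b3, b4, b5⟩ := cubicReg_hess_bounds ht0 ht hl hlo hhi hm hf hp hpp
  have hp2 : 0 < p ^ 2 := by positivity
  have hR0 : 0 < hR f := by nlinarith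
  have hdl : l ^ 4 ≤ dsc f := hlo.trans hf.2.2.1
  have hl4 : 0 < l ^ 4 := by positivity
  have hG4 := four_hP_cube f
  rw [← hpp] at hG4
  have ha : |f 0| * l ^ 2 ≤ 2 * p ^ 3 := by
    refine le_of_pow_le_pow_left₀ (n := 2) (by norm_num) (by positivity) ?_
    rw [mul_pow, sq_abs]
    nlinarith [sq_nonneg (hG f), mul_le_mul_of_nonneg_left hdl (sq_nonneg (f 0))]
  have hGb : |hG f| ≤ 2 * p ^ 3 := by
    refine abs_le_of_sq_le_sq ?_ (by positivity)
    nlinarith [mul_nonneg (sq_nonneg (f 0)) (hl4.le.trans hdl)]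
  have hpl2 : p ^ 2 ≤ 25 / 16 * l ^ 2 := by nlinarith
  have ha2 : |f 0| ≤ 25 / 8 * p := by
    have : p ^ 3 ≤ 25 / 16 * l ^ 2 * p := by nlinarith
    have hl2 : 0 < l ^ 2 := by positivity
    by_contra! hc
    nlinarith
  have hb : |f 1| ≤ 3 * p := by
    have e := hG_eq f
    rw [← hpp] at e
    have e1 : |2 * f 1 * p ^ 2| ≤ |f 0| * |hQ f| + |hG f| := by
      rw [show 2 * f 1 * p ^ 2 = f 0 * hQ f + hG f by linarith, ← abs_mul]
      exact abs_add_le _ _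
    rw [abs_mul, abs_mul, abs_two, abs_of_pos hp2] at e1
    have e2 : |f 0| * |hQ f| ≤ 25 / 8 * p * (11 / 10 * p ^ 2) :=
      mul_le_mul ha2 b2 (abs_nonneg _) (by positivity)
    by_contra! hc
    nlinarith
  have hc : |f 2| * p ≤ 10 * l ^ 2 := by
    have e := hess_rel_c f
    rw [← hpp] at e
    have e1 : p ^ 2 * |f 2| ≤ |hQ f| * |f 1| + hR f * |f 0| := by
      rw [← abs_of_pos hp2, ← abs_mul, e, ← abs_mul]
      refine (abs_sub _ _).trans ?_
      rw [abs_mul (hR f), abs_of_pos hR0]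
    have e2 : |hQ f| * |f 1| ≤ 11 / 10 * p ^ 2 * (3 * p) :=
      mul_le_mul b2 hb (abs_nonneg _) (by positivity)
    have e3 : hR f * |f 0| * l ^ 2 ≤ 4 * l ^ 4 * p := by
      nlinarith [mul_le_mul_of_nonneg_left ha hR0.le, mul_le_mul_of_nonneg_right b4 hp.le]
    have e3' : hR f * |f 0| ≤ 4 * l ^ 2 * p := by
      have hl2 : 0 < l ^ 2 := by positivity
      by_contra! hc
      nlinarith
    have e4 : p * (|f 2| * p) ≤ p * (10 * l ^ 2) := by nlinarith
    exact le_of_mul_le_mul_left e4 hp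
  refine ⟨?_, ?_, hc, ?_⟩
  · have := mul_le_mul_of_nonneg_right ha2 hp.le
    linarith
  · have := mul_le_mul_of_nonneg_right hb hp.le
    linarith
  · have e := hess_rel_d f
    rw [← hpp] at e
    have e1 : p ^ 2 * |f 3| ≤ |hQ f| * |f 2| + hR f * |f 1| := by
      rw [← abs_of_pos hp2, ← abs_mul, e, ← abs_mul]
      refine (abs_sub _ _).trans ?_
      rw [abs_mul (hR f), abs_of_pos hR0]
    have e2 : |hQ f| * |f 2| ≤ 11 / 10 * p ^ 2 * |f 2| :=
      mul_le_mul_of_nonneg_right b2 (abs_nonneg _)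
    have e3 : hR f * |f 1| ≤ hR f * (3 * p) := mul_le_mul_of_nonneg_left hb hR0.le
    have e4 : p ^ 2 * |f 3| * p ≤ 11 / 10 * p ^ 2 * (10 * l ^ 2) + 3 * (2 * l ^ 4) := by
      have e5 : p ^ 2 * |f 3| * p ≤ (11 / 10 * p ^ 2 * |f 2| + hR f * (3 * p)) * p :=
        mul_le_mul_of_nonneg_right (e1.trans (add_le_add e2 e3)) hp.le
      have e6 := mul_le_mul_of_nonneg_left hc hp2.le
      linarith
    have e5 : p ^ 2 * l ^ 2 ≤ 25 / 16 * l ^ 4 := by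
      have := mul_le_mul_of_nonneg_right hpl2 (sq_nonneg l)
      linarith
    have e6 : p ^ 2 * |f 3| * p = |f 3| * p ^ 3 := by ring
    linarith

lemma abs_mul_sub_mul_perturb {x y z w x' y' z' w' B n : ℝ} (hx : |x| ≤ B) (hy : |y| ≤ B)
    (hz : |z| ≤ B) (hw : |w| ≤ B) (hx' : |x'| ≤ n) (hy' : |y'| ≤ n) (hz' : |z'| ≤ n)
    (hw' : |w'| ≤ n) (hn : n ≤ B) :
    |(x + x') * (y + y') - (z + z') * (w + w') - (x * y - z * w)| ≤ 6 * (B * n) := by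
  have hB : 0 ≤ B := (abs_nonneg _).trans hx
  have key {s t : ℝ} (hs : |s| ≤ B) (ht : |t| ≤ n) : |s * t| ≤ B * n := by
    rw [abs_mul]; exact mul_le_mul hs ht (abs_nonneg _) hB
  have h1 := abs_le.1 (key hx hy')
  have h2 := abs_le.1 (key hy hx')
  have h3 := abs_le.1 (key (hx'.trans hn) hy')
  have h4 := abs_le.1 (key hz hw')
  have h5 := abs_le.1 (key hw hz')
  have h6 := abs_le.1 (key (hz'.trans hn) hw')
  rw [abs_le]
  constructor <;> nlinarith

/-- Moving a form by at most `n` in each coordinate changes the Hessian and the discriminant only by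
a small relative amount. -/
lemma cubicReg_perturb {δ : ℝ} (ht0 : 0 < t) (ht : t ≤ 11 / 10) (hl : 0 < l) (hlo : l ^ 4 ≤ lo)
    (hhi : hi ≤ 5 * l ^ 4) (hm : 0 < m) (hf : f ∈ cubicReg t lo hi m) (hp : 0 < p)
    (hpp : p ^ 2 = hP f) (hn : 0 ≤ n) (hδ : 1000 * n * l ^ 4 ≤ δ * p ^ 5) (hδ1 : δ ≤ 1 / 100)
    (he : ∀ i, |e i| ≤ n) :
    |hP (f + e) - hP f| ≤ δ * hP f ∧ |hQ (f + e) - hQ f| ≤ δ * hP f ∧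
      |hR (f + e) - hR f| ≤ δ * hR f ∧ |dsc (f + e) - dsc f| ≤ 22 * δ * l ^ 4 := by
  obtain ⟨b1, b2, b3, b4, b5⟩ := cubicReg_hess_bounds ht0 ht hl hlo hhi hm hf hp hpp
  obtain ⟨c0, c1, c2, c3⟩ := cubicReg_coeff_bounds ht0 ht hl hlo hhi hm hf hp hpp
  have hl4 : 0 < l ^ 4 := by positivity
  have hδ0 : 0 ≤ δ := by
    have h : 0 ≤ δ * p ^ 5 := le_trans (by positivity) hδ
    exact nonneg_of_mul_nonneg_left h (by positivity)
  have hp2 : 0 < p ^ 2 := by positivity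
  have hp3 : 0 < p ^ 3 := by positivity
  have hp4 : p ^ 4 ≤ 22 / 10 * l ^ 4 := by
    have := mul_le_mul_of_nonneg_left b5 hp2.le
    linarith
  have hpl : p ^ 2 ≤ 25 / 16 * l ^ 2 := by
    have := pow_le_pow_left₀ hp.le b1 2
    linarith
  have hpl4 : l ^ 2 * p ^ 2 ≤ 25 / 16 * l ^ 4 := by
    have := mul_le_mul_of_nonneg_left hpl (sq_nonneg l)
    linarith
  obtain ⟨B, hB⟩ : ∃ B, B * p ^ 3 = 24 * l ^ 4 := ⟨24 * l ^ 4 / p ^ 3, by field_simp⟩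
  have bd {x : ℝ} (hx : |x| * p ≤ 10 * l ^ 2) : |x| ≤ B := by
    refine le_of_mul_le_mul_right ?_ hp3
    have := mul_le_mul_of_nonneg_right hx hp2.le
    linarith
  have a0 := bd c0
  have a1 := bd c1
  have a2 := bd c2
  have a3 : |f 3| ≤ B := le_of_mul_le_mul_right (by linarith) hp3
  have hBn : 6 * (B * n) ≤ δ * (p ^ 2 / 5) := by
    refine le_of_mul_le_mul_right ?_ hp3
    have : 6 * (B * n) * p ^ 3 = 6 * n * (B * p ^ 3) := by ring
    rw [this, hB]
    have := mul_nonneg hn hl4.le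
    linarith
  have hnB : n ≤ B := by
    refine le_of_mul_le_mul_right ?_ hp3
    have e1 : 1000 * n * l ^ 4 ≤ 1 / 100 * p ^ 5 := hδ.trans (by gcongr)
    have e2 : 1000 * (n * p ^ 3) * l ^ 4 ≤ 1 / 100 * (p ^ 4 * p ^ 4) := by
      have := mul_le_mul_of_nonneg_right e1 hp3.le
      linarith
    have e3 : p ^ 4 * p ^ 4 ≤ (22 / 10 * l ^ 4) * (22 / 10 * l ^ 4) := by gcongr
    rw [hB]
    refine le_of_mul_le_mul_right ?_ hl4
    have := mul_pos hl4 hl4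
    linarith
  have dP := abs_mul_sub_mul_perturb a1 a1 a0 a2 (he 1) (he 1) (he 0) (he 2) hnB
  have dQ := abs_mul_sub_mul_perturb a1 a2 a0 a3 (he 1) (he 2) (he 0) (he 3) hnB
  have dR := abs_mul_sub_mul_perturb a2 a2 a1 a3 (he 2) (he 2) (he 1) (he 3) hnB
  have eP : |hP (f + e) - hP f| ≤ 6 * (B * n) := by
    convert dP using 2; simp only [hP, Pi.add_apply]; ring
  have eQ : |hQ (f + e) - hQ f| ≤ 6 * (B * n) := by
    convert dQ using 2; simp only [hQ, Pi.add_apply]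
  have eR : |hR (f + e) - hR f| ≤ 6 * (B * n) := by
    convert dR using 2; simp only [hR, Pi.add_apply]; ring
  have hR0 : 0 < hR f := by linarith
  have hBn' : δ * (p ^ 2 / 5) ≤ δ * hR f := mul_le_mul_of_nonneg_left (by linarith) hδ0
  have hBn2 : δ * (p ^ 2 / 5) ≤ δ * p ^ 2 := mul_le_mul_of_nonneg_left (by linarith) hδ0
  have fP := eP.trans (hBn.trans hBn2)
  have fQ := eQ.trans (hBn.trans hBn2)
  have fR := eR.trans (hBn.trans hBn')
  refine ⟨hpp ▸ fP, hpp ▸ fQ, fR, ?_⟩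
  have ed : dsc (f + e) - dsc f = 4 * (hP (f + e) - hP f) * hR f + 4 * p ^ 2 * (hR (f + e) - hR f) +
      4 * (hP (f + e) - hP f) * (hR (f + e) - hR f) - 2 * hQ f * (hQ (f + e) - hQ f) -
      (hQ (f + e) - hQ f) ^ 2 := by
    rw [dsc, dsc, hpp]; ring
  rw [ed]
  generalize hP (f + e) - hP f = u at fP
  generalize hQ (f + e) - hQ f = v at fQ
  generalize hR (f + e) - hR f = w at fR
  have g1 : |u * hR f| ≤ δ * (p ^ 2 * hR f) := by
    rw [abs_mul, abs_of_pos hR0, ← mul_assoc]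
    exact mul_le_mul_of_nonneg_right fP hR0.le
  have g2 : |p ^ 2 * w| ≤ δ * (p ^ 2 * hR f) := by
    rw [abs_mul, abs_of_pos hp2, mul_left_comm]
    exact mul_le_mul_of_nonneg_left fR hp2.le
  have g3 : |u * w| ≤ δ * (p ^ 2 * hR f) / 100 := by
    rw [abs_mul]
    have h1 : |u| * |w| ≤ δ * p ^ 2 * (δ * hR f) :=
      mul_le_mul fP fR (abs_nonneg _) (by positivity)
    have h2 : δ * (δ * (p ^ 2 * hR f)) ≤ 1 / 100 * (δ * (p ^ 2 * hR f)) :=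
      mul_le_mul_of_nonneg_right hδ1 (by positivity)
    linarith
  have g4 : |hQ f * v| ≤ 11 / 10 * (δ * p ^ 4) := by
    rw [abs_mul]
    have h1 : |hQ f| * |v| ≤ 11 / 10 * p ^ 2 * (δ * p ^ 2) :=
      mul_le_mul b2 fQ (abs_nonneg _) (by positivity)
    linarith
  have g5 : |v ^ 2| ≤ δ * p ^ 4 / 100 := by
    rw [abs_pow]
    have h1 : |v| ^ 2 ≤ (δ * p ^ 2) ^ 2 := pow_le_pow_left₀ (abs_nonneg _) fQ 2
    have h2 : δ * (δ * p ^ 4) ≤ 1 / 100 * (δ * p ^ 4) :=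
      mul_le_mul_of_nonneg_right hδ1 (by positivity)
    linarith
  have k1 := mul_le_mul_of_nonneg_left b4 hδ0
  have k2 := mul_le_mul_of_nonneg_left hp4 hδ0
  have m1 := abs_le.1 g1
  have m2 := abs_le.1 g2
  have m3 := abs_le.1 g3
  have m4 := abs_le.1 g4
  have m5 := abs_le.1 g5
  rw [abs_le]
  have := mul_nonneg hδ0 hl4.le
  constructor <;> linarith

end Perturbation

section TileCount

open MeasureTheory

lemma cubicReg_add_mem {f e : Fin 4 → ℝ} {t lo hi m l n y δ : ℝ} (ht0 : 0 < t) (ht : t ≤ 11 / 10)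
    (hl : 0 < l) (hlo : l ^ 4 ≤ lo) (hhi : hi ≤ 5 * l ^ 4) (hy : 0 < y) (hm : l ^ 2 / y ^ 2 ≤ m)
    (hf : f ∈ cubicReg t lo hi m) (hn : 0 ≤ n) (hδ : 1000 * n * y ^ 5 ≤ δ * l)
    (hδ1 : δ ≤ 1 / 100) (he : ∀ i, |e i| ≤ n) :
    f + e ∈ cubicReg (t + 4 * δ) (lo - 22 * δ * l ^ 4) (hi + 22 * δ * l ^ 4) (m / 2) := by
  have hm0 : 0 < m := lt_of_lt_of_le (by positivity) hm
  have hP0 : 0 < hP f := hm0.trans_le hf.2.2.2.2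
  have hδ0 : 0 ≤ δ := nonneg_of_mul_nonneg_left (le_trans (by positivity) hδ) hl
  have hp : 0 < √(hP f) := Real.sqrt_pos.2 hP0
  have hly : l / y ≤ √(hP f) := by
    refine Real.le_sqrt_of_sq_le ?_
    rw [div_pow]
    exact hm.trans hf.2.2.2.2
  have hδp : 1000 * n * l ^ 4 ≤ δ * √(hP f) ^ 5 := by
    have h5 : (l / y) ^ 5 ≤ √(hP f) ^ 5 := pow_le_pow_left₀ (by positivity) hly 5
    refine le_trans ?_ (mul_le_mul_of_nonneg_left h5 hδ0)
    rw [div_pow, ← mul_div_assoc, le_div_iff₀ (by positivity)]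
    have := mul_le_mul_of_nonneg_right hδ (show 0 ≤ l ^ 4 by positivity)
    linarith
  obtain ⟨dP, dQ, dR, dD⟩ := cubicReg_perturb ht0 ht hl hlo hhi hm0 hf hp (Real.sq_sqrt hP0.le) hn
    hδp hδ1 he
  obtain ⟨h1, h2, h3, h4, h5⟩ := hf
  have hR0 : 0 < hR f := by
    by_contra hc
    nlinarith
  rw [abs_le] at dP dQ dR dD h1
  have hP1 : 0 ≤ δ * hP f := by positivity
  have hR1 : 0 ≤ δ * hR f := by positivity
  refine ⟨?_, ?_, by linarith, by linarith, by nlinarith⟩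
  · have e1 : (t + δ) * hP f ≤ (t + 4 * δ) * hP (f + e) := by
      have : (t + 4 * δ) * ((1 - δ) * hP f) ≤ (t + 4 * δ) * hP (f + e) :=
        mul_le_mul_of_nonneg_left (by linarith) (by positivity)
      nlinarith
    rw [abs_le]
    constructor <;> linarith
  · have e1 : (t + 4 * δ) * ((1 - δ) * hR f) ≤ (t + 4 * δ) * hR (f + e) :=
        mul_le_mul_of_nonneg_left (by linarith) (by positivity)
    have e2 : hP (f + e) ≤ (1 + δ) * (t * hR f) := by nlinarith
    nlinarith

lemma finite_redCubic (X : ℝ) :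
    {f : Fin 4 → ℤ | RedCubic f ∧ 0 < f 0 ∧ ((dsc f : ℤ) : ℝ) < 4 * X}.Finite := by
  refine ((contentPairs_finite X (4 * X) (1 / 2)).preimage
    (f := fun f : Fin 4 → ℤ => (f, 1)) fun f _ g _ h => (Prod.mk.inj h).1).subset ?_
  rintro f ⟨h1, h2, h3⟩
  refine ⟨h1, h2, h3, ?_, squarefree_one, by norm_num, by simp, by simp⟩
  refine le_trans ?_ h3.le
  have := h1.three_sq_le_dsc
  have h0 := h1.1
  have : hP f ≤ dsc f := by nlinarith
  exact_mod_cast this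

/-- The half-open cube of side `N` with lowest corner `f`. -/
def cubicTile (N : ℕ) (f : Fin 4 → ℤ) : Set (Fin 4 → ℝ) :=
  Set.pi Set.univ fun i => Set.Ico (f i : ℝ) (f i + N)

lemma volume_biUnion_cubicTile {N : ℕ} {v : Fin 4 → ZMod N} (F : Finset (Fin 4 → ℤ))
    (hF : ∀ f ∈ F, (fun i => (f i : ZMod N)) = v) :
    volume (⋃ f ∈ F, cubicTile N f) = ENNReal.ofReal (F.card * (N : ℝ) ^ 4) := by
  rw [measure_biUnion_finset]
  · have : ∀ f ∈ F, volume (cubicTile N f) = ENNReal.ofReal ((N : ℝ) ^ 4) := by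
      intro f _
      rw [cubicTile, Real.volume_pi_Ico]
      simp [ENNReal.ofReal_pow]
    rw [Finset.sum_congr rfl this, Finset.sum_const, nsmul_eq_mul, ENNReal.ofReal_mul (by positivity)]
    simp
  · intro f hf g hg hfg
    refine Set.disjoint_left.2 fun x hx hy => hfg ?_
    funext i
    have h1 := hx i (Set.mem_univ i)
    have h2 := hy i (Set.mem_univ i)
    have h3 : ((f i : ℤ) : ZMod N) = (g i : ZMod N) :=
      (congrFun (hF f hf) i).trans (congrFun (hF g hg) i).symm
    rw [ZMod.intCast_eq_intCast_iff_dvd_sub] at h3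
    have h4 : (g i : ℝ) < f i + N := h2.1.trans_lt h1.2
    have h5 : (f i : ℝ) < g i + N := h1.1.trans_lt h2.2
    have h4' : g i < f i + N := by exact_mod_cast h4
    have h5' : f i < g i + N := by exact_mod_cast h5
    have := Int.eq_zero_of_abs_lt_dvd h3 (by rw [abs_lt]; constructor <;> linarith)
    linarith
  · exact fun f _ => MeasurableSet.univ_pi fun i => measurableSet_Ico

lemma exists_mem_cubicTile {N : ℕ} (hN : 0 < N) (v : Fin 4 → ZMod N) (x : Fin 4 → ℝ) :
    ∃ f : Fin 4 → ℤ, (fun i => (f i : ZMod N)) = v ∧ x ∈ cubicTile N f := by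
  have : NeZero N := ⟨hN.ne'⟩
  have hN' : (0 : ℝ) < N := by exact_mod_cast hN
  refine ⟨fun i => (v i).val + N * ⌊(x i - (v i).val) / N⌋, ?_, fun i _ => ?_⟩
  · funext i
    simp
  · have h1 := Int.floor_le ((x i - (v i).val) / N)
    have h2 := Int.lt_floor_add_one ((x i - (v i).val) / N)
    rw [le_div_iff₀ hN'] at h1
    rw [div_lt_iff₀ hN'] at h2
    push_cast
    constructor <;> linarith

end TileCount

section CountClass

open MeasureTheory

/-- Reduced forms in a given class, away from the cusp. -/
def mainForms (N : ℕ) (v : Fin 4 → ZMod N) (l y : ℝ) : Set (Fin 4 → ℤ) :=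
  {f | RedCubic f ∧ 0 < f 0 ∧ 2 * l ^ 4 ≤ ((dsc f : ℤ) : ℝ) ∧ ((dsc f : ℤ) : ℝ) < 4 * l ^ 4 ∧
    l ^ 2 / y ^ 2 ≤ ((hP f : ℤ) : ℝ) ∧ (fun i => (f i : ZMod N)) = v}

lemma mainForms_finite (N : ℕ) (v : Fin 4 → ZMod N) (l y : ℝ) : (mainForms N v l y).Finite :=
  (finite_redCubic (l ^ 4)).subset fun _ h => ⟨h.1, h.2.1, h.2.2.2.1⟩

lemma intCast_forms (f : Fin 4 → ℤ) :
    hP (fun i => (f i : ℝ)) = ((hP f : ℤ) : ℝ) ∧ hQ (fun i => (f i : ℝ)) = ((hQ f : ℤ) : ℝ) ∧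
    hR (fun i => (f i : ℝ)) = ((hR f : ℤ) : ℝ) ∧ dsc (fun i => (f i : ℝ)) = ((dsc f : ℤ) : ℝ) := by
  simp [hP, hQ, hR, dsc]

lemma abs_sqrt_sub_one_le {t : ℝ} (ht : 0 ≤ t) : |√t - 1| ≤ |t - 1| := by
  have h : (√t - 1) * (√t + 1) = t - 1 := by linarith [Real.sq_sqrt ht, sq (√t)]
  rw [← h, abs_mul, abs_of_pos (show 0 < √t + 1 by positivity)]
  nlinarith [abs_nonneg (√t - 1), Real.sqrt_nonneg t]

variable {N : ℕ} {v : Fin 4 → ZMod N} {l y δ : ℝ}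

lemma ncard_mainForms_le (hN : 0 < N) (hl : 0 < l) (hy : 0 < y)
    (hδ : 1000 * N * y ^ 5 ≤ δ * l) (hδ1 : δ ≤ 1 / 1000) :
    ((mainForms N v l y).ncard : ℝ) * (N : ℝ) ^ 4 ≤
      Real.pi ^ 2 / 6 * l ^ 4 + 1000 * (δ * l ^ 4) := by
  have hN' : (0 : ℝ) < N := by exact_mod_cast hN
  have hδ0 : 0 < δ := pos_of_mul_pos_left (lt_of_lt_of_le (by positivity) hδ) hl.le
  have hl4 : 0 < l ^ 4 := by positivity
  have hfin := mainForms_finite N v l y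
  have hvol := volume_biUnion_cubicTile (v := v) hfin.toFinset
    fun f hf => ((hfin.mem_toFinset).1 hf).2.2.2.2.2
  rw [← Set.ncard_eq_toFinset_card _ hfin] at hvol
  set lo := 2 * l ^ 4 - 22 * δ * l ^ 4 with hlo
  set hi := 4 * l ^ 4 + 22 * δ * l ^ 4 with hhi
  have hδl : 0 < δ * l ^ 4 := by positivity
  have hδl1 : δ * l ^ 4 ≤ 1 / 1000 * l ^ 4 := mul_le_mul_of_nonneg_right hδ1 hl4.le
  have hlo0 : 0 < lo := by linarith
  have hm0 : 0 < l ^ 2 / y ^ 2 / 2 := by positivity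
  have hsub : (⋃ f ∈ hfin.toFinset, cubicTile N f) ⊆
      cubicParam '' cubicBox (√(1 + 4 * δ)) (√lo) (√hi) (√(l ^ 2 / y ^ 2 / 2)) (Real.pi / 2) := by
    refine Set.iUnion₂_subset fun f hf x hx => ?_
    obtain ⟨h1, h2, h3, h4, h5, -⟩ := (hfin.mem_toFinset).1 hf
    obtain ⟨c1, c2, c3, c4⟩ := intCast_forms f
    have hreg : (fun i => (f i : ℝ)) ∈ cubicReg 1 (2 * l ^ 4) (4 * l ^ 4) (l ^ 2 / y ^ 2) := by
      refine ⟨?_, ?_, by rwa [c4], by rw [c4]; exact h4.le, by rwa [c1]⟩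
      · rw [c1, c2, one_mul, abs_le]
        constructor
        · exact_mod_cast h1.2.1.le
        · exact_mod_cast h1.2.2.1
      · rw [c1, c3, one_mul]; exact_mod_cast h1.2.2.2.1
    have hx' : x ∈ cubicReg (1 + 4 * δ) lo hi (l ^ 2 / y ^ 2 / 2) := by
      have := cubicReg_add_mem (e := x - fun i => (f i : ℝ)) (n := N) (δ := δ) one_pos (by norm_num)
        hl (by linarith) (by linarith) hy le_rfl hreg hN'.le hδ (by linarith) fun i => by
          have := hx i (Set.mem_univ i)
          rw [Pi.sub_apply, abs_le]
          constructor <;> linarith [this.1, this.2]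
      rwa [add_sub_cancel] at this
    refine mem_image_cubicBox (by linarith) hlo0 hm0 ?_ hx'
    have := (hx 0 (Set.mem_univ 0)).1
    have h20 : (0 : ℝ) < f 0 := by exact_mod_cast h2
    linarith
  have hr1 : |√(1 + 4 * δ) - 1| ≤ 4 * δ := by
    refine (abs_sqrt_sub_one_le (by linarith)).trans_eq ?_
    rw [abs_of_pos (by linarith)]; ring
  have hr2 := abs_le.1 hr1
  have key := measure_mono (μ := volume) hsub
  rw [hvol, volume_cubicParam_image (Real.sqrt_pos.2 hlo0) (Real.sqrt_pos.2 hm0) le_rfl] at key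
  have key2 := key.trans (lintegral_cubicBox_le (Real.sqrt_pos.2 (by linarith)) (by linarith)
    (Real.sqrt_nonneg _) (Real.sqrt_le_sqrt (by linarith)) (by positivity) (Real.sqrt_nonneg _))
  have hA := abs_le.1 (abs_arcsin_sub_le (hr1.trans (by linarith)))
  set A := Real.arcsin (√(1 + 4 * δ) ^ 3 / 2) with hAdef
  have hA1 : A ≤ Real.pi / 6 + 16 * δ := by linarith
  have hA0 : 0 ≤ A := Real.arcsin_nonneg.2 (by positivity)
  rw [Real.sq_sqrt hlo0.le, Real.sq_sqrt (by linarith), show hi - lo = (2 + 44 * δ) * l ^ 4 by ring] at key2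
  have hpi := Real.pi_pos
  rw [ENNReal.ofReal_le_ofReal_iff (by positivity)] at key2
  refine key2.trans ?_
  have hpi4 := Real.pi_le_four
  have e1 : Real.pi / 2 * ((2 + 44 * δ) * l ^ 4) * A ≤
      Real.pi / 2 * ((2 + 44 * δ) * l ^ 4) * (Real.pi / 6 + 16 * δ) :=
    mul_le_mul_of_nonneg_left hA1 (by positivity)
  refine e1.trans ?_
  have e2 : Real.pi / 2 * ((2 + 44 * δ) * l ^ 4) * (Real.pi / 6 + 16 * δ) =
    Real.pi ^ 2 / 6 * l ^ 4 + (Real.pi * Real.pi * (22 / 6) + Real.pi * (16 + 352 * δ)) * (δ * l ^ 4) := by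
    ring
  rw [e2]
  have e3 : Real.pi * Real.pi ≤ 4 * 4 := mul_le_mul hpi4 hpi4 hpi.le (by norm_num)
  have e4 : Real.pi * (16 + 352 * δ) ≤ 4 * 17 := mul_le_mul hpi4 (by linarith) (by positivity) (by norm_num)
  nlinarith

lemma image_cubicBox_subset (hN : 0 < N) (hl : 0 < l) (hy : 1 ≤ y)
    (hδ : 1000 * N * y ^ 5 ≤ δ * l) (hδ1 : δ ≤ 1 / 1000) :
    cubicParam '' cubicBox (√(1 - 5 * δ)) (√(2 * l ^ 4 + 22 * δ * l ^ 4))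
      (√(4 * l ^ 4 - 44 * δ * l ^ 4)) (√(2 * (l ^ 2 / y ^ 2))) (Real.pi / 2 * (1 - δ)) ⊆
      ⋃ f ∈ (mainForms_finite N v l y).toFinset, cubicTile N f := by
  have hN' : (0 : ℝ) < N := by exact_mod_cast hN
  have hy0 : 0 < y := by linarith
  have hδ0 : 0 < δ := pos_of_mul_pos_left (lt_of_lt_of_le (by positivity) hδ) hl.le
  have hl4 : 0 < l ^ 4 := by positivity
  have hfin := mainForms_finite N v l y
  set lo := 2 * l ^ 4 + 22 * δ * l ^ 4 with hlo
  set hi := 4 * l ^ 4 - 44 * δ * l ^ 4 with hhi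
  have hδl : 0 < δ * l ^ 4 := by positivity
  have hδl1 : δ * l ^ 4 ≤ 1 / 1000 * l ^ 4 := mul_le_mul_of_nonneg_right hδ1 hl4.le
  have hlo0 : 0 < lo := by linarith
  have hhi0 : 0 < hi := by linarith
  have hm0 : 0 < 2 * (l ^ 2 / y ^ 2) := by positivity
  have hpi := Real.pi_pos
  set τ := Real.pi / 2 * (1 - δ) with hτ
  have hτ1 : τ ≤ Real.pi / 2 := by nlinarith
  rintro _ ⟨z, hz, rfl⟩
  have hreg := mem_cubicReg_of_mem_cubicBox (by linarith) hlo0 hm0 hhi0.le hz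
  set x := cubicParam z with hx
  obtain ⟨f, hfv, hfx⟩ := exists_mem_cubicTile hN v x
  have hdiff (i : Fin 4) : |(f i : ℝ) - x i| ≤ N := by
    have := hfx i (Set.mem_univ i)
    rw [abs_le]
    constructor <;> linarith [this.1, this.2]
  have hf' : (fun i => (f i : ℝ)) ∈ cubicReg (1 - 5 * δ + 4 * δ) (lo - 22 * δ * l ^ 4)
      (hi + 22 * δ * l ^ 4) (2 * (l ^ 2 / y ^ 2) / 2) := by
    have := cubicReg_add_mem (e := (fun i => (f i : ℝ)) - x) (n := N) (δ := δ) (by linarith)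
      (by linarith) hl (by linarith) (by linarith) hy0 (by linarith) hreg hN'.le hδ (by linarith) hdiff
    rwa [add_sub_cancel] at this
  obtain ⟨c1, c2, c3, c4⟩ := intCast_forms f
  obtain ⟨g1, g2, g3, g4, g5⟩ := hf'
  rw [c1, c2] at g1
  rw [c1, c3] at g2
  rw [c4] at g3 g4
  rw [c1] at g5
  have hP0 : (0 : ℝ) < ((hP f : ℤ) : ℝ) := lt_of_lt_of_le (by positivity) g5
  have hPδ : 0 < δ * ((hP f : ℤ) : ℝ) := by positivity
  have hR0 : (0 : ℝ) < ((hR f : ℤ) : ℝ) := by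
    by_contra hc
    nlinarith
  have hRδ : 0 < δ * ((hR f : ℤ) : ℝ) := by positivity
  have hQ' := abs_le.1 g1
  have hPR : hP f < hR f := by
    have : ((hP f : ℤ) : ℝ) < ((hR f : ℤ) : ℝ) := by linarith
    exact_mod_cast this
  have hred : RedCubic f := by
    refine ⟨by exact_mod_cast hP0, ?_, ?_, hPR.le, fun h => absurd h hPR.ne⟩
    · have : -((hP f : ℤ) : ℝ) < ((hQ f : ℤ) : ℝ) := by linarith
      exact_mod_cast this
    · have : ((hQ f : ℤ) : ℝ) ≤ ((hP f : ℤ) : ℝ) := by linarith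
      exact_mod_cast this
  have hx0 : (N : ℝ) ≤ x 0 := by
    obtain ⟨-, ⟨b1, b2⟩, b3, b4, -⟩ := hz
    have z1 : 0 < z 1 := (Real.sqrt_pos.2 hlo0).trans_le b1
    have z2 : z 1 ≤ 2 * l ^ 2 := b2.trans (Real.sqrt_le_iff.2 ⟨by positivity, by nlinarith⟩)
    have z3 : l / y ≤ z 3 := by
      refine le_trans (Real.le_sqrt_of_sq_le ?_) b4
      rw [div_pow]
      have : 0 < l ^ 2 / y ^ 2 := by positivity
      linarith
    have z4 : δ ≤ Real.cos (z 2) := by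
      rw [← Real.cos_abs]
      refine le_trans ?_ (Real.one_sub_mul_le_cos (abs_nonneg _) (b3.trans hτ1))
      have e : 2 / Real.pi * τ = 1 - δ := by rw [hτ]; field_simp
      have : 2 / Real.pi * |z 2| ≤ 2 / Real.pi * τ := by gcongr
      linarith
    have z5 : (l / y) ^ 3 ≤ z 3 ^ 3 := pow_le_pow_left₀ (by positivity) z3 3
    have ex : x 0 = 2 * z 3 ^ 3 * Real.cos (z 2) / z 1 := by simp [hx, cubicParam]
    rw [ex, le_div_iff₀ z1]
    have e1 : (l / y) ^ 3 * δ ≤ z 3 ^ 3 * Real.cos (z 2) :=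
      mul_le_mul z5 z4 hδ0.le (le_trans (by positivity) z5)
    have e2 : N * z 1 ≤ N * (2 * l ^ 2) := by gcongr
    have e3 : N * l ^ 2 ≤ (l / y) ^ 3 * δ := by
      rw [div_pow, div_mul_eq_mul_div, le_div_iff₀ (by positivity)]
      have k1 : y ^ 3 ≤ y ^ 5 := pow_le_pow_right₀ hy (by norm_num)
      have k2 : N * y ^ 3 ≤ 1000 * N * y ^ 5 := by
        have := mul_le_mul_of_nonneg_left k1 hN'.le
        have : 0 < N * y ^ 5 := by positivity
        linarith
      have k3 := mul_le_mul_of_nonneg_right (k2.trans hδ) (sq_nonneg l)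
      linarith
    linarith
  have hf0 : 0 < f 0 := by
    have := (hfx 0 (Set.mem_univ 0)).2
    have h0 : (0 : ℝ) < f 0 := by linarith
    exact_mod_cast h0
  refine Set.mem_iUnion₂.2 ⟨f, (hfin.mem_toFinset).2
    ⟨hred, hf0, by linarith, by linarith, by linarith, hfv⟩, hfx⟩

lemma le_ncard_mainForms (hN : 0 < N) (hl : 0 < l) (hy : 1 ≤ y)
    (hδ : 1000 * N * y ^ 5 ≤ δ * l) (hδ1 : δ ≤ 1 / 1000) :
    Real.pi ^ 2 / 6 * l ^ 4 ≤ ((mainForms N v l y).ncard : ℝ) * (N : ℝ) ^ 4 +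
      1000 * (δ * l ^ 4) + 100 * (l ^ 4 / y ^ 2) := by
  have hN' : (0 : ℝ) < N := by exact_mod_cast hN
  have hy0 : 0 < y := by linarith
  have hδ0 : 0 < δ := pos_of_mul_pos_left (lt_of_lt_of_le (by positivity) hδ) hl.le
  have hl4 : 0 < l ^ 4 := by positivity
  have hfin := mainForms_finite N v l y
  have hvol := volume_biUnion_cubicTile (v := v) hfin.toFinset
    fun f hf => ((hfin.mem_toFinset).1 hf).2.2.2.2.2
  rw [← Set.ncard_eq_toFinset_card _ hfin] at hvol
  set lo := 2 * l ^ 4 + 22 * δ * l ^ 4 with hlo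
  set hi := 4 * l ^ 4 - 44 * δ * l ^ 4 with hhi
  have hδl : 0 < δ * l ^ 4 := by positivity
  have hδl1 : δ * l ^ 4 ≤ 1 / 1000 * l ^ 4 := mul_le_mul_of_nonneg_right hδ1 hl4.le
  have hlo0 : 0 < lo := by linarith
  have hhi0 : 0 < hi := by linarith
  have hm0 : 0 < 2 * (l ^ 2 / y ^ 2) := by positivity
  have hpi := Real.pi_pos
  have hpi4 := Real.pi_le_four
  set τ := Real.pi / 2 * (1 - δ) with hτ
  have hτ1 : τ ≤ Real.pi / 2 := by nlinarith
  have hτ0 : 0 ≤ τ := mul_nonneg (by positivity) (by linarith)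
  have hsub := image_cubicBox_subset (v := v) hN hl hy hδ hδ1
  have hr1 : |√(1 - 5 * δ) - 1| ≤ 5 * δ := by
    refine (abs_sqrt_sub_one_le (by linarith)).trans_eq ?_
    rw [abs_of_neg (by linarith)]; ring
  have hr2 := abs_le.1 hr1
  have key := measure_mono (μ := volume) hsub
  rw [hvol, volume_cubicParam_image (Real.sqrt_pos.2 hlo0) (Real.sqrt_pos.2 hm0) hτ1] at key
  have hrpos : 0 < √(1 - 5 * δ) := Real.sqrt_pos.2 (by linarith)
  have hab : √lo ≤ √hi := Real.sqrt_le_sqrt (by linarith)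
  have key2 := (le_lintegral_cubicBox hrpos (by linarith)
    (Real.sqrt_nonneg _) hab hτ0 (Real.sqrt_nonneg _)).trans
    (add_le_add_left key _)
  have hA := abs_le.1 (abs_arcsin_sub_le (hr1.trans (by linarith)))
  set A := Real.arcsin (√(1 - 5 * δ) ^ 3 / 2) with hAdef
  have hA1 : Real.pi / 6 - 20 * δ ≤ A := by linarith
  rw [Real.sq_sqrt hlo0.le, Real.sq_sqrt hhi0.le, Real.sq_sqrt hm0.le, Real.sq_sqrt (by linarith),
    show hi - lo = (2 - 66 * δ) * l ^ 4 by ring] at key2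
  have hB0 : 0 ≤ √hi - √lo := by linarith
  have hB1 : √hi ≤ 2 * l ^ 2 := Real.sqrt_le_iff.2 ⟨by positivity, by nlinarith⟩
  have hB2 : √hi - √lo ≤ 2 * l ^ 2 := by linarith [Real.sqrt_nonneg lo]
  have h15 : 0 ≤ 1 - 5 * δ := by linarith
  rw [← ENNReal.ofReal_add (by positivity) (by positivity),
    ENNReal.ofReal_le_ofReal_iff (by positivity)] at key2
  have e1 : 4 * (1 - 5 * δ) * (√hi - √lo) * τ * (2 * (l ^ 2 / y ^ 2)) ≤
      4 * 1 * (2 * l ^ 2) * 2 * (2 * (l ^ 2 / y ^ 2)) := by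
    have : τ ≤ 2 := by linarith
    gcongr
    linarith
  have e2 : 4 * 1 * (2 * l ^ 2) * 2 * (2 * (l ^ 2 / y ^ 2)) = 32 * (l ^ 4 / y ^ 2) := by ring
  have e3 : τ * ((2 - 66 * δ) * l ^ 4) * (Real.pi / 6 - 20 * δ) ≤ τ * ((2 - 66 * δ) * l ^ 4) * A :=
    mul_le_mul_of_nonneg_left hA1 (mul_nonneg hτ0 (mul_nonneg (by linarith) hl4.le))
  have e4 : τ * ((2 - 66 * δ) * l ^ 4) * (Real.pi / 6 - 20 * δ) =
    Real.pi ^ 2 / 6 * l ^ 4 - (Real.pi * Real.pi / 12 * (68 - 66 * δ) +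
      Real.pi * (1 - δ) * 10 * (2 - 66 * δ)) * (δ * l ^ 4) := by
    rw [hτ]; ring
  have e5 : Real.pi * Real.pi ≤ 4 * 4 := mul_le_mul hpi4 hpi4 hpi.le (by norm_num)
  have e6 : Real.pi * Real.pi / 12 * (68 - 66 * δ) ≤ 4 * 4 / 12 * 68 := by
    have : 0 ≤ 68 - 66 * δ := by linarith
    gcongr; linarith
  have e7 : Real.pi * (1 - δ) * 10 * (2 - 66 * δ) ≤ 4 * 1 * 10 * 2 := by
    have : 0 ≤ 2 - 66 * δ := by linarith
    have : 0 ≤ 1 - δ := by linarith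
    gcongr <;> linarith
  have e8 : 0 ≤ l ^ 4 / y ^ 2 := by positivity
  have e9 : (Real.pi * Real.pi / 12 * (68 - 66 * δ) +
      Real.pi * (1 - δ) * 10 * (2 - 66 * δ)) * (δ * l ^ 4) ≤ 1000 * (δ * l ^ 4) :=
    mul_le_mul_of_nonneg_right (by linarith) hδl.le
  linarith

end CountClass

section CubicAct

/-- The substitution `f (i x + j y, k x + l y)` on binary cubic forms. -/
def cubicAct {S : Type*} [CommRing S] (f : Fin 4 → S) (i j k l : S) : Fin 4 → S :=
  ![f 0 * i ^ 3 + 3 * f 1 * i ^ 2 * k + 3 * f 2 * i * k ^ 2 + f 3 * k ^ 3,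
    f 0 * i ^ 2 * j + f 1 * (i ^ 2 * l + 2 * i * j * k) + f 2 * (2 * i * k * l + j * k ^ 2) +
      f 3 * k ^ 2 * l,
    f 0 * i * j ^ 2 + f 1 * (2 * i * j * l + j ^ 2 * k) + f 2 * (2 * j * k * l + i * l ^ 2) +
      f 3 * k * l ^ 2,
    f 0 * j ^ 3 + 3 * f 1 * j ^ 2 * l + 3 * f 2 * j * l ^ 2 + f 3 * l ^ 3]

variable {S : Type*} [CommRing S] (f : Fin 4 → S) (i j k l : S)

lemma hP_cubicAct : hP (cubicAct f i j k l) =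
    (i * l - j * k) ^ 2 * (hP f * i ^ 2 + hQ f * i * k + hR f * k ^ 2) := by
  simp only [hP, hQ, hR, cubicAct, Matrix.cons_val]; ring

lemma hQ_cubicAct : hQ (cubicAct f i j k l) =
    (i * l - j * k) ^ 2 * (2 * hP f * i * j + hQ f * (i * l + j * k) + 2 * hR f * k * l) := by
  simp only [hP, hQ, hR, cubicAct, Matrix.cons_val]; ring

lemma hR_cubicAct : hR (cubicAct f i j k l) =
    (i * l - j * k) ^ 2 * (hP f * j ^ 2 + hQ f * j * l + hR f * l ^ 2) := by
  simp only [hP, hQ, hR, cubicAct, Matrix.cons_val]; ring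

lemma dsc_cubicAct : dsc (cubicAct f i j k l) = (i * l - j * k) ^ 6 * dsc f := by
  rw [dsc, hP_cubicAct, hQ_cubicAct, hR_cubicAct, dsc]; ring

lemma cubicAct_cubicAct (i' j' k' l' : S) : cubicAct (cubicAct f i j k l) i' j' k' l' =
    cubicAct f (i * i' + j * k') (i * j' + j * l') (k * i' + l * k') (k * j' + l * l') := by
  funext m
  fin_cases m <;> simp only [cubicAct, Fin.zero_eta, Fin.mk_one, Fin.reduceFinMk, Matrix.cons_val] <;> ring

lemma cubicAct_smul (c : S) : cubicAct (c • f) i j k l = c • cubicAct f i j k l := by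
  funext m
  fin_cases m <;> simp [cubicAct] <;> ring

lemma cubicAct_scalar (c : S) : cubicAct f c 0 0 c = c ^ 3 • f := by
  funext m
  fin_cases m <;> simp [cubicAct] <;> ring

/-- Every form with positive definite Hessian is equivalent to a reduced one. -/
lemma exists_redCubic_cubicAct (f : Fin 4 → ℤ) (hp : 0 < hP f) (hd : 0 < dsc f) :
    ∃ i j k l : ℤ, i * l - j * k = 1 ∧ RedCubic (cubicAct f i j k l) := by
  induction hn : (hP f).toNat using Nat.strong_induction_on generalizing f with
  | _ n ih =>
  set m := (hP f - hQ f) / (2 * hP f) with hm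
  have hmod := Int.emod_add_mul_ediv (hP f - hQ f) (2 * hP f)
  have h0 := Int.emod_nonneg (hP f - hQ f) (show 2 * hP f ≠ 0 by lia)
  have h1 := Int.emod_lt_of_pos (hP f - hQ f) (show 0 < 2 * hP f by lia)
  rw [← hm] at hmod
  set g := cubicAct f 1 m 0 1 with hg
  have gP : hP g = hP f := by rw [hg, hP_cubicAct]; ring
  have gQ : hQ g = hQ f + 2 * hP f * m := by rw [hg, hQ_cubicAct]; ring
  have gd : dsc g = dsc f := by rw [hg, dsc_cubicAct]; ring
  have gQ1 : -hP g < hQ g := by lia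
  have gQ2 : hQ g ≤ hP g := by lia
  have hs : cubicAct g 0 (-1) 1 0 = cubicAct f m (-1) 1 0 := by
    rw [hg, cubicAct_cubicAct]; congr 1 <;> ring
  have sP : hP (cubicAct g 0 (-1) 1 0) = hR g := by rw [hP_cubicAct]; ring
  have sQ : hQ (cubicAct g 0 (-1) 1 0) = -hQ g := by rw [hQ_cubicAct]; ring
  have sR : hR (cubicAct g 0 (-1) 1 0) = hP g := by rw [hR_cubicAct]; ring
  have sd : dsc (cubicAct g 0 (-1) 1 0) = dsc f := by rw [dsc_cubicAct, gd]; ring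
  have gR : 0 < hR g := by
    have : 0 < 4 * hP g * hR g - hQ g ^ 2 := by rw [← gd] at hd; exact hd
    by_contra hc
    nlinarith
  rcases lt_trichotomy (hP g) (hR g) with h | h | h
  · exact ⟨1, m, 0, 1, by ring, by lia, gQ1, gQ2, h.le, fun e => absurd e h.ne⟩
  · rcases le_or_gt 0 (hQ g) with h' | h'
    · exact ⟨1, m, 0, 1, by ring, by lia, gQ1, gQ2, h.le, fun e => h'⟩
    · refine ⟨m, -1, 1, 0, by ring, ?_⟩
      rw [← hs]
      refine ⟨by lia, by lia, by lia, by lia, fun _ => by lia⟩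
  · obtain ⟨i, j, k, l, h2, h3⟩ := ih (hP (cubicAct g 0 (-1) 1 0)).toNat (by lia)
      (cubicAct g 0 (-1) 1 0) (by lia) (by lia) rfl
    refine ⟨m * i - k, m * j - l, i, j, by linear_combination h2, ?_⟩
    rw [hs, cubicAct_cubicAct] at h3
    convert h3 using 2 <;> ring

end CubicAct

section Descent

/-- `p f` is obtained from `g` by a substitution of determinant `p`. -/
def Descends (p : ℤ) (f g : Fin 4 → ℤ) : Prop :=
  ∃ i j k l : ℤ, i * l - j * k = p ∧ p • f = cubicAct g i j k l

/-- `q` divides the Hessian of `f`. -/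
def HessDvd (q : ℤ) (f : Fin 4 → ℤ) : Prop := q ∣ hP f ∧ q ∣ hQ f ∧ q ∣ hR f

variable {f g : Fin 4 → ℤ} {p q : ℤ}

lemma Descends.hess (hp : p ≠ 0) {i j k l : ℤ} (hN : i * l - j * k = p)
    (h : p • f = cubicAct g i j k l) :
    hP f = hP g * i ^ 2 + hQ g * i * k + hR g * k ^ 2 ∧
    hQ f = 2 * hP g * i * j + hQ g * (i * l + j * k) + 2 * hR g * k * l ∧
    hR f = hP g * j ^ 2 + hQ g * j * l + hR g * l ^ 2 := by
  have h2 : p ^ 2 ≠ 0 := pow_ne_zero 2 hp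
  have e1 := hP_cubicAct g i j k l
  have e2 := hQ_cubicAct g i j k l
  have e3 := hR_cubicAct g i j k l
  rw [← h, hN] at e1 e2 e3
  refine ⟨mul_left_cancel₀ h2 ?_, mul_left_cancel₀ h2 ?_, mul_left_cancel₀ h2 ?_⟩
  · rw [← e1]; simp only [hP, Pi.smul_apply, smul_eq_mul]; ring
  · rw [← e2]; simp only [hQ, Pi.smul_apply, smul_eq_mul]; ring
  · rw [← e3]; simp only [hR, Pi.smul_apply, smul_eq_mul]; ring

lemma Descends.dsc_eq (hp : p ≠ 0) (h : Descends p f g) : dsc f = p ^ 2 * dsc g := by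
  obtain ⟨i, j, k, l, hN, h⟩ := h
  obtain ⟨h1, h2, h3⟩ := Descends.hess hp hN h
  rw [dsc, dsc, h1, h2, h3, ← hN]; ring

lemma Descends.hessDvd (hp : p ≠ 0) (hq : IsCoprime q p) (h : Descends p f g) (hf : HessDvd q f) :
    HessDvd q g := by
  obtain ⟨i, j, k, l, hN, h⟩ := h
  obtain ⟨h1, h2, h3⟩ := Descends.hess hp hN h
  obtain ⟨d1, d2, d3⟩ := hf
  have hq2 : IsCoprime q (p ^ 2) := hq.pow_right
  refine ⟨hq2.dvd_of_dvd_mul_left ?_, hq2.dvd_of_dvd_mul_left ?_, hq2.dvd_of_dvd_mul_left ?_⟩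
  · have : p ^ 2 * hP g = hP f * l ^ 2 - hQ f * (l * k) + hR f * k ^ 2 := by
      rw [h1, h2, h3, ← hN]; ring
    rw [this]
    exact dvd_add (dvd_sub (d1.mul_right _) (d2.mul_right _)) (d3.mul_right _)
  · have : p ^ 2 * hQ g = hP f * (-2 * l * j) + hQ f * (i * l + j * k) + hR f * (-2 * i * k) := by
      rw [h1, h2, h3, ← hN]; ring
    rw [this]
    exact dvd_add (dvd_add (d1.mul_right _) (d2.mul_right _)) (d3.mul_right _)
  · have : p ^ 2 * hR g = hP f * j ^ 2 - hQ f * (i * j) + hR f * i ^ 2 := by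
      rw [h1, h2, h3, ← hN]; ring
    rw [this]
    exact dvd_add (dvd_sub (d1.mul_right _) (d2.mul_right _)) (d3.mul_right _)

lemma Descends.comp {i j k l : ℤ} (hd : i * l - j * k = 1) (h : Descends p (cubicAct f i j k l) g) :
    Descends p f g := by
  obtain ⟨i', j', k', l', hN, h⟩ := h
  have e : f = cubicAct (cubicAct f i j k l) l (-j) (-k) i := by
    rw [cubicAct_cubicAct]
    have := cubicAct_scalar f (1 : ℤ)
    rw [one_pow, one_smul] at this
    rw [show i * l + j * -k = 1 by lia, show i * -j + j * i = 0 by ring,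
      show k * l + l * -k = 0 by ring, show k * -j + l * i = 1 by linear_combination hd, this]
  refine ⟨i' * l + j' * -k, i' * -j + j' * i, k' * l + l' * -k, k' * -j + l' * i, ?_, ?_⟩
  · linear_combination (i * l - j * k) * hN + p * hd
  · conv_lhs => rw [e]
    rw [← cubicAct_smul, h, cubicAct_cubicAct]

lemma Descends.comp_right {i j k l : ℤ} (hd : i * l - j * k = 1) (h : Descends p f g) :
    Descends p f (cubicAct g i j k l) := by
  obtain ⟨i', j', k', l', hN, h⟩ := h
  refine ⟨l * i' - j * k', l * j' - j * l', -k * i' + i * k', -k * j' + i * l', ?_, ?_⟩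
  · linear_combination (i * l - j * k) * hN + p * hd
  · rw [h, cubicAct_cubicAct]
    congr 1
    · linear_combination -i' * hd
    · linear_combination -j' * hd
    · linear_combination -k' * hd
    · linear_combination -l' * hd

lemma exists_descends_of_dvd (hp : Prime p) (hp2 : IsCoprime p 2) (h1 : p ∣ hP f) (h2 : p ∣ hQ f)
    (h3 : ¬ p ∣ hR f) (hd : p ^ 2 ∣ dsc f) : ∃ g, Descends p f g := by
  have hc := hess_rel_c f
  have hdd := hess_rel_d f
  have ha : p ∣ f 0 := by
    have : p ∣ hR f * f 0 := by
      rw [show hR f * f 0 = hQ f * f 1 - hP f * f 2 by lia]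
      exact dvd_sub (h2.mul_right _) (h1.mul_right _)
    exact (hp.dvd_or_dvd this).resolve_left h3
  have hb : p ∣ f 1 := by
    have : p ∣ hR f * f 1 := by
      rw [show hR f * f 1 = hQ f * f 2 - hP f * f 3 by lia]
      exact dvd_sub (h2.mul_right _) (h1.mul_right _)
    exact (hp.dvd_or_dvd this).resolve_left h3
  have hRp : IsCoprime (p ^ 2) (4 * hR f) := by
    have h4 : IsCoprime p (4 * hR f) := by
      have h22 : IsCoprime p ((2 * 2) * hR f) :=
        (hp2.mul_right hp2).mul_right ((Prime.coprime_iff_not_dvd hp).2 h3)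
      exact h22
    exact h4.pow_left
  have hP2 : p ^ 2 ∣ hP f := by
    refine hRp.dvd_of_dvd_mul_left ?_
    rw [show 4 * hR f * hP f = dsc f + hQ f ^ 2 by rw [dsc]; ring]
    exact dvd_add hd (pow_dvd_pow_of_dvd h2 2)
  have hcc : ¬ p ∣ f 2 := by
    intro h
    apply h3
    rw [hR]
    exact dvd_sub (h.trans (dvd_pow_self _ two_ne_zero)) (hb.mul_right _)
  have ha2 : p ^ 2 ∣ f 0 := by
    have hcop : IsCoprime (p ^ 2) (f 2) := ((Prime.coprime_iff_not_dvd hp).2 hcc).pow_left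
    refine hcop.dvd_of_dvd_mul_right ?_
    rw [show f 0 * f 2 = f 1 ^ 2 - hP f by rw [hP]; ring]
    exact dvd_sub (pow_dvd_pow_of_dvd hb 2) hP2
  obtain ⟨a, ha⟩ := ha2
  obtain ⟨b, hb⟩ := hb
  refine ⟨![a, b, f 2, p * f 3], p, 0, 0, 1, by ring, ?_⟩
  funext m
  fin_cases m <;> simp [cubicAct, ha, hb] <;> ring

lemma exists_redCubic_descends (hp : Prime p) (hp2 : IsCoprime p 2) (hP0 : 0 < hP f)
    (hd0 : 0 < dsc f) (hd : p ^ 2 ∣ dsc f) (hH : ¬ HessDvd p f) :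
    ∃ g, RedCubic g ∧ Descends p f g := by
  have key : ∃ g, Descends p f g := by
    have hpd : p ∣ dsc f := (dvd_pow_self p two_ne_zero).trans hd
    by_cases h1 : p ∣ hP f
    · have h2 : p ∣ hQ f := by
        refine hp.dvd_of_dvd_pow (n := 2) ?_
        rw [show hQ f ^ 2 = hP f * (4 * hR f) - dsc f by rw [dsc]; ring]
        exact dvd_sub (h1.mul_right _) hpd
      exact exists_descends_of_dvd hp hp2 h1 h2 (fun h3 => hH ⟨h1, h2, h3⟩) hd
    · have hcop : IsCoprime p (2 * hP f) := hp2.mul_right ((Prime.coprime_iff_not_dvd hp).2 h1)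
      obtain ⟨u, v, huv⟩ := hcop
      set t := -(v * hQ f) with ht
      have hroot : p ∣ 2 * hP f * t + hQ f := ⟨u * hQ f, by rw [ht]; linear_combination -hQ f * huv⟩
      set f' := cubicAct f t (-1) 1 0 with hf'
      have eP : hP f' = hP f * t ^ 2 + hQ f * t + hR f := by rw [hf', hP_cubicAct]; ring
      have eQ : hQ f' = -(2 * hP f * t + hQ f) := by rw [hf', hQ_cubicAct]; ring
      have eR : hR f' = hP f := by rw [hf', hR_cubicAct]; ring
      have ed : dsc f' = dsc f := by rw [hf', dsc_cubicAct]; ring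
      have dP : p ∣ hP f' := by
        have : p ∣ (2 * 2 * hP f) * hP f' := by
          rw [show (2 * 2 * hP f) * hP f' = (2 * hP f * t + hQ f) ^ 2 + dsc f by rw [eP, dsc]; ring]
          exact dvd_add (hroot.trans (dvd_pow_self _ two_ne_zero)) hpd
        refine IsCoprime.dvd_of_dvd_mul_left ?_ this
        exact (hp2.mul_right hp2).mul_right ((Prime.coprime_iff_not_dvd hp).2 h1)
      obtain ⟨g, hg⟩ := exists_descends_of_dvd (f := f') hp hp2 dP (eQ ▸ hroot.neg_right)
        (eR ▸ h1) (ed ▸ hd)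
      exact ⟨g, hg.comp (by ring)⟩
  obtain ⟨g, hg⟩ := key
  have hgd := hg.dsc_eq hp.ne_zero
  have hp0 : 0 < p ^ 2 := by have := hp.ne_zero; positivity
  have hgd0 : 0 < dsc g := by
    by_contra hc
    nlinarith
  have hgP : 0 < hP g := by
    obtain ⟨i, j, k, l, hN, h⟩ := hg
    have h1 := (Descends.hess hp.ne_zero hN h).1
    have h4 : 4 * hP g * hP f = (2 * hP g * i + hQ g * k) ^ 2 + dsc g * k ^ 2 := by
      rw [h1, dsc]; ring
    have h5 : hP g ≠ 0 := by
      intro h0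
      rw [dsc, h0] at hgd0
      nlinarith [sq_nonneg (hQ g)]
    have h6 : 0 ≤ 4 * hP g * hP f := h4 ▸ by positivity
    by_contra hc
    have : hP g < 0 := by lia
    nlinarith
  obtain ⟨i, j, k, l, hN, hr⟩ := exists_redCubic_cubicAct g hgP hgd0
  exact ⟨_, hr, hg.comp_right hN⟩

end Descent

section Fibers

variable {f g : Fin 4 → ℤ} {p : ℤ}

lemma RedCubic.le_form (hf : RedCubic f) (x y : ℤ) :
    hP f * (x ^ 2 - |x * y| + y ^ 2) ≤ hP f * x ^ 2 + hQ f * x * y + hR f * y ^ 2 := by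
  obtain ⟨h1, h2, h3, h4, -⟩ := hf
  have hq : |hQ f * (x * y)| ≤ hP f * |x * y| := by
    rw [abs_mul]
    exact mul_le_mul_of_nonneg_right (abs_le.2 ⟨h2.le, h3⟩) (abs_nonneg _)
  have h5 := neg_abs_le (hQ f * (x * y))
  have h6 := mul_le_mul_of_nonneg_right h4 (sq_nonneg y)
  linarith

lemma RedCubic.hP_le_of_cubicAct (hf : RedCubic f) {i j k l : ℤ} (hd : i * l - j * k = 1) :
    hP f ≤ hP (cubicAct f i j k l) := by
  have h1 := hf.le_form i k
  rw [hP_cubicAct, hd, one_pow, one_mul]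
  refine le_trans (le_mul_of_one_le_right hf.1.le ?_) h1
  have hne : 0 < i ^ 2 + k ^ 2 := by
    rcases eq_or_ne i 0 with rfl | h
    · have : k ≠ 0 := by rintro rfl; simp at hd
      positivity
    · positivity
  rw [abs_mul, ← sq_abs i, ← sq_abs k] at *
  have := abs_nonneg i
  have := abs_nonneg k
  nlinarith [sq_nonneg (|i| - |k|), mul_nonneg (abs_nonneg i) (abs_nonneg k)]

lemma eq_cubicAct_adjugate {i j k l : ℤ} (hd : i * l - j * k = 1) (h : g = cubicAct f i j k l) :
    f = cubicAct g l (-j) (-k) i := by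
  rw [h, cubicAct_cubicAct]
  have := cubicAct_scalar f (1 : ℤ)
  rw [one_pow, one_smul] at this
  rw [show i * l + j * -k = 1 by lia, show i * -j + j * i = 0 by ring,
    show k * l + l * -k = 0 by ring, show k * -j + l * i = 1 by linear_combination hd, this]

lemma RedCubic.column_mem (hf : RedCubic f) {i j k l : ℤ} (hd : i * l - j * k = 1)
    (hg : RedCubic (cubicAct f i j k l)) :
    (i, k) ∈ Finset.Icc (-1 : ℤ) 1 ×ˢ Finset.Icc (-1 : ℤ) 1 := by
  have e1 := hg.hP_le_of_cubicAct (i := l) (j := -j) (k := -k) (l := i) (by linear_combination hd)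
  rw [← eq_cubicAct_adjugate hd rfl, hP_cubicAct, hd, one_pow, one_mul] at e1
  have h1 := (hf.le_form i k).trans e1
  have h2 : i ^ 2 - |i * k| + k ^ 2 ≤ 1 := by
    by_contra! hc
    have := mul_lt_mul_of_pos_left hc hf.1
    linarith
  rw [abs_mul, ← sq_abs i, ← sq_abs k] at h2
  have hi : |i| < 2 := by nlinarith [sq_nonneg (2 * |k| - |i|), abs_nonneg i]
  have hk : |k| < 2 := by nlinarith [sq_nonneg (2 * |i| - |k|), abs_nonneg k]
  rw [abs_lt] at hi hk
  simp only [Finset.mem_product, Finset.mem_Icc]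
  lia

lemma RedCubic.eq_of_column {i j k l j' l' : ℤ} (hd : i * l - j * k = 1)
    (hd' : i * l' - j' * k = 1) (h1 : RedCubic (cubicAct f i j k l))
    (h2 : RedCubic (cubicAct f i j' k l')) : cubicAct f i j k l = cubicAct f i j' k l' := by
  set m := l * j' - j * l' with hm
  have ej : j' = j + m * i := by rw [hm]; linear_combination (-j') * hd + j * hd'
  have el : l' = l + m * k := by rw [hm]; linear_combination (-l') * hd + l * hd'
  obtain ⟨a1, a2, a3, -⟩ := h1
  obtain ⟨-, b2, b3, -⟩ := h2
  have eP : hP (cubicAct f i j' k l') = hP (cubicAct f i j k l) := by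
    rw [hP_cubicAct, hP_cubicAct, hd, hd']
  have eQ : hQ (cubicAct f i j' k l') =
      hQ (cubicAct f i j k l) + 2 * m * hP (cubicAct f i j k l) := by
    rw [hQ_cubicAct, hQ_cubicAct, hP_cubicAct, hd, hd', ej, el]; ring
  rw [eP, eQ] at b2 b3
  have hm0 : m = 0 := by
    have h1 : m < 1 := by by_contra! hc; nlinarith
    have h2 : -1 < m := by by_contra! hc; nlinarith
    lia
  rw [ej, el, hm0]; simp

/-- The column space modulo `p` of a singular nonzero matrix. -/
noncomputable def columnLine (p : ℕ) [Fact p.Prime] (i j k l : ℤ) : Option (ZMod p) :=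
  if (i : ZMod p) ≠ 0 then some (k / i) else if (j : ZMod p) ≠ 0 then some (l / j) else none

lemma columnLine_none {p : ℕ} [Fact p.Prime] {i j k l : ℤ} (h : columnLine p i j k l = none) :
    (i : ZMod p) = 0 ∧ (j : ZMod p) = 0 := by
  unfold columnLine at h
  split_ifs at h with h1 h2
  exact ⟨by simpa using h1, by simpa using h2⟩

lemma columnLine_some {p : ℕ} [Fact p.Prime] {i j k l : ℤ} {t : ZMod p}
    (hd : i * l - j * k = p) (h : columnLine p i j k l = some t) :
    ((i : ZMod p) ≠ 0 ∨ (j : ZMod p) ≠ 0) ∧ (k : ZMod p) = t * i ∧ (l : ZMod p) = t * j := by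
  have hd' : (i : ZMod p) * l = j * k := by
    have := congrArg (Int.cast : ℤ → ZMod p) hd
    push_cast at this
    rw [CharP.cast_eq_zero] at this
    linear_combination this
  unfold columnLine at h
  split_ifs at h with h1 h2
  · rw [Option.some_inj] at h
    subst h
    refine ⟨Or.inl h1, by field_simp, ?_⟩
    field_simp
    linear_combination hd'
  · rw [Option.some_inj] at h
    subst h
    push Not at h1
    have hk : (k : ZMod p) = 0 := by
      rw [h1, zero_mul] at hd'
      exact (mul_eq_zero.1 hd'.symm).resolve_left h2
    refine ⟨Or.inr h2, by rw [h1, hk, mul_zero], by field_simp⟩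

lemma exists_cubicAct_of_columnLine {p : ℕ} [Fact p.Prime] {f' : Fin 4 → ℤ}
    {i j k l i' j' k' l' : ℤ} (hd : i * l - j * k = p) (hd' : i' * l' - j' * k' = p)
    (hf : (p : ℤ) • f = cubicAct g i j k l) (hf' : (p : ℤ) • f' = cubicAct g i' j' k' l')
    (h : columnLine p i j k l = columnLine p i' j' k' l') :
    ∃ x y z w : ℤ, x * w - y * z = 1 ∧ f' = cubicAct f x y z w := by
  have hp0 : (p : ℤ) ≠ 0 := by exact_mod_cast (Fact.out : p.Prime).ne_zero
  have key : (p : ℤ) ∣ l * i' - j * k' ∧ (p : ℤ) ∣ l * j' - j * l' ∧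
      (p : ℤ) ∣ i * k' - k * i' ∧ (p : ℤ) ∣ i * l' - k * j' := by
    simp only [← ZMod.intCast_zmod_eq_zero_iff_dvd]
    push_cast
    cases hl : columnLine p i j k l with
    | none =>
      obtain ⟨h1, h2⟩ := columnLine_none hl
      obtain ⟨h3, h4⟩ := columnLine_none (h ▸ hl)
      simp [h1, h2, h3, h4]
    | some t =>
      obtain ⟨-, h1, h2⟩ := columnLine_some hd hl
      obtain ⟨-, h3, h4⟩ := columnLine_some hd' (h ▸ hl)
      rw [h1, h2, h3, h4]
      refine ⟨by ring, by ring, by ring, by ring⟩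
  obtain ⟨⟨x, hx⟩, ⟨y, hy⟩, ⟨z, hz⟩, ⟨w, hw⟩⟩ := key
  have hdet : x * w - y * z = 1 := by
    refine mul_left_cancel₀ (pow_ne_zero 2 hp0) ?_
    have : (p : ℤ) ^ 2 * (x * w - y * z) = (p * x) * (p * w) - (p * y) * (p * z) := by ring
    rw [this, ← hx, ← hy, ← hz, ← hw]
    linear_combination (i' * l' - j' * k') * hd + p * hd'
  refine ⟨x, y, z, w, hdet, ?_⟩
  have e : (p : ℤ) • cubicAct f x y z w = (p : ℤ) • f' := by
    rw [← cubicAct_smul, hf, cubicAct_cubicAct, hf']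
    congr 1 <;> refine mul_left_cancel₀ hp0 ?_
    · rw [show (p : ℤ) * (i * x + j * z) = i * (p * x) + j * (p * z) by ring, ← hx, ← hz]
      linear_combination i' * hd
    · rw [show (p : ℤ) * (i * y + j * w) = i * (p * y) + j * (p * w) by ring, ← hy, ← hw]
      linear_combination j' * hd
    · rw [show (p : ℤ) * (k * x + l * z) = k * (p * x) + l * (p * z) by ring, ← hx, ← hz]
      linear_combination k' * hd
    · rw [show (p : ℤ) * (k * y + l * w) = k * (p * y) + l * (p * w) by ring, ← hy, ← hw]
      linear_combination l' * hd
  exact (smul_right_injective _ hp0 e).symm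

open Polynomial in
lemma card_roots_le_three {p : ℕ} [Fact p.Prime]
    (hg : ¬ ((p : ℤ) ∣ g 0 ∧ (p : ℤ) ∣ g 1 ∧ (p : ℤ) ∣ g 2 ∧ (p : ℤ) ∣ g 3)) :
    (Finset.univ.filter fun t : ZMod p =>
      (g 0 : ZMod p) + 3 * g 1 * t + 3 * g 2 * t ^ 2 + g 3 * t ^ 3 = 0).card ≤ 3 := by
  rcases eq_or_ne p 3 with rfl | hp3
  · exact (Finset.card_le_univ _).trans (by rw [ZMod.card])
  have h3 : (3 : ZMod p) ≠ 0 := by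
    intro h
    have : ((3 : ℕ) : ZMod p) = 0 := by exact_mod_cast h
    rw [ZMod.natCast_eq_zero_iff] at this
    exact hp3 ((Nat.prime_dvd_prime_iff_eq Fact.out Nat.prime_three).1 this)
  set P : (ZMod p)[X] := (⟨g 3, 3 * g 2, 3 * g 1, g 0⟩ : Cubic (ZMod p)).toPoly with hPdef
  have hP0 : P ≠ 0 := by
    intro h
    apply hg
    simp only [← ZMod.intCast_zmod_eq_zero_iff_dvd]
    have c0 : P.coeff 0 = g 0 := Cubic.coeff_eq_d
    have c1 : P.coeff 1 = 3 * g 1 := Cubic.coeff_eq_c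
    have c2 : P.coeff 2 = 3 * g 2 := Cubic.coeff_eq_b
    have c3 : P.coeff 3 = g 3 := Cubic.coeff_eq_a
    rw [h, coeff_zero] at c0 c1 c2 c3
    exact ⟨c0.symm, (mul_eq_zero.1 c1.symm).resolve_left h3,
      (mul_eq_zero.1 c2.symm).resolve_left h3, c3.symm⟩
  have hsub : (Finset.univ.filter fun t : ZMod p =>
      (g 0 : ZMod p) + 3 * g 1 * t + 3 * g 2 * t ^ 2 + g 3 * t ^ 3 = 0) ⊆ P.roots.toFinset := by
    intro t ht
    rw [Finset.mem_filter] at ht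
    rw [Multiset.mem_toFinset, mem_roots hP0, IsRoot.def, hPdef, Cubic.toPoly]
    simp only [eval_add, eval_mul, eval_C, eval_pow, eval_X]
    linear_combination ht.2
  calc _ ≤ P.roots.toFinset.card := Finset.card_le_card hsub
    _ ≤ Multiset.card P.roots := Multiset.toFinset_card_le _
    _ ≤ P.natDegree := card_roots' _
    _ ≤ 3 := natDegree_cubic_le

lemma card_redCubic_descends_le {p : ℕ} [Fact p.Prime] (S : Finset (Fin 4 → ℤ))
    (hS : ∀ f ∈ S, RedCubic f ∧ Descends p f g ∧ ¬ HessDvd p f) : S.card ≤ 36 := by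
  have hp0 : (p : ℤ) ≠ 0 := by exact_mod_cast (Fact.out : p.Prime).ne_zero
  rcases S.eq_empty_or_nonempty with rfl | ⟨f₀, hf₀⟩
  · simp
  have hg : ¬ ((p : ℤ) ∣ g 0 ∧ (p : ℤ) ∣ g 1 ∧ (p : ℤ) ∣ g 2 ∧ (p : ℤ) ∣ g 3) := by
    rintro ⟨h0, h1, h2, h3⟩
    obtain ⟨-, ⟨i, j, k, l, hd, hN⟩, hH⟩ := hS f₀ hf₀
    obtain ⟨e1, e2, e3⟩ := Descends.hess hp0 hd hN
    have d1 : (p : ℤ) ∣ hP g := dvd_sub (h1.trans (dvd_pow_self _ two_ne_zero)) (h0.mul_right _)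
    have d2 : (p : ℤ) ∣ hQ g := dvd_sub (h1.mul_right _) (h0.mul_right _)
    have d3 : (p : ℤ) ∣ hR g := dvd_sub (h2.trans (dvd_pow_self _ two_ne_zero)) (h1.mul_right _)
    refine hH ⟨?_, ?_, ?_⟩
    · rw [e1]
      exact dvd_add (dvd_add (d1.mul_right _) ((d2.mul_right _).mul_right _)) (d3.mul_right _)
    · rw [e2]
      exact dvd_add (dvd_add (((d1.mul_left 2).mul_right _).mul_right _) (d2.mul_right _))
        (((d3.mul_left 2).mul_right _).mul_right _)
    · rw [e3]
      exact dvd_add (dvd_add (d1.mul_right _) ((d2.mul_right _).mul_right _)) (d3.mul_right _)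
  have hex : ∀ f, ∃ i j k l : ℤ, f ∈ S → i * l - j * k = p ∧ (p : ℤ) • f = cubicAct g i j k l := by
    intro f
    by_cases hf : f ∈ S
    · obtain ⟨-, ⟨i, j, k, l, h⟩, -⟩ := hS f hf
      exact ⟨i, j, k, l, fun _ => h⟩
    · exact ⟨0, 0, 0, 0, fun h => absurd h hf⟩
  choose i j k l hN using hex
  set T := Finset.univ.filter fun t : ZMod p =>
      (g 0 : ZMod p) + 3 * g 1 * t + 3 * g 2 * t ^ 2 + g 3 * t ^ 3 = 0 with hT
  have himg : S.image (fun f => columnLine p (i f) (j f) (k f) (l f)) ⊆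
      insert none (T.image some) := by
    intro x hx
    obtain ⟨f, hf, rfl⟩ := Finset.mem_image.1 hx
    cases hl : columnLine p (i f) (j f) (k f) (l f) with
    | none => simp
    | some t =>
      obtain ⟨hd, hN⟩ := hN f hf
      obtain ⟨h1, h2, h3⟩ := columnLine_some hd hl
      refine Finset.mem_insert_of_mem (Finset.mem_image_of_mem _ (Finset.mem_filter.2
        ⟨Finset.mem_univ _, ?_⟩))
      have e0 := congrArg (Int.cast : ℤ → ZMod p) (congrFun hN 0)
      have e3 := congrArg (Int.cast : ℤ → ZMod p) (congrFun hN 3)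
      simp only [cubicAct, Matrix.cons_val, Pi.smul_apply, smul_eq_mul] at e0 e3
      push_cast at e0 e3
      rw [CharP.cast_eq_zero, zero_mul, h2] at e0
      rw [CharP.cast_eq_zero, zero_mul, h3] at e3
      rcases h1 with h1 | h1
      · refine (mul_eq_zero.1 (?_ : ((i f : ZMod p)) ^ 3 * _ = 0)).resolve_left (pow_ne_zero 3 h1)
        rw [e0]; ring
      · refine (mul_eq_zero.1 (?_ : ((j f : ZMod p)) ^ 3 * _ = 0)).resolve_left (pow_ne_zero 3 h1)
        rw [e3]; ring
  have hfib : ∀ x ∈ S.image (fun f => columnLine p (i f) (j f) (k f) (l f)),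
      (S.filter fun f => columnLine p (i f) (j f) (k f) (l f) = x).card ≤ 9 := by
    intro x hx
    obtain ⟨f₁, hf₁, rfl⟩ := Finset.mem_image.1 hx
    set F := S.filter fun f => columnLine p (i f) (j f) (k f) (l f) =
      columnLine p (i f₁) (j f₁) (k f₁) (l f₁) with hF
    have hex : ∀ f, ∃ x y z w : ℤ, f ∈ F → x * w - y * z = 1 ∧ f = cubicAct f₁ x y z w := by
      intro f
      by_cases hf : f ∈ F
      · obtain ⟨hfS, hl⟩ := Finset.mem_filter.1 hf
        obtain ⟨x, y, z, w, h⟩ := exists_cubicAct_of_columnLine (hN f₁ hf₁).1 (hN f hfS).1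
          (hN f₁ hf₁).2 (hN f hfS).2 hl.symm
        exact ⟨x, y, z, w, fun _ => h⟩
      · exact ⟨0, 0, 0, 0, fun h => absurd h hf⟩
    choose x y z w hM using hex
    have hred : ∀ f ∈ F, RedCubic (cubicAct f₁ (x f) (y f) (z f) (w f)) := fun f hf =>
      (hM f hf).2 ▸ (hS f (Finset.mem_filter.1 hf).1).1
    have hcard := Finset.card_le_card_of_injOn (s := F)
      (t := Finset.Icc (-1 : ℤ) 1 ×ˢ Finset.Icc (-1 : ℤ) 1) (fun f => (x f, z f))
      (fun f hf => (hS f₁ hf₁).1.column_mem (hM f hf).1 (hred f hf)) (by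
        intro f hf f' hf' he
        simp only [Prod.mk.injEq] at he
        have hd' := (hM f' hf').1
        have hr' := hred f' hf'
        rw [← he.1, ← he.2] at hd' hr'
        rw [(hM f hf).2, (hM f' hf').2, ← he.1, ← he.2]
        exact RedCubic.eq_of_column (hM f hf).1 hd' (hred f hf) hr')
    simpa using hcard
  calc S.card ≤ 9 * (S.image (fun f => columnLine p (i f) (j f) (k f) (l f))).card :=
        Finset.card_le_mul_card_image _ 9 hfib
    _ ≤ 9 * (insert none (T.image some)).card :=
        Nat.mul_le_mul_left _ (Finset.card_le_card himg)
    _ ≤ 9 * (T.card + 1) := Nat.mul_le_mul_left _ ((Finset.card_insert_le _ _).trans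
        (Nat.add_le_add_right Finset.card_image_le 1))
    _ ≤ 36 := by have := card_roots_le_three (p := p) hg; lia

end Fibers

section HessPairs

lemma exists_sum_inv_le {ε : ℝ} (hε : 0 < ε) : ∃ C : ℝ, 0 ≤ C ∧ ∀ M : ℝ, 1 ≤ M →
    ∑ n ∈ Finset.Icc 1 ⌊M⌋₊, ((n : ℝ))⁻¹ ≤ C * M ^ ε := by
  refine ⟨1 + 1 / ε, by positivity, fun M hM => ?_⟩
  have h5 := harmonic_le_one_add_log ⌊M⌋₊
  rw [harmonic_eq_sum_Icc] at h5
  push_cast at h5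
  have h6 : Real.log ⌊M⌋₊ ≤ M ^ ε / ε := by
    refine (Real.log_le_log ?_ (Nat.floor_le (by linarith))).trans
      (Real.log_le_rpow_div (by linarith) hε)
    exact_mod_cast (Nat.one_le_floor_iff _).2 hM
  have h7 : 1 ≤ M ^ ε := Real.one_le_rpow hM hε.le
  calc _ ≤ 1 + Real.log ⌊M⌋₊ := h5
    _ ≤ M ^ ε + M ^ ε / ε := by linarith
    _ = _ := by ring

/-- Reduced forms together with a squarefree divisor `q > Q` of their Hessian. -/
def hessPairs (X Q : ℝ) : Set ((Fin 4 → ℤ) × ℕ) :=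
  {x | RedCubic x.1 ∧ ((dsc x.1 : ℤ) : ℝ) < 4 * X ∧ Squarefree x.2 ∧ Q < x.2 ∧ HessDvd x.2 x.1}

/-- A finite set of parameters for the members of `hessPairs` with vanishing first coefficient. -/
noncomputable def hessBox (X Q : ℝ) : Finset (Σ _ : ℕ, ℤ × ℕ × ℤ × ℕ) :=
  (Finset.Icc 1 ⌊2 * √X⌋₊).sigma fun n : ℕ => ({(n : ℤ), -(n : ℤ)} : Finset ℤ) ×ˢ
    (n.divisors.filter Squarefree ×ˢ (Finset.Icc (-(n : ℤ)) n ×ˢ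
      Finset.Icc 1 ⌊4 * X / (3 * n ^ 2 * Q)⌋₊))

lemma hP_le_two_sqrt {f : Fin 4 → ℤ} (hf : RedCubic f) {X : ℝ} (hX : ((dsc f : ℤ) : ℝ) < 4 * X) :
    ((hP f : ℤ) : ℝ) ≤ 2 * √X := by
  have h1 : (3 : ℝ) * ((hP f : ℤ) : ℝ) ^ 2 ≤ ((dsc f : ℤ) : ℝ) := by exact_mod_cast hf.three_sq_le_dsc
  have hX0 : 0 ≤ X := by nlinarith [sq_nonneg ((hP f : ℤ) : ℝ)]
  refine abs_le_of_sq_le_sq' ?_ (by positivity) |>.2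
  rw [mul_pow, Real.sq_sqrt hX0]
  nlinarith [sq_nonneg ((hP f : ℤ) : ℝ)]

lemma RedCubic.three_hP_mul_hR_le {f : Fin 4 → ℤ} (hf : RedCubic f) :
    3 * hP f * hR f ≤ dsc f := by
  obtain ⟨h0, h1, h2, h3, -⟩ := hf
  have : hQ f ^ 2 ≤ hP f ^ 2 := sq_le_sq' h1.le h2
  unfold dsc
  nlinarith

lemma ncard_hessPairs_zero_le_box {X Q : ℝ} (hQ0 : 0 < Q) :
    {x ∈ hessPairs X Q | x.1 0 = 0}.Finite ∧
      {x ∈ hessPairs X Q | x.1 0 = 0}.ncard ≤ (hessBox X Q).card := by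
  set φ : (Fin 4 → ℤ) × ℕ → Σ _ : ℕ, ℤ × ℕ × ℤ × ℕ := fun x =>
    ⟨(x.1 1).natAbs, x.1 1, x.2, x.1 2, (hR x.1 / x.2).toNat⟩ with hφ
  have key : ∀ x ∈ {x ∈ hessPairs X Q | x.1 0 = 0}, hP x.1 = x.1 1 ^ 2 ∧ x.1 1 ≠ 0 ∧
      hQ x.1 = x.1 1 * x.1 2 ∧ |x.1 2| ≤ |x.1 1| ∧ hR x.1 = x.2 * ((hR x.1 / x.2).toNat : ℤ) ∧
      0 < (hR x.1 / x.2).toNat := by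
    rintro ⟨f, q⟩ ⟨⟨hf, hd, hq, hQq, h1, h2, h3⟩, h0⟩
    dsimp only at *
    have eP : hP f = f 1 ^ 2 := by rw [hP, h0]; ring
    have eQ : hQ f = f 1 * f 2 := by rw [hQ, h0]; ring
    have hb : f 1 ≠ 0 := by
      intro h
      have := hf.1
      rw [eP, h] at this
      simp at this
    have hR0 : 0 < hR f := hf.1.trans_le hf.2.2.2.1
    have hq0 : (0 : ℤ) < q := by exact_mod_cast hq.ne_zero.bot_lt
    obtain ⟨r, hr⟩ := h3
    have hr0 : 0 < r := by
      rw [hr] at hR0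
      exact pos_of_mul_pos_right hR0 hq0.le
    have e : (hR f / q).toNat = r.toNat := by rw [hr, Int.mul_ediv_cancel_left _ hq0.ne']
    refine ⟨eP, hb, eQ, ?_, ?_, ?_⟩
    · have : |hQ f| ≤ hP f := abs_le.2 ⟨hf.2.1.le, hf.2.2.1⟩
      rw [eQ, eP, abs_mul, ← sq_abs, sq] at this
      exact le_of_mul_le_mul_left this (abs_pos.2 hb)
    · rw [e, Int.toNat_of_nonneg hr0.le, hr]
    · rw [e]; lia
  have hmaps : Set.MapsTo φ {x ∈ hessPairs X Q | x.1 0 = 0} (hessBox X Q) := by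
    rintro ⟨f, q⟩ hx
    obtain ⟨eP, hb, eQ, hc, hRr, hr0⟩ := key _ hx
    obtain ⟨⟨hf, hd, hq, hQq, h1, h2, h3⟩, h0⟩ := hx
    dsimp only at *
    set r := (hR f / q).toNat with hr
    have hn0 : (f 1).natAbs ≠ 0 := by simpa using hb
    have hPle := hP_le_two_sqrt hf hd
    have hcn : -((f 1).natAbs : ℤ) ≤ f 2 ∧ f 2 ≤ ((f 1).natAbs : ℤ) := by
      rwa [← abs_le, Int.natCast_natAbs]
    simp only [hφ, hessBox, Finset.coe_sigma, Set.mem_sigma_iff, Finset.mem_coe, Finset.mem_product,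
      Finset.mem_Icc, Finset.mem_filter, Nat.mem_divisors, Finset.mem_insert, Finset.mem_singleton]
    refine ⟨⟨by lia, Nat.le_floor ?_⟩, by lia, ⟨⟨?_, hn0⟩, hq⟩, hcn, hr0, Nat.le_floor ?_⟩
    · refine le_trans ?_ hPle
      rw [eP]
      have h4 : (f 1).natAbs ≤ (f 1).natAbs ^ 2 := Nat.le_self_pow two_ne_zero _
      have h5 : f 1 ^ 2 = (((f 1).natAbs ^ 2 : ℕ) : ℤ) := by rw [Nat.cast_pow, Int.natAbs_sq]
      rw [h5, Int.cast_natCast]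
      exact Nat.cast_le.2 h4
    · have h4 : (q : ℤ) ∣ f 1 ^ 2 := eP ▸ h1
      have h5 : q ∣ (f 1).natAbs ^ 2 := by
        rw [← Int.natAbs_pow]
        exact Int.natCast_dvd.1 h4
      exact (Squarefree.dvd_pow_iff_dvd hq two_ne_zero).1 h5
    · have hn : (0 : ℝ) < (f 1).natAbs := by exact_mod_cast hn0.bot_lt
      rw [le_div_iff₀ (by positivity)]
      have h6 : (3 : ℝ) * ((hP f : ℤ) : ℝ) * ((hR f : ℤ) : ℝ) ≤ ((dsc f : ℤ) : ℝ) := by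
        exact_mod_cast hf.three_hP_mul_hR_le
      have h7 : ((hP f : ℤ) : ℝ) = ((f 1).natAbs : ℝ) ^ 2 := by
        rw [eP, ← Int.natAbs_sq, ← Nat.cast_pow, Int.cast_natCast, Nat.cast_pow]
      have h8 : ((hR f : ℤ) : ℝ) = q * r := by exact_mod_cast hRr
      rw [h7, h8] at h6
      have h9 : (r : ℝ) * (3 * ((f 1).natAbs : ℝ) ^ 2 * Q) ≤ r * (3 * ((f 1).natAbs : ℝ) ^ 2 * q) := by
        gcongr
      linarith
  have hinj : Set.InjOn φ {x ∈ hessPairs X Q | x.1 0 = 0} := by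
    rintro ⟨f, q⟩ hx ⟨f', q'⟩ hx' he
    obtain ⟨eP, hb, eQ, hc, hRr, hr0⟩ := key _ hx
    obtain ⟨eP', hb', eQ', hc', hRr', hr0'⟩ := key _ hx'
    obtain ⟨⟨hf, -⟩, h0⟩ := hx
    obtain ⟨-, h0'⟩ := hx'
    simp only [hφ, Sigma.mk.injEq, heq_eq_eq, Prod.mk.injEq] at he
    obtain ⟨-, e1, e2, e3, e4⟩ := he
    dsimp only at *
    have : f = f' := by
      refine cubic_ext hf.1.ne' (by rw [eP, eP', e1]) (by rw [eQ, eQ', e1, e3]) ?_ (by rw [h0, h0']) e1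
      rw [hRr, hRr', e4, e2]
    rw [this, e2]
  refine ⟨Set.Finite.of_finite_image ((Finset.finite_toSet _).subset hmaps.image_subset) hinj, ?_⟩
  have := Set.ncard_le_ncard_of_injOn φ hmaps hinj (Finset.finite_toSet _)
  rwa [Set.ncard_coe_finset] at this

lemma card_hessBox_le {ε : ℝ} (hε : 0 < ε) : ∃ C : ℝ, 0 ≤ C ∧ ∀ X Q : ℝ, 1 ≤ 2 * √X → 0 < Q →
    ((hessBox X Q).card : ℝ) ≤ C * (2 * √X) ^ ε * (2 * √X * √X / Q) := by
  obtain ⟨B, hB1, hB⟩ := exists_pow_card_primeFactors_le (K := 2) (ε := ε / 2) (by norm_num)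
    (by positivity)
  obtain ⟨C, hC0, hC⟩ := exists_sum_inv_le (ε := ε / 2) (by positivity)
  refine ⟨4 * B * C, by positivity, fun X Q hX hQ => ?_⟩
  have hX0 : 0 ≤ X := by
    by_contra! h
    rw [Real.sqrt_eq_zero_of_nonpos h.le] at hX
    norm_num at hX
  set M := 2 * √X with hM
  have hM2 : 4 * X = 2 * (M * √X) := by
    rw [hM]; nlinarith [Real.mul_self_sqrt hX0]
  rw [hessBox, Finset.card_sigma]
  push_cast
  have hterm : ∀ n ∈ Finset.Icc 1 ⌊M⌋₊,
      (((({(n : ℤ), -(n : ℤ)} : Finset ℤ) ×ˢ (n.divisors.filter Squarefree ×ˢ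
      (Finset.Icc (-(n : ℤ)) n ×ˢ Finset.Icc 1 ⌊4 * X / (3 * n ^ 2 * Q)⌋₊))).card : ℕ) : ℝ) ≤
      4 * B * M ^ (ε / 2) * (M * √X / Q) * (n : ℝ)⁻¹ := by
    intro n hn
    obtain ⟨hn1, hnM⟩ := Finset.mem_Icc.1 hn
    have hn0 : n ≠ 0 := by lia
    have hnM' : (n : ℝ) ≤ M := (Nat.le_floor_iff (by linarith)).1 hnM
    have hn1' : (1 : ℝ) ≤ n := by exact_mod_cast hn1
    simp only [Finset.card_product]
    rw [card_squarefree_divisors n hn0, Int.card_Icc, Nat.card_Icc]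
    have c1 : ((({(n : ℤ), -(n : ℤ)} : Finset ℤ).card : ℕ) : ℝ) ≤ 2 := by
      exact_mod_cast Finset.card_le_two
    have c2 : ((2 : ℝ)) ^ n.primeFactors.card ≤ B * M ^ (ε / 2) := by
      refine (hB n hn0).trans ?_
      gcongr
    have c3 : ((((n : ℤ) + 1 - -(n : ℤ)).toNat : ℕ) : ℝ) ≤ 3 * n := by
      have : ((n : ℤ) + 1 - -(n : ℤ)).toNat ≤ 3 * n := by lia
      exact_mod_cast this
    have c4 : ((⌊4 * X / (3 * n ^ 2 * Q)⌋₊ + 1 - 1 : ℕ) : ℝ) ≤ 2 * (M * √X) / (3 * n ^ 2 * Q) := by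
      rw [Nat.add_sub_cancel, ← hM2]
      exact Nat.floor_le (by positivity)
    push_cast
    push_cast at c4
    calc _ ≤ 2 * (B * M ^ (ε / 2) * (3 * n * (2 * (M * √X) / (3 * n ^ 2 * Q)))) := by
          gcongr
      _ = _ := by field_simp; ring
  refine (Finset.sum_le_sum hterm).trans ?_
  rw [← Finset.mul_sum]
  have hMM : M ^ ε = M ^ (ε / 2) * M ^ (ε / 2) := by
    rw [← Real.rpow_add (by linarith)]; ring_nf
  calc _ ≤ 4 * B * M ^ (ε / 2) * (M * √X / Q) * (C * M ^ (ε / 2)) := by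
        gcongr
        exact hC M hX
    _ = _ := by rw [hMM]; ring

lemma hessPairs_subset {X Q : ℝ} : hessPairs X Q ⊆ {x ∈ hessPairs X Q | x.1 0 = 0} ∪
    (contentPairs X (2 * √X) Q ∪ (fun x => (-x.1, x.2)) '' contentPairs X (2 * √X) Q) := by
  rintro ⟨f, q⟩ ⟨hf, hd, hq, hQq, h1, h2, h3⟩
  rcases lt_trichotomy (f 0) 0 with h | h | h
  · refine Or.inr (Or.inr ⟨(-f, q), ⟨hf.neg, by simpa using h, by rwa [dsc_neg], ?_, hq, hQq, ?_, ?_⟩,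
      by simp⟩)
    · rw [hP_neg]; exact hP_le_two_sqrt hf hd
    · rwa [hP_neg]
    · rwa [hQ_neg]
  · exact Or.inl ⟨⟨hf, hd, hq, hQq, h1, h2, h3⟩, h⟩
  · exact Or.inr (Or.inl ⟨hf, h, hd, hP_le_two_sqrt hf hd, hq, hQq, h1, h2⟩)

lemma hessPairs_finite {X Q : ℝ} (hQ : 0 < Q) : (hessPairs X Q).Finite :=
  ((ncard_hessPairs_zero_le_box hQ).1.union ((contentPairs_finite _ _ _).union
    ((contentPairs_finite _ _ _).image _))).subset hessPairs_subset

lemma ncard_hessPairs_le {ε : ℝ} (hε : 0 < ε) : ∃ C : ℝ, 0 ≤ C ∧ ∀ X Q : ℝ, 1 ≤ 2 * √X → 0 < Q →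
    ((hessPairs X Q).ncard : ℝ) ≤ C * (2 * √X) ^ ε * (2 * √X * √X / Q + 2 * √X * √(2 * √X)) := by
  obtain ⟨C1, hC1, h1⟩ := card_hessBox_le hε
  obtain ⟨C2, hC2, h2⟩ := ncard_contentPairs_le hε
  refine ⟨C1 + 2 * C2, by positivity, fun X Q hX hQ => ?_⟩
  have hX0 : 0 ≤ X := by
    by_contra! h
    rw [Real.sqrt_eq_zero_of_nonpos h.le] at hX
    norm_num at hX
  have e1 := (Set.ncard_le_ncard hessPairs_subset
    ((ncard_hessPairs_zero_le_box hQ).1.union ((contentPairs_finite X (2 * √X) Q).union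
    ((contentPairs_finite _ _ _).image _)))).trans (Set.ncard_union_le _ _)
  have e2 := Set.ncard_union_le (contentPairs X (2 * √X) Q)
    ((fun x => (-x.1, x.2)) '' contentPairs X (2 * √X) Q)
  have e3 := Set.ncard_image_le (f := fun x : (Fin 4 → ℤ) × ℕ => (-x.1, x.2))
    (contentPairs_finite X (2 * √X) Q)
  have e4 := (ncard_hessPairs_zero_le_box (X := X) hQ).2
  have e5 : ((hessPairs X Q).ncard : ℝ) ≤ (hessBox X Q).card + 2 * (contentPairs X (2 * √X) Q).ncard := by
    have : (hessPairs X Q).ncard ≤ (hessBox X Q).card + 2 * (contentPairs X (2 * √X) Q).ncard := by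
      lia
    exact_mod_cast this
  have e6 : C1 * (2 * √X) ^ ε * (2 * √X * √X / Q) ≤
      C1 * (2 * √X) ^ ε * (2 * √X * √X / Q + 2 * √X * √(2 * √X)) := by
    gcongr
    linarith [show 0 ≤ 2 * √X * √(2 * √X) by positivity]
  linarith [h1 X Q hX hQ, h2 X (2 * √X) Q hX0 hX hQ]

end HessPairs

section DescentSum

/-- Reduced forms whose Hessian is divisible by `q₁` and whose discriminant is divisible by
`q₂ ^ 2`. -/
def descentForms (X : ℝ) (q₁ q₂ : ℕ) : Set (Fin 4 → ℤ) :=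
  {f | RedCubic f ∧ ((dsc f : ℤ) : ℝ) < 4 * X ∧ HessDvd q₁ f ∧ (q₂ : ℤ) ^ 2 ∣ dsc f}

lemma descentForms_finite (X : ℝ) (q₁ q₂ : ℕ) : (descentForms X q₁ q₂).Finite := by
  refine ((hessPairs_finite (X := X) (Q := 1 / 2) (by norm_num)).preimage
    (f := fun f : Fin 4 → ℤ => (f, 1)) fun f _ g _ h => (Prod.mk.inj h).1).subset ?_
  rintro f ⟨h1, h2, -⟩
  exact ⟨h1, h2, squarefree_one, by norm_num, by simp, by simp, by simp⟩

lemma RedCubic.dsc_pos {f : Fin 4 → ℤ} (h : RedCubic f) : 0 < dsc f := by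
  have h1 := h.three_sq_le_dsc
  have h0 := h.1
  nlinarith

lemma ncard_descentForms_mul_le {X : ℝ} {p q₁ : ℕ} (q₂ : ℕ) (hp : p.Prime) (hp2 : p ≠ 2)
    (hq : p.Coprime q₁) : (descentForms X q₁ (p * q₂)).ncard ≤
      (descentForms X (p * q₁) q₂).ncard + 36 * (descentForms (X / (p : ℝ) ^ 2) q₁ q₂).ncard := by
  have : Fact p.Prime := ⟨hp⟩
  have hp' : Prime (p : ℤ) := Nat.prime_iff_prime_int.1 hp
  have hp20 : (0 : ℤ) < (p : ℤ) ^ 2 := by have := hp'.ne_zero; positivity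
  have hc2 : IsCoprime (p : ℤ) 2 :=
    (Nat.isCoprime_iff_coprime (n := 2)).2 ((Nat.coprime_primes hp Nat.prime_two).2 hp2)
  have hcq : IsCoprime (p : ℤ) q₁ := Nat.isCoprime_iff_coprime.2 hq
  set B : Set (Fin 4 → ℤ) := {f ∈ descentForms X q₁ (p * q₂) | ¬ HessDvd p f} with hB
  have hBfin : B.Finite := (descentForms_finite X q₁ (p * q₂)).subset fun f hf => hf.1
  have hsub : descentForms X q₁ (p * q₂) ⊆ descentForms X (p * q₁) q₂ ∪ B := by
    intro f hf
    by_cases h : HessDvd p f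
    · obtain ⟨h1, h2, ⟨d1, d2, d3⟩, h4⟩ := hf
      refine Or.inl ⟨h1, h2, ?_, ?_⟩
      · push_cast
        exact ⟨hcq.mul_dvd h.1 d1, hcq.mul_dvd h.2.1 d2, hcq.mul_dvd h.2.2 d3⟩
      · push_cast at h4
        rw [mul_pow] at h4
        exact (dvd_mul_left _ _).trans h4
    · exact Or.inr ⟨hf, h⟩
  have hdvd : ∀ f ∈ B, (p : ℤ) ^ 2 ∣ dsc f := by
    rintro f ⟨⟨-, -, -, h4⟩, -⟩
    push_cast at h4
    rw [mul_pow] at h4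
    exact (dvd_mul_right _ _).trans h4
  have hex : ∀ f, ∃ g, f ∈ B → RedCubic g ∧ Descends p f g := by
    intro f
    by_cases hf : f ∈ B
    · obtain ⟨g, hg⟩ := exists_redCubic_descends hp' hc2 hf.1.1.1 hf.1.1.dsc_pos (hdvd f hf) hf.2
      exact ⟨g, fun _ => hg⟩
    · exact ⟨0, fun h => absurd h hf⟩
  choose D hD using hex
  have himg : hBfin.toFinset.image D ⊆ (descentForms_finite (X / (p : ℝ) ^ 2) q₁ q₂).toFinset := by
    intro g hg
    obtain ⟨f, hf, rfl⟩ := Finset.mem_image.1 hg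
    rw [Set.Finite.mem_toFinset] at hf ⊢
    obtain ⟨hr, hd⟩ := hD f hf
    have hdsc := hd.dsc_eq hp'.ne_zero
    obtain ⟨⟨h1, h2, h3, h4⟩, h5⟩ := hf
    refine ⟨hr, ?_, hd.hessDvd hp'.ne_zero hcq.symm h3, ?_⟩
    · have hpos : (0 : ℝ) < (p : ℝ) ^ 2 := by exact_mod_cast hp20
      rw [← mul_div_assoc, lt_div_iff₀ hpos]
      rw [hdsc] at h2
      push_cast at h2
      linarith
    · push_cast at h4
      rw [hdsc, mul_pow] at h4
      exact Int.dvd_of_mul_dvd_mul_left hp20.ne' h4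
  have hBcard : B.ncard ≤ 36 * (descentForms (X / (p : ℝ) ^ 2) q₁ q₂).ncard := by
    rw [Set.ncard_eq_toFinset_card _ hBfin,
      Set.ncard_eq_toFinset_card _ (descentForms_finite (X / (p : ℝ) ^ 2) q₁ q₂)]
    refine (Finset.card_le_mul_card_image (f := D) _ 36 fun g _ => ?_).trans
      (Nat.mul_le_mul_left _ (Finset.card_le_card himg))
    refine card_redCubic_descends_le (g := g) (p := p) _ fun f hf => ?_
    obtain ⟨hfB, hDf⟩ := Finset.mem_filter.1 hf
    rw [Set.Finite.mem_toFinset] at hfB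
    exact ⟨hfB.1.1, hDf ▸ (hD f hfB).2, hfB.2⟩
  calc _ ≤ (descentForms X (p * q₁) q₂ ∪ B).ncard :=
        Set.ncard_le_ncard hsub ((descentForms_finite _ _ _).union hBfin)
    _ ≤ _ := (Set.ncard_union_le _ _).trans (Nat.add_le_add_left hBcard _)

lemma ncard_descentForms_prod_le (s : Finset ℕ) (hs : ∀ p ∈ s, p.Prime ∧ p ≠ 2) (X : ℝ) (q₁ : ℕ)
    (hq : ∀ p ∈ s, p.Coprime q₁) : (descentForms X q₁ (∏ p ∈ s, p)).ncard ≤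
      ∑ t ∈ s.powerset, 36 ^ t.card *
        (descentForms (X / ((∏ p ∈ t, p : ℕ) : ℝ) ^ 2) ((∏ p ∈ s \ t, p) * q₁) 1).ncard := by
  induction s using Finset.induction_on generalizing X q₁ with
  | empty => simp
  | insert a s ha ih =>
    have hs' : ∀ p ∈ s, p.Prime ∧ p ≠ 2 := fun p hp => hs p (Finset.mem_insert_of_mem hp)
    obtain ⟨hap, ha2⟩ := hs a (Finset.mem_insert_self _ _)
    have hcop : ∀ p ∈ s, p.Coprime (a * q₁) := fun p hp =>
      Nat.Coprime.mul_right ((Nat.coprime_primes (hs' p hp).1 hap).2 fun h => ha (h ▸ hp))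
        (hq p (Finset.mem_insert_of_mem hp))
    rw [Finset.prod_insert ha, Finset.sum_powerset_insert ha]
    refine (ncard_descentForms_mul_le _ hap ha2 (hq a (Finset.mem_insert_self _ _))).trans
      (add_le_add ((ih hs' X (a * q₁) hcop).trans (le_of_eq ?_))
      ((Nat.mul_le_mul_left 36 (ih hs' (X / (a : ℝ) ^ 2) q₁
        fun p hp => hq p (Finset.mem_insert_of_mem hp))).trans (le_of_eq ?_)))
    · refine Finset.sum_congr rfl fun t ht => ?_
      have hat : a ∉ t := fun h => ha (Finset.mem_powerset.1 ht h)
      rw [Finset.insert_sdiff_of_notMem _ hat, Finset.prod_insert (by simp [ha])]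
      congr 3
      ring
    · rw [Finset.mul_sum]
      refine Finset.sum_congr rfl fun t ht => ?_
      have hat : a ∉ t := fun h => ha (Finset.mem_powerset.1 ht h)
      rw [Finset.card_insert_of_notMem hat, Finset.insert_sdiff_insert,
        Finset.sdiff_insert_of_notMem ha, Finset.prod_insert hat, Nat.cast_mul, mul_pow, ← div_div,
        pow_succ]
      ring

lemma Set.Finite.ncard_eq_sum_fiber {α β : Type*} {S : Set (α × β)} (hS : S.Finite) {T : Finset β}
    (h : ∀ x ∈ S, x.2 ∈ T) : S.ncard = ∑ q ∈ T, {a | (a, q) ∈ S}.ncard := by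
  rw [Set.ncard_eq_toFinset_card _ hS,
    Finset.card_eq_sum_card_fiberwise (f := Prod.snd) (t := T) fun x hx => h x (by simpa using hx)]
  refine Finset.sum_congr rfl fun q _ => ?_
  rw [← Set.ncard_coe_finset]
  refine Set.ncard_congr (fun x _ => x.1) ?_ ?_ ?_
  · rintro ⟨a, b⟩ hx
    simp only [Finset.coe_filter, Set.Finite.mem_toFinset, Set.mem_ofPred_eq] at hx ⊢
    obtain ⟨hx, rfl⟩ := hx
    exact hx
  · rintro ⟨a, b⟩ ⟨a', b'⟩ hx hx' he
    simp only [Finset.coe_filter, Set.Finite.mem_toFinset, Set.mem_ofPred_eq] at hx hx' he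
    rw [he, hx.2, hx'.2]
  · intro a ha
    exact ⟨(a, q), by simpa using ha, rfl⟩

lemma Set.Finite.sum_fiber_le_ncard {α β : Type*} {S : Set (α × β)} (hS : S.Finite)
    (T : Finset β) : ∑ q ∈ T, {a | (a, q) ∈ S}.ncard ≤ S.ncard := by
  have hS' : {x ∈ S | x.2 ∈ T}.Finite := hS.subset fun x hx => hx.1
  refine le_trans (le_of_eq ?_) (Set.ncard_le_ncard (fun x hx => hx.1 : {x ∈ S | x.2 ∈ T} ⊆ S) hS)
  rw [hS'.ncard_eq_sum_fiber (T := T) fun x hx => hx.2]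
  refine Finset.sum_congr rfl fun q hq => ?_
  congr 1
  ext a
  simp [hq]

/-- Reduced forms together with an odd squarefree `q > Q` whose square divides the discriminant. -/
def tailPairs (X Q : ℝ) : Set ((Fin 4 → ℤ) × ℕ) :=
  {x | RedCubic x.1 ∧ ((dsc x.1 : ℤ) : ℝ) < 4 * X ∧ Squarefree x.2 ∧ Odd x.2 ∧ Q < x.2 ∧
    (x.2 : ℤ) ^ 2 ∣ dsc x.1}

lemma le_two_sqrt_of_sq_dvd {f : Fin 4 → ℤ} {X : ℝ} {q : ℕ} (hf : RedCubic f)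
    (hd : ((dsc f : ℤ) : ℝ) < 4 * X) (hq : (q : ℤ) ^ 2 ∣ dsc f) : q ≤ ⌊2 * √X⌋₊ := by
  have h1 : (q : ℝ) ^ 2 ≤ ((dsc f : ℤ) : ℝ) := by exact_mod_cast Int.le_of_dvd hf.dsc_pos hq
  have hX0 : 0 ≤ X := by nlinarith [sq_nonneg (q : ℝ)]
  refine Nat.le_floor (abs_le_of_sq_le_sq' (b := 2 * √X) ?_ (by positivity) |>.2)
  rw [mul_pow, Real.sq_sqrt hX0]
  linarith

lemma tailPairs_finite (X Q : ℝ) : (tailPairs X Q).Finite := by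
  refine ((descentForms_finite X 1 1).prod (Finset.finite_toSet (Finset.Iic ⌊2 * √X⌋₊))).subset ?_
  rintro ⟨f, q⟩ ⟨hf, hd, -, -, -, h⟩
  refine ⟨⟨hf, hd, by simp [HessDvd], by simp⟩, ?_⟩
  simpa using le_two_sqrt_of_sq_dvd hf hd h

lemma ncard_tailPairs_le_sum {X Q : ℝ} (hQ : 0 < Q) : (tailPairs X Q).ncard ≤
    ∑ e ∈ Finset.Icc 1 ⌊2 * √X⌋₊, 36 ^ e.primeFactors.card *
      (hessPairs (X / (e : ℝ) ^ 2) (Q / e)).ncard := by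
  set N := ⌊2 * √X⌋₊ with hN
  set T := (Finset.Icc 1 N).filter fun q : ℕ => Squarefree q ∧ Odd q ∧ Q < q with hT
  have h1 : (tailPairs X Q).ncard = ∑ q ∈ T, {f | (f, q) ∈ tailPairs X Q}.ncard := by
    refine (tailPairs_finite X Q).ncard_eq_sum_fiber ?_
    rintro ⟨f, q⟩ ⟨hf, hd, hs, ho, hQq, h⟩
    exact Finset.mem_filter.2 ⟨Finset.mem_Icc.2 ⟨hs.ne_zero.bot_lt, le_two_sqrt_of_sq_dvd hf hd h⟩,
      hs, ho, hQq⟩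
  have h2 : ∀ q ∈ T, {f | (f, q) ∈ tailPairs X Q}.ncard ≤ ∑ t ∈ q.primeFactors.powerset,
      36 ^ t.card * (descentForms (X / ((∏ p ∈ t, p : ℕ) : ℝ) ^ 2)
        (∏ p ∈ q.primeFactors \ t, p) 1).ncard := by
    intro q hq
    obtain ⟨-, hs, ho, -⟩ := Finset.mem_filter.1 hq
    have := ncard_descentForms_prod_le q.primeFactors (fun p hp =>
      ⟨Nat.prime_of_mem_primeFactors hp, fun h => by
        have := Nat.dvd_of_mem_primeFactors hp
        rw [h] at this
        exact (Nat.not_even_iff_odd.2 ho) (even_iff_two_dvd.2 this)⟩) X 1 (by simp)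
    simp only [mul_one] at this
    refine le_trans (Set.ncard_le_ncard ?_ (descentForms_finite _ _ _)) this
    rintro f ⟨hf, hd, -, -, -, h⟩
    refine ⟨hf, hd, by simp [HessDvd], ?_⟩
    rwa [Nat.prod_primeFactors_of_squarefree hs]
  set F : (Σ _ : ℕ, ℕ) → ℕ := fun y =>
    36 ^ y.1.primeFactors.card * (descentForms (X / (y.1 : ℝ) ^ 2) y.2 1).ncard with hF
  set φ : (Σ _ : ℕ, Finset ℕ) → (Σ _ : ℕ, ℕ) := fun x =>
    ⟨∏ p ∈ x.2, p, ∏ p ∈ x.1.primeFactors \ x.2, p⟩ with hφ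
  set S := T.sigma fun q : ℕ => q.primeFactors.powerset with hS
  have hpf : ∀ x ∈ S, (∏ p ∈ x.2, p).primeFactors = x.2 ∧
      (∏ p ∈ x.2, p) * (∏ p ∈ x.1.primeFactors \ x.2, p) = x.1 := by
    rintro ⟨q, t⟩ hx
    obtain ⟨hq, ht⟩ := Finset.mem_sigma.1 hx
    obtain ⟨-, hs, -⟩ := Finset.mem_filter.1 hq
    rw [Finset.mem_powerset] at ht
    refine ⟨Nat.primeFactors_prod fun p hp => Nat.prime_of_mem_primeFactors (ht hp), ?_⟩
    dsimp only at *
    rw [mul_comm, Finset.prod_sdiff ht, Nat.prod_primeFactors_of_squarefree hs]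
  have h3 : (tailPairs X Q).ncard ≤ ∑ x ∈ S, F (φ x) := by
    rw [h1, hS, Finset.sum_sigma]
    refine Finset.sum_le_sum fun q hq => (h2 q hq).trans (le_of_eq ?_)
    refine Finset.sum_congr rfl fun t ht => ?_
    have := (hpf ⟨q, t⟩ (Finset.mem_sigma.2 ⟨hq, ht⟩)).1
    simp only [hF, hφ]
    rw [this]
  have hinj : Set.InjOn φ S := by
    rintro ⟨q, t⟩ hx ⟨q', t'⟩ hx' he
    simp only [hφ, Sigma.mk.injEq, heq_eq_eq] at he
    obtain ⟨a1, a2⟩ := hpf _ hx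
    obtain ⟨b1, b2⟩ := hpf _ hx'
    dsimp only at *
    have e1 : t = t' := by rw [← a1, ← b1, he.1]
    have e2 : q = q' := by rw [← a2, ← b2, he.1, he.2]
    rw [e1, e2]
  have h4 : ∑ x ∈ S, F (φ x) ≤ ∑ y ∈ (Finset.Icc 1 N).sigma fun e : ℕ =>
      (Finset.Icc 1 N).filter fun q : ℕ => Squarefree q ∧ Q / e < q, F y := by
    rw [← Finset.sum_image hinj]
    refine Finset.sum_le_sum_of_subset fun y hy => ?_
    obtain ⟨⟨q, t⟩, hx, rfl⟩ := Finset.mem_image.1 hy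
    obtain ⟨-, a2⟩ := hpf _ hx
    obtain ⟨hq, -⟩ := Finset.mem_sigma.1 hx
    obtain ⟨hqN, hs, -, hQq⟩ := Finset.mem_filter.1 hq
    obtain ⟨hq1, hqN⟩ := Finset.mem_Icc.1 hqN
    simp only [hφ, Finset.mem_sigma, Finset.mem_filter, Finset.mem_Icc]
    dsimp only at *
    generalize (∏ p ∈ t, p) = e at *
    generalize (∏ p ∈ q.primeFactors \ t, p) = r at *
    subst a2
    have he0 : 0 < e := Nat.pos_of_ne_zero fun h => by simp [h] at hq1
    have hr0 : 0 < r := Nat.pos_of_ne_zero fun h => by simp [h] at hq1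
    refine ⟨⟨he0, (Nat.le_mul_of_pos_right _ hr0).trans hqN⟩,
      ⟨hr0, (Nat.le_mul_of_pos_left _ he0).trans hqN⟩, hs.of_mul_right, ?_⟩
    rw [div_lt_iff₀ (by exact_mod_cast he0)]
    push_cast at hQq
    linarith
  refine (h3.trans h4).trans ?_
  rw [Finset.sum_sigma]
  refine Finset.sum_le_sum fun e he => ?_
  simp only [hF]
  rw [← Finset.mul_sum]
  refine Nat.mul_le_mul_left _ ?_
  have he0 : (0 : ℝ) < e := by exact_mod_cast (Finset.mem_Icc.1 he).1
  refine le_trans (Finset.sum_le_sum fun q hq => ?_)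
    ((hessPairs_finite (X := X / (e : ℝ) ^ 2) (Q := Q / e) (by positivity)).sum_fiber_le_ncard _)
  obtain ⟨-, hs, hQq⟩ := Finset.mem_filter.1 hq
  refine Set.ncard_le_ncard ?_ ?_
  · rintro f ⟨h1, h2, h3, -⟩
    exact ⟨h1, h2, hs, hQq, h3⟩
  · exact (hessPairs_finite (by positivity)).preimage fun f _ g _ h => (Prod.mk.inj h).1

end DescentSum

section TailBound

theorem ncard_tailPairs_le {ε : ℝ} (hε : 0 < ε) : ∃ C : ℝ, 0 ≤ C ∧ ∀ X Q : ℝ, 1 ≤ X → 0 < Q →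
    Q ^ 2 ≤ √X → ((tailPairs X Q).ncard : ℝ) ≤ C * X ^ ε * (X / Q) := by
  obtain ⟨B, hB1, hB⟩ := exists_pow_card_primeFactors_le (K := 36) (ε := ε / 3) (by norm_num)
    (by positivity)
  obtain ⟨C, hC0, hC⟩ := exists_sum_inv_le (ε := ε / 3) (by positivity)
  obtain ⟨H, hH0, hH⟩ := ncard_hessPairs_le (ε := ε / 3) (by positivity)
  refine ⟨6 * B * H * C * 2 ^ ε, by positivity, fun X Q hX hQ hQX => ?_⟩
  set M := 2 * √X with hM
  have hs1 : 1 ≤ √X := Real.one_le_sqrt.2 hX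
  have hss : √X * √X = X := Real.mul_self_sqrt (by linarith)
  have hM1 : 1 ≤ M := by linarith
  have hQM : √M * Q ≤ 2 * √X := by
    refine abs_le_of_sq_le_sq' (b := 2 * √X) ?_ (by positivity) |>.2
    rw [mul_pow, Real.sq_sqrt (by linarith), mul_pow, sq √X]
    have := mul_le_mul_of_nonneg_left hQX (show 0 ≤ M by linarith)
    rw [hM] at this ⊢
    linarith
  have hterm : ∀ e ∈ Finset.Icc 1 ⌊M⌋₊, ((36 ^ e.primeFactors.card *
      (hessPairs (X / (e : ℝ) ^ 2) (Q / e)).ncard : ℕ) : ℝ) ≤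
      6 * B * H * M ^ (ε / 3) * M ^ (ε / 3) * (X / Q) * (e : ℝ)⁻¹ := by
    intro e he
    obtain ⟨he1, heM⟩ := Finset.mem_Icc.1 he
    have he0 : e ≠ 0 := by lia
    have he1' : (1 : ℝ) ≤ e := by exact_mod_cast he1
    have he0' : (0 : ℝ) < e := by linarith
    have heM' : (e : ℝ) ≤ M := (Nat.le_floor_iff (by linarith)).1 heM
    have hsq : √(X / (e : ℝ) ^ 2) = √X / e := by
      rw [Real.sqrt_div (by linarith), Real.sqrt_sq he0'.le]
    have hMe : 2 * (√X / e) = M / e := by rw [hM]; ring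
    have hMeM : M / e ≤ M := div_le_self (by linarith) he1'
    have h1 := hH (X / (e : ℝ) ^ 2) (Q / e) (by rw [hsq, hMe, le_div_iff₀ he0']; linarith)
      (by positivity)
    rw [hsq, hMe] at h1
    have h2 : M / e * (√X / e) / (Q / e) + M / e * √(M / e) ≤ 6 * ((X / Q) * (e : ℝ)⁻¹) := by
      have a1 : M / e * (√X / e) / (Q / e) = 2 * ((X / Q) * (e : ℝ)⁻¹) := by
        rw [show X / Q = √X * √X / Q by rw [hss], hM]; field_simp
      have a2 : M / e * √(M / e) ≤ 4 * ((X / Q) * (e : ℝ)⁻¹) := by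
        calc M / e * √(M / e) ≤ M / e * √M := by gcongr
          _ = M * (√M * Q) / (Q * e) := by field_simp
          _ ≤ M * (2 * √X) / (Q * e) := by gcongr
          _ = _ := by rw [show X / Q = √X * √X / Q by rw [hss], hM]; field_simp; ring
      linarith
    have h3 : (36 : ℝ) ^ e.primeFactors.card ≤ B * M ^ (ε / 3) := by
      refine (hB e he0).trans ?_
      gcongr
    push_cast
    calc _ ≤ B * M ^ (ε / 3) * (H * M ^ (ε / 3) * (6 * ((X / Q) * (e : ℝ)⁻¹))) := by
          refine mul_le_mul h3 (h1.trans ?_) (by positivity) (by positivity)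
          gcongr
      _ = _ := by ring
  have h0 : ((tailPairs X Q).ncard : ℝ) ≤ ∑ e ∈ Finset.Icc 1 ⌊M⌋₊, ((36 ^ e.primeFactors.card *
      (hessPairs (X / (e : ℝ) ^ 2) (Q / e)).ncard : ℕ) : ℝ) := by
    exact_mod_cast ncard_tailPairs_le_sum (X := X) hQ
  refine (h0.trans (Finset.sum_le_sum hterm)).trans ?_
  rw [← Finset.mul_sum]
  have hMε : M ^ (ε / 3) * M ^ (ε / 3) * M ^ (ε / 3) ≤ 2 ^ ε * X ^ ε := by
    rw [← Real.rpow_add (by linarith), ← Real.rpow_add (by linarith),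
      show ε / 3 + ε / 3 + ε / 3 = ε by ring, ← Real.mul_rpow (by norm_num) (by linarith)]
    have : √X ≤ X := by nlinarith
    gcongr
    linarith
  calc _ ≤ 6 * B * H * M ^ (ε / 3) * M ^ (ε / 3) * (X / Q) * (C * M ^ (ε / 3)) := by
        gcongr
        exact hC M hM1
    _ = 6 * B * H * C * (M ^ (ε / 3) * M ^ (ε / 3) * M ^ (ε / 3)) * (X / Q) := by ring
    _ ≤ 6 * B * H * C * (2 ^ ε * X ^ ε) * (X / Q) := by gcongr
    _ = _ := by ring

end TailBound

section Sieve

/-- Reduced forms away from the cusp, in a dyadic range of discriminants that are `8` modulo `16`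
and divisible by `q ^ 2`. -/
def sieveForms (u : ℝ) (q : ℕ) : Set (Fin 4 → ℤ) :=
  {f | RedCubic f ∧ 0 < f 0 ∧ 2 * u ^ 40 ≤ ((dsc f : ℤ) : ℝ) ∧ ((dsc f : ℤ) : ℝ) < 4 * u ^ 40 ∧
    u ^ 18 ≤ ((hP f : ℤ) : ℝ) ∧ (q : ℤ) ^ 2 ∣ dsc f ∧ dsc f % 16 = 8}

lemma sieveForms_finite (u : ℝ) (q : ℕ) : (sieveForms u q).Finite :=
  (finite_redCubic (u ^ 40)).subset fun _ h => ⟨h.1, h.2.1, h.2.2.2.1⟩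

lemma ncard_sieveForms {u : ℝ} (hu : 0 < u) {q : ℕ} [NeZero (4 * q ^ 2)] :
    (sieveForms u q).ncard = ∑ v : {v : Fin 4 → ZMod (4 * q ^ 2) // GoodClass q v},
      (mainForms (4 * q ^ 2) v.1 (u ^ 10) u).ncard := by
  rw [Set.ncard_eq_toFinset_card _ (sieveForms_finite u q),
    Finset.card_eq_sum_card_fiberwise (f := fun f i => (f i : ZMod (4 * q ^ 2)))
      (t := Finset.univ.filter (GoodClass q))]
  · rw [Finset.sum_subtype (p := GoodClass q) _ (by simp)]
    refine Finset.sum_congr rfl fun v _ => ?_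
    rw [← Set.ncard_coe_finset]
    congr 1
    ext f
    have e : u ^ (10 * 2) / u ^ 2 = u ^ 18 := by field_simp
    have hv := v.2
    simp only [sieveForms, mainForms, Finset.coe_filter, Set.Finite.mem_toFinset,
      Set.mem_ofPred_eq, ← pow_mul, e]
    constructor
    · rintro ⟨⟨h1, h2, h3, h4, h5, -⟩, h⟩
      exact ⟨h1, h2, h3, h4, h5, h⟩
    · rintro ⟨h1, h2, h3, h4, h5, h⟩
      rw [← h, goodClass_intCast] at hv
      exact ⟨⟨h1, h2, h3, h4, h5, hv⟩, h⟩
  · intro f hf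
    simp only [sieveForms, Set.Finite.coe_toFinset, Set.mem_ofPred_eq] at hf
    simpa [goodClass_intCast] using hf.2.2.2.2.2

lemma abs_ncard_sieveForms_sub_le {u : ℝ} {q : ℕ} (hq : Odd q) (hu : 16000000 ≤ u)
    (hqu : (q : ℝ) ≤ 2 * u ^ 2) :
    |((sieveForms u q).ncard : ℝ) - Real.pi ^ 2 / 64 * u ^ 40 * (dscRoots q / (q : ℝ) ^ 8)| ≤
      (4000000 * q ^ 2 / u ^ 5 + 100 / u ^ 2) * u ^ 40 * (dscRoots q / (q : ℝ) ^ 8) := by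
  have hu0 : 0 < u := by linarith
  have hq0 : 0 < q := hq.pos
  have hq0' : (0 : ℝ) < q := by exact_mod_cast hq0
  have : NeZero (4 * q ^ 2) := ⟨by positivity⟩
  set δ : ℝ := 4000 * q ^ 2 / u ^ 5 with hδ
  have hN : ((4 * q ^ 2 : ℕ) : ℝ) ^ 4 = 256 * (q : ℝ) ^ 8 := by push_cast; ring
  have h1 : 1000 * ((4 * q ^ 2 : ℕ) : ℝ) * u ^ 5 ≤ δ * u ^ 10 := by
    rw [hδ]; push_cast
    refine le_of_eq ?_
    field_simp
    ring
  have h2 : δ ≤ 1 / 1000 := by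
    rw [hδ, div_le_iff₀ (by positivity)]
    have : (q : ℝ) ^ 2 ≤ (2 * u ^ 2) ^ 2 := by gcongr
    have h3 : 16000000 * u ^ 4 ≤ u * u ^ 4 := by gcongr
    nlinarith
  set E : ℝ := (1000 * δ + 100 / u ^ 2) * u ^ 40 / (256 * (q : ℝ) ^ 8) with hE
  have hv : ∀ v : {v : Fin 4 → ZMod (4 * q ^ 2) // GoodClass q v},
      |((mainForms (4 * q ^ 2) v.1 (u ^ 10) u).ncard : ℝ) -
        Real.pi ^ 2 / 6 * u ^ 40 / (256 * (q : ℝ) ^ 8)| ≤ E := by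
    intro v
    have b1 := ncard_mainForms_le (v := v.1) (by positivity) (by positivity) hu0 h1 h2
    have b2 := le_ncard_mainForms (v := v.1) (by positivity) (by positivity)
      (by linarith : 1 ≤ u) h1 h2
    rw [hN, ← pow_mul] at b1 b2
    norm_num at b1 b2
    rw [hE, abs_le, ← sub_nonneg, ← sub_nonneg (a := E)]
    set n : ℝ := ((mainForms (4 * q ^ 2) v.1 (u ^ 10) u).ncard : ℝ)
    have hpos : 0 < 256 * (q : ℝ) ^ 8 := by positivity
    have e1 : (1000 * δ + 100 / u ^ 2) * u ^ 40 = 1000 * (δ * u ^ 40) + 100 * (u ^ 40 / u ^ 2) := by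
      ring
    have hpos' : 0 ≤ 100 * (u ^ 40 / u ^ 2) := by positivity
    rw [hE, e1]
    constructor
    · rw [show n - Real.pi ^ 2 / 6 * u ^ 40 / (256 * (q : ℝ) ^ 8) -
        -((1000 * (δ * u ^ 40) + 100 * (u ^ 40 / u ^ 2)) / (256 * (q : ℝ) ^ 8)) =
        (n * (256 * (q : ℝ) ^ 8) + 1000 * (δ * u ^ 40) + 100 * (u ^ 40 / u ^ 2) -
          Real.pi ^ 2 / 6 * u ^ 40) / (256 * (q : ℝ) ^ 8) by field_simp; ring]
      exact div_nonneg (by linarith) hpos.le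
    · rw [show (1000 * (δ * u ^ 40) + 100 * (u ^ 40 / u ^ 2)) / (256 * (q : ℝ) ^ 8) -
        (n - Real.pi ^ 2 / 6 * u ^ 40 / (256 * (q : ℝ) ^ 8)) =
        (Real.pi ^ 2 / 6 * u ^ 40 + 1000 * (δ * u ^ 40) + 100 * (u ^ 40 / u ^ 2) -
          n * (256 * (q : ℝ) ^ 8)) / (256 * (q : ℝ) ^ 8) by field_simp; ring]
      exact div_nonneg (by linarith) hpos.le
  have hcard : (Fintype.card {v : Fin 4 → ZMod (4 * q ^ 2) // GoodClass q v} : ℝ) =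
      24 * dscRoots q := by
    rw [← Nat.card_eq_fintype_card, card_goodClass hq]; push_cast; ring
  have hsum := (Finset.abs_sum_le_sum_abs (fun v : {v : Fin 4 → ZMod (4 * q ^ 2) // GoodClass q v} =>
      ((mainForms (4 * q ^ 2) v.1 (u ^ 10) u).ncard : ℝ) -
        Real.pi ^ 2 / 6 * u ^ 40 / (256 * (q : ℝ) ^ 8)) Finset.univ).trans
    (Finset.sum_le_sum fun v _ => hv v)
  rw [Finset.sum_sub_distrib, Finset.sum_const, Finset.sum_const, nsmul_eq_mul, nsmul_eq_mul,
    Finset.card_univ, hcard] at hsum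
  rw [ncard_sieveForms hu0]
  push_cast
  have e2 : Real.pi ^ 2 / 64 * u ^ 40 * (dscRoots q / (q : ℝ) ^ 8) =
      24 * dscRoots q * (Real.pi ^ 2 / 6 * u ^ 40 / (256 * (q : ℝ) ^ 8)) := by
    field_simp; ring
  rw [e2]
  refine hsum.trans ?_
  have e3 : 24 * dscRoots q * E =
      24 / 256 * ((4000000 * q ^ 2 / u ^ 5 + 100 / u ^ 2) * u ^ 40 * (dscRoots q / (q : ℝ) ^ 8)) := by
    rw [hE, hδ]; ring
  rw [e3]
  have : 0 ≤ (4000000 * q ^ 2 / u ^ 5 + 100 / u ^ 2) * u ^ 40 * (dscRoots q / (q : ℝ) ^ 8) := by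
    positivity
  linarith

end Sieve

section Dyadic

open ArithmeticFunction

/-- Reduced forms in a dyadic range of discriminants whose discriminant is `4 D` with `D`
squarefree and `D ≡ 2` modulo `4`. -/
def dyadicForms (X : ℝ) : Set (Fin 4 → ℤ) :=
  {f | RedCubic f ∧ 0 < f 0 ∧ 2 * X ≤ ((dsc f : ℤ) : ℝ) ∧ ((dsc f : ℤ) : ℝ) < 4 * X ∧
    dsc f % 16 = 8 ∧ Squarefree (dsc f / 4).toNat}

lemma dyadicForms_finite (X : ℝ) : (dyadicForms X).Finite :=
  (finite_redCubic X).subset fun _ h => ⟨h.1, h.2.1, h.2.2.2.1⟩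

/-- The forms of `dyadicForms` away from the cusp. -/
def bulkForms (u : ℝ) : Set (Fin 4 → ℤ) :=
  {f | f ∈ sieveForms u 1 ∧ Squarefree (dsc f / 4).toNat}

lemma sq_dvd_toNat_iff {q : ℕ} (hq : Odd q) {n : ℤ} (hn : 0 < n) (h : n % 16 = 8) :
    q ^ 2 ∣ (n / 4).toNat ↔ (q : ℤ) ^ 2 ∣ n := by
  obtain ⟨m, rfl⟩ : ∃ m : ℕ, n = 4 * m := ⟨(n / 4).toNat, by omega⟩
  have e : (4 * (m : ℤ) / 4).toNat = m := by omega
  rw [e]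
  have : (q : ℤ) ^ 2 ∣ 4 * m ↔ q ^ 2 ∣ 4 * m := by
    rw [← Int.natCast_dvd_natCast (m := q ^ 2)]; push_cast; rfl
  rw [this]
  have hc : Nat.Coprime (q ^ 2) 4 :=
    Nat.Coprime.pow 2 2 (Nat.coprime_two_right.mpr hq)
  exact (hc.dvd_mul_left).symm

lemma ncard_bulkForms {u : ℝ} {R : ℕ} (hR : u ^ 40 ≤ (R : ℝ) ^ 2) :
    ((bulkForms u).ncard : ℝ) = ∑ q ∈ Finset.Icc 1 R,
      (if Odd q then (moebius q : ℝ) * ((sieveForms u q).ncard : ℝ) else 0) := by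
  set S := (sieveForms_finite u 1).toFinset with hS
  have hmem : ∀ f, f ∈ S ↔ f ∈ sieveForms u 1 := by simp [hS]
  have h1 : (bulkForms u).ncard = (S.filter fun f => Squarefree (dsc f / 4).toNat).card := by
    rw [← Set.ncard_coe_finset]
    congr 1
    ext f
    simp [bulkForms, hmem]
  rw [h1, Finset.card_filter]
  push_cast
  have h2 : ∀ f ∈ S, (if Squarefree (dsc f / 4).toNat then (1 : ℝ) else 0) =
      ∑ q ∈ Finset.Icc 1 R, (if q ^ 2 ∣ (dsc f / 4).toNat then (moebius q : ℝ) else 0) := by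
    intro f hf
    obtain ⟨hr, -, -, hd, -, -, h8⟩ := (hmem f).1 hf
    have hp := hr.dsc_pos
    refine (sum_moebius_sq_dvd (by omega) ?_).symm
    have : (((dsc f / 4).toNat : ℕ) : ℝ) * 4 = ((dsc f : ℤ) : ℝ) := by
      have : (((dsc f / 4).toNat : ℕ) : ℤ) * 4 = dsc f := by omega
      exact_mod_cast this
    have : (((dsc f / 4).toNat : ℕ) : ℝ) ≤ (R : ℝ) ^ 2 := by linarith
    exact_mod_cast this
  rw [Finset.sum_congr rfl h2, Finset.sum_comm]
  refine Finset.sum_congr rfl fun q _ => ?_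
  rw [← Finset.sum_filter, Finset.sum_const, nsmul_eq_mul]
  split_ifs with ho
  · rw [mul_comm, ← Set.ncard_coe_finset]
    congr 3
    ext f
    simp only [Finset.coe_filter, hmem, Set.mem_ofPred_eq, sieveForms]
    constructor
    · rintro ⟨⟨a, b, c, d, e, -, g⟩, h⟩
      exact ⟨a, b, c, d, e, (sq_dvd_toNat_iff ho a.dsc_pos g).1 h, g⟩
    · rintro ⟨a, b, c, d, e, h, g⟩
      exact ⟨⟨a, b, c, d, e, by simp, g⟩, (sq_dvd_toNat_iff ho a.dsc_pos g).2 h⟩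
  · rw [Finset.filter_false_of_mem, Finset.card_empty, Nat.cast_zero, zero_mul]
    intro f hf hdvd
    obtain ⟨hr, -, -, -, -, -, h8⟩ := (hmem f).1 hf
    have := hr.dsc_pos
    exact ho (odd_of_sq_dvd hdvd (by omega))

lemma ncard_dyadicForms_sub_bulkForms (u : ℝ) :
    (bulkForms u).ncard ≤ (dyadicForms (u ^ 40)).ncard ∧
    (dyadicForms (u ^ 40)).ncard ≤ (bulkForms u).ncard +
      (contentPairs (u ^ 40) (u ^ 18) (1 / 2)).ncard := by
  constructor
  · refine Set.ncard_le_ncard ?_ (dyadicForms_finite _)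
    rintro f ⟨⟨a, b, c, d, -, -, g⟩, h⟩
    exact ⟨a, b, c, d, g, h⟩
  · have hfin := contentPairs_finite (u ^ 40) (u ^ 18) (1 / 2)
    have h1 : dyadicForms (u ^ 40) ⊆ bulkForms u ∪
        {f | (f, 1) ∈ contentPairs (u ^ 40) (u ^ 18) (1 / 2)} := by
      rintro f ⟨a, b, c, d, g, h⟩
      rcases le_total (u ^ 18) ((hP f : ℤ) : ℝ) with hP | hP
      · exact Or.inl ⟨⟨a, b, c, d, hP, by simp, g⟩, h⟩
      · refine Or.inr ⟨a, b, d, hP, squarefree_one, ?_, ?_, ?_⟩ <;> norm_num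
    have hb : (bulkForms u).Finite := (sieveForms_finite u 1).subset fun f h => h.1
    have hc : {f | (f, 1) ∈ contentPairs (u ^ 40) (u ^ 18) (1 / 2)}.Finite :=
      hfin.preimage fun a _ b _ h => congrArg Prod.fst h
    refine (Set.ncard_le_ncard h1 (hb.union hc)).trans ((Set.ncard_union_le _ _).trans ?_)
    gcongr
    have := hfin.sum_fiber_le_ncard {1}
    simpa using this

lemma abs_sum_sieveForms_tail_le {u : ℝ} {Q R : ℕ} (hQ : u ^ 2 ≤ Q) :
    |∑ q ∈ Finset.Ioc Q R,
      (if Odd q then (moebius q : ℝ) * ((sieveForms u q).ncard : ℝ) else 0)| ≤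
      ((tailPairs (u ^ 40) (u ^ 2)).ncard : ℝ) := by
  have hfin := tailPairs_finite (u ^ 40) (u ^ 2)
  refine (Finset.abs_sum_le_sum_abs _ _).trans ?_
  have := hfin.sum_fiber_le_ncard (Finset.Ioc Q R)
  refine le_trans (Finset.sum_le_sum fun q hq => ?_)
    ((Nat.cast_sum (R := ℝ) _ _).symm.le.trans (Nat.cast_le.2 this))
  have hqQ : (Q : ℝ) < q := by exact_mod_cast (Finset.mem_Ioc.1 hq).1
  split_ifs with ho
  · by_cases hs : Squarefree q
    · rw [abs_mul, Nat.abs_cast]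
      refine (mul_le_of_le_one_left (by positivity) (abs_moebius_le_one q)).trans ?_
      have : {a | (a, q) ∈ tailPairs (u ^ 40) (u ^ 2)}.Finite :=
        hfin.preimage fun a _ b _ h => congrArg Prod.fst h
      refine Nat.cast_le.2 (Set.ncard_le_ncard ?_ this)
      rintro f ⟨a, b, c, d, -, e, g⟩
      exact ⟨a, d, hs, ho, by linarith, e⟩
    · rw [moebius_eq_zero_of_not_squarefree hs]; simp
  · simp

lemma exists_sum_sieveForms_le {ε : ℝ} (hε : 0 < ε) (hε1 : ε ≤ 1 / 2) : ∃ C : ℝ, 0 ≤ C ∧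
    ∀ (u : ℝ) (Q : ℕ), 16000000 ≤ u → u ^ 2 ≤ Q → (Q : ℝ) ≤ 2 * u ^ 2 →
      |∑ q ∈ Finset.Icc 1 Q,
        (if Odd q then (moebius q : ℝ) * ((sieveForms u q).ncard : ℝ) else 0) -
          u ^ 40 / Real.pi ^ 2| ≤ C * (u ^ 38 * u ^ (6 * ε)) := by
  obtain ⟨B, hB0, hB⟩ := exists_dscRoots_div_le hε
  obtain ⟨C1, hC1, h1⟩ := sum_moebius_dscRoots hε hε1
  obtain ⟨C2, hC2, h2⟩ := exists_sum_inv_le hε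
  refine ⟨101 * B * C2 + Real.pi ^ 2 / 64 * C1, by positivity, fun u Q hu hQ hQ2 => ?_⟩
  have hu0 : 0 < u := by linarith
  have hu1 : 1 ≤ u := by linarith
  have hQ1 : 1 ≤ Q := by
    have : (1 : ℝ) ≤ Q := (one_le_pow₀ hu1).trans hQ
    exact_mod_cast this
  have hW : (2 * u ^ 2) ^ ε ≤ u ^ (3 * ε) := by
    have : 2 * u ^ 2 ≤ u ^ (3 : ℝ) := by
      rw [show (3 : ℝ) = (3 : ℕ) by norm_num, Real.rpow_natCast, pow_succ' u 2]
      gcongr; linarith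
    rw [Real.rpow_mul hu0.le]
    gcongr
  have hmain : |Real.pi ^ 2 / 64 * u ^ 40 * ∑ q ∈ Finset.Icc 1 Q,
      (if Odd q then (moebius q : ℝ) * (dscRoots q / (q : ℝ) ^ 8) else 0) - u ^ 40 / Real.pi ^ 2| ≤
      Real.pi ^ 2 / 64 * C1 * (u ^ 38 * u ^ (6 * ε)) := by
    have e : u ^ 40 / Real.pi ^ 2 = Real.pi ^ 2 / 64 * u ^ 40 * (8 / Real.pi ^ 2) ^ 2 := by
      field_simp; norm_num
    rw [e, ← mul_sub, abs_mul, abs_of_nonneg (by positivity)]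
    have h3 : (Q : ℝ) ^ (-1 + 2 * ε) ≤ (u ^ 2)⁻¹ * u ^ (6 * ε) := by
      calc (Q : ℝ) ^ (-1 + 2 * ε) ≤ (u ^ 2) ^ (-1 + 2 * ε) :=
            Real.rpow_le_rpow_of_nonpos (by positivity) hQ (by linarith)
        _ = (u ^ 2)⁻¹ * u ^ (4 * ε) := by
            rw [Real.rpow_add (by positivity), Real.rpow_neg_one, ← Real.rpow_natCast u 2,
              ← Real.rpow_mul hu0.le]
            congr 2; push_cast; ring
        _ ≤ _ := by gcongr; linarith
    calc _ ≤ Real.pi ^ 2 / 64 * u ^ 40 * (C1 * ((u ^ 2)⁻¹ * u ^ (6 * ε))) := by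
          gcongr; exact (h1 Q hQ1).trans (by gcongr)
      _ = _ := by field_simp
  have herr : |∑ q ∈ Finset.Icc 1 Q,
        (if Odd q then (moebius q : ℝ) * ((sieveForms u q).ncard : ℝ) else 0) -
      Real.pi ^ 2 / 64 * u ^ 40 * ∑ q ∈ Finset.Icc 1 Q,
        (if Odd q then (moebius q : ℝ) * (dscRoots q / (q : ℝ) ^ 8) else 0)| ≤
      101 * B * C2 * (u ^ 38 * u ^ (6 * ε)) := by
    rw [Finset.mul_sum, ← Finset.sum_sub_distrib]
    refine (Finset.abs_sum_le_sum_abs _ _).trans ?_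
    have hterm : ∀ q ∈ Finset.Icc 1 Q,
        |(if Odd q then (moebius q : ℝ) * ((sieveForms u q).ncard : ℝ) else 0) -
          Real.pi ^ 2 / 64 * u ^ 40 *
            (if Odd q then (moebius q : ℝ) * (dscRoots q / (q : ℝ) ^ 8) else 0)| ≤
        101 * B * u ^ 38 * u ^ (3 * ε) * (q : ℝ)⁻¹ := by
      intro q hq
      have hq1 : (1 : ℝ) ≤ q := by exact_mod_cast (Finset.mem_Icc.1 hq).1
      have hqQ : (q : ℝ) ≤ 2 * u ^ 2 :=
        le_trans (by exact_mod_cast (Finset.mem_Icc.1 hq).2) hQ2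
      have hq0 : (0 : ℝ) < q := by linarith
      split_ifs with ho
      · by_cases hs : Squarefree q
        · have h4 := abs_ncard_sieveForms_sub_le ho hu hqQ
          have h5 := hB q ho hs
          have h6 : (q : ℝ) ^ (-2 + ε) ≤ ((q : ℝ) ^ 2)⁻¹ * u ^ (3 * ε) := by
            rw [Real.rpow_add hq0, Real.rpow_neg hq0.le, Real.rpow_two]
            gcongr
            exact (Real.rpow_le_rpow hq0.le hqQ hε.le).trans hW
          have h7 : 4000000 * (q : ℝ) ^ 2 / u ^ 5 + 100 / u ^ 2 ≤ 101 * q / u ^ 2 := by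
            rw [div_add_div _ _ (by positivity) (by positivity),
              div_le_div_iff₀ (by positivity) (by positivity)]
            have a1 : 4000000 * (q : ℝ) ^ 2 ≤ q * u ^ 3 := by
              calc 4000000 * (q : ℝ) ^ 2 = q * (4000000 * q) := by ring
                _ ≤ q * (4000000 * (2 * u ^ 2)) := by gcongr
                _ = q * (8000000 * u ^ 2) := by ring
                _ ≤ q * (u * u ^ 2) := by gcongr; linarith
                _ = q * u ^ 3 := by ring
            have a2 : u ^ 5 * 100 ≤ q * (u ^ 5 * 100) :=
              le_mul_of_one_le_left (by positivity) hq1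
            calc (4000000 * (q : ℝ) ^ 2 * u ^ 2 + u ^ 5 * 100) * u ^ 2
                ≤ (q * u ^ 3 * u ^ 2 + q * (u ^ 5 * 100)) * u ^ 2 := by gcongr
              _ = 101 * q * (u ^ 5 * u ^ 2) := by ring
          calc _ = |(moebius q : ℝ)| * |((sieveForms u q).ncard : ℝ) -
                Real.pi ^ 2 / 64 * u ^ 40 * (dscRoots q / (q : ℝ) ^ 8)| := by
                rw [← abs_mul]; congr 1; ring
            _ ≤ 1 * ((101 * q / u ^ 2) * u ^ 40 * (B * (((q : ℝ) ^ 2)⁻¹ * u ^ (3 * ε)))) := by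
                refine mul_le_mul (abs_moebius_le_one q) (h4.trans ?_) (abs_nonneg _) zero_le_one
                have h8 := h5.trans (mul_le_mul_of_nonneg_left h6 hB0)
                gcongr
            _ = _ := by field_simp
        · rw [moebius_eq_zero_of_not_squarefree hs]
          simp only [Int.cast_zero, zero_mul, mul_zero, sub_zero, abs_zero]
          positivity
      · simp only [mul_zero, sub_zero, abs_zero]
        positivity
    refine (Finset.sum_le_sum hterm).trans ?_
    rw [← Finset.mul_sum]
    have h9 := h2 (Q : ℝ) (by exact_mod_cast hQ1)
    rw [Nat.floor_natCast] at h9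
    have h10 : (Q : ℝ) ^ ε ≤ u ^ (3 * ε) :=
      (Real.rpow_le_rpow (by positivity) hQ2 hε.le).trans hW
    calc _ ≤ 101 * B * u ^ 38 * u ^ (3 * ε) * (C2 * u ^ (3 * ε)) := by
          gcongr; exact h9.trans (by gcongr)
      _ = 101 * B * C2 * (u ^ 38 * (u ^ (3 * ε) * u ^ (3 * ε))) := by ring
      _ = _ := by rw [← Real.rpow_add hu0]; ring_nf
  refine (abs_sub_le _ _ _).trans ((add_le_add herr hmain).trans (le_of_eq ?_))
  ring

lemma exists_ncard_dyadicForms_pow {ε : ℝ} (hε : 0 < ε) (hε1 : ε ≤ 1 / 2) : ∃ C : ℝ, 0 ≤ C ∧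
    ∀ u : ℝ, 16000000 ≤ u →
      |((dyadicForms (u ^ 40)).ncard : ℝ) - u ^ 40 / Real.pi ^ 2| ≤
        C * (u ^ 38 * u ^ (40 * ε)) := by
  obtain ⟨C1, hC1, h1⟩ := exists_sum_sieveForms_le hε hε1
  obtain ⟨C2, hC2, h2⟩ := ncard_tailPairs_le hε
  obtain ⟨C3, hC3, h3⟩ := ncard_contentPairs_le hε
  refine ⟨C1 + C2 + 3 * C3, by positivity, fun u hu => ?_⟩
  have hu0 : 0 < u := by linarith
  have hu1 : 1 ≤ u := by linarith
  set Q := ⌈u ^ 2⌉₊ with hQ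
  have hQ1 : u ^ 2 ≤ Q := Nat.le_ceil _
  have hQ2 : (Q : ℝ) ≤ 2 * u ^ 2 := by
    have := (Nat.ceil_lt_add_one (by positivity : 0 ≤ u ^ 2)).le
    have : 1 ≤ u ^ 2 := one_le_pow₀ hu1
    linarith
  set R := max Q ⌈u ^ 20⌉₊ with hR
  have hR1 : u ^ 40 ≤ (R : ℝ) ^ 2 := by
    have : u ^ 20 ≤ R := (Nat.le_ceil _).trans (by exact_mod_cast le_max_right _ _)
    calc u ^ 40 = (u ^ 20) ^ 2 := by ring
      _ ≤ _ := by gcongr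
  have hs : √(u ^ 40) = u ^ 20 := by
    rw [show u ^ 40 = (u ^ 20) ^ 2 by ring, Real.sqrt_sq (by positivity)]
  have hs' : √(u ^ 18) = u ^ 9 := by
    rw [show u ^ 18 = (u ^ 9) ^ 2 by ring, Real.sqrt_sq (by positivity)]
  have hpow : ∀ n : ℕ, n ≤ 40 → (u ^ n) ^ ε ≤ u ^ (40 * ε) := by
    intro n hn
    rw [← Real.rpow_natCast u n, ← Real.rpow_mul hu0.le]
    have : (n : ℝ) ≤ 40 := by exact_mod_cast hn
    gcongr
  have hbulk := ncard_bulkForms hR1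
  have hsplit : Finset.Icc 1 R = Finset.Icc 1 Q ∪ Finset.Ioc Q R := by
    have h4 : Q ≤ R := le_max_left _ _
    have h5 : 1 ≤ Q := by
      have : (1 : ℝ) ≤ Q := (one_le_pow₀ hu1).trans hQ1
      exact_mod_cast this
    ext q
    simp only [Finset.mem_union, Finset.mem_Icc, Finset.mem_Ioc]
    omega
  rw [hsplit, Finset.sum_union (by
      rw [Finset.disjoint_left]; intro a ha hb
      exact absurd (Finset.mem_Icc.1 ha).2 (not_le.2 (Finset.mem_Ioc.1 hb).1))] at hbulk
  have k1 := h1 u Q hu hQ1 hQ2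
  have k2 := abs_sum_sieveForms_tail_le (R := R) hQ1
  have k3 := h2 (u ^ 40) (u ^ 2) (one_le_pow₀ hu1) (by positivity) (by
    rw [hs, ← pow_mul]; exact pow_le_pow_right₀ hu1 (by norm_num))
  have k4 := h3 (u ^ 40) (u ^ 18) (1 / 2) (by positivity) (one_le_pow₀ hu1) (by norm_num)
  rw [hs, hs'] at k4
  obtain ⟨k5, k6⟩ := ncard_dyadicForms_sub_bulkForms u
  have k5' : ((bulkForms u).ncard : ℝ) ≤ ((dyadicForms (u ^ 40)).ncard : ℝ) := by exact_mod_cast k5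
  have k6' : ((dyadicForms (u ^ 40)).ncard : ℝ) ≤ ((bulkForms u).ncard : ℝ) +
      ((contentPairs (u ^ 40) (u ^ 18) (1 / 2)).ncard : ℝ) := by exact_mod_cast k6
  set W := u ^ 38 * u ^ (40 * ε) with hW
  have m1 : C1 * (u ^ 38 * u ^ (6 * ε)) ≤ C1 * W := by
    rw [hW]; gcongr
    norm_num
  have m2 : C2 * (u ^ 40) ^ ε * (u ^ 40 / u ^ 2) ≤ C2 * W := by
    have : u ^ 40 / u ^ 2 = u ^ 38 := by field_simp
    rw [hW, this, mul_assoc, mul_comm (u ^ 38)]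
    gcongr
    exact hpow 40 le_rfl
  have m3 : C3 * (u ^ 18) ^ ε * (u ^ 18 * u ^ 20 / (1 / 2) + u ^ 18 * u ^ 9) ≤ 3 * C3 * W := by
    have a1 : u ^ 27 ≤ u ^ 38 := pow_le_pow_right₀ hu1 (by norm_num)
    calc C3 * (u ^ 18) ^ ε * (u ^ 18 * u ^ 20 / (1 / 2) + u ^ 18 * u ^ 9)
        = C3 * (u ^ 18) ^ ε * (2 * u ^ 38 + u ^ 27) := by ring
      _ ≤ C3 * u ^ (40 * ε) * (2 * u ^ 38 + u ^ 38) := by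
          gcongr; exact hpow 18 (by norm_num)
      _ = _ := by rw [hW]; ring
  rw [abs_le] at k1 k2 ⊢
  have z1 : 0 ≤ C3 * W := by positivity
  constructor <;> linarith

/-- The number of reduced forms in a dyadic range of squarefree discriminants. -/
theorem exists_ncard_dyadicForms {ε : ℝ} (hε : 0 < ε) (hε1 : ε ≤ 1 / 2) : ∃ C : ℝ, 0 ≤ C ∧
    ∀ X : ℝ, 1 ≤ X →
      |((dyadicForms X).ncard : ℝ) - X / Real.pi ^ 2| ≤ C * X ^ ((19 : ℝ) / 20 + ε) := by
  obtain ⟨C, hC, h⟩ := exists_ncard_dyadicForms_pow hε hε1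
  set K : ℝ := 16000000 ^ 40 with hK
  set N := ({f : Fin 4 → ℤ | RedCubic f ∧ 0 < f 0 ∧ ((dsc f : ℤ) : ℝ) < 4 * K}.ncard : ℝ) with hN
  refine ⟨C + (N + K), by positivity, fun X hX => ?_⟩
  have hX0 : 0 < X := by linarith
  rcases le_total K X with hKX | hKX
  · set u := X ^ ((1 : ℝ) / 40) with hu
    have hu0 : 0 < u := by positivity
    have e : u ^ 40 = X := by
      rw [hu, ← Real.rpow_natCast, ← Real.rpow_mul hX0.le]; norm_num
    have hu1 : 16000000 ≤ u := by
      refine (pow_le_pow_iff_left₀ (by norm_num) hu0.le (by norm_num : (40 : ℕ) ≠ 0)).1 ?_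
      rw [e]; exact hKX
    have := h u hu1
    rw [e] at this
    have e2 : u ^ 38 * u ^ (40 * ε) = X ^ ((19 : ℝ) / 20 + ε) := by
      rw [hu, ← Real.rpow_natCast, ← Real.rpow_mul hX0.le, ← Real.rpow_mul hX0.le,
        ← Real.rpow_add hX0]
      congr 1; push_cast; ring
    rw [e2] at this
    refine this.trans ?_
    gcongr
    have : 0 ≤ N + K := by positivity
    linarith
  · have h1 : 1 ≤ X ^ ((19 : ℝ) / 20 + ε) := Real.one_le_rpow hX (by positivity)
    have h2 : ((dyadicForms X).ncard : ℝ) ≤ N := by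
      refine Nat.cast_le.2 (Set.ncard_le_ncard ?_ (finite_redCubic K))
      rintro f ⟨a, b, -, d, -, -⟩
      exact ⟨a, b, by linarith⟩
    have h3 : X / Real.pi ^ 2 ≤ K := by
      refine (div_le_self hX0.le ?_).trans hKX
      have := Real.pi_gt_three
      nlinarith
    have h4 : 0 ≤ X / Real.pi ^ 2 := by positivity
    have h5 : (0 : ℝ) ≤ ((dyadicForms X).ncard : ℝ) := by positivity
    have h6 : C + (N + K) ≤ (C + (N + K)) * X ^ ((19 : ℝ) / 20 + ε) :=
      le_mul_of_one_le_right (by positivity) h1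
    refine le_trans ?_ h6
    rw [abs_le]
    constructor <;> linarith [show 0 ≤ K by positivity, show 0 ≤ N by positivity]

end Dyadic

section Average

/-- Reduced forms of discriminant `4 D`, where `D < X` is squarefree and `D ≡ 2` modulo `4`. -/
def squarefreeForms (X : ℝ) : Set (Fin 4 → ℤ) :=
  {f | RedCubic f ∧ 0 < f 0 ∧ ((dsc f : ℤ) : ℝ) < 4 * X ∧ dsc f % 16 = 8 ∧
    Squarefree (dsc f / 4).toNat}

lemma squarefreeForms_finite (X : ℝ) : (squarefreeForms X).Finite :=
  (finite_redCubic X).subset fun _ h => ⟨h.1, h.2.1, h.2.2.1⟩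

lemma ncard_squarefreeForms_eq_add {X : ℝ} (hX : 0 ≤ X) :
    (squarefreeForms X).ncard = (squarefreeForms (X / 2)).ncard + (dyadicForms X).ncard := by
  rw [← Set.ncard_union_eq _ (squarefreeForms_finite _) (dyadicForms_finite _)]
  · congr 1
    ext f
    constructor
    · rintro ⟨a, b, c, d, e⟩
      rcases lt_or_ge ((dsc f : ℤ) : ℝ) (2 * X) with h | h
      · exact Or.inl ⟨a, b, by linarith, d, e⟩
      · exact Or.inr ⟨a, b, h, c, d, e⟩
    · rintro (⟨a, b, c, d, e⟩ | ⟨a, b, -, c, d, e⟩)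
      · exact ⟨a, b, by linarith, d, e⟩
      · exact ⟨a, b, c, d, e⟩
  · rw [Set.disjoint_left]
    rintro f ⟨-, -, h, -⟩ ⟨-, -, h', -⟩
    linarith

lemma squarefreeForms_eq_empty {X : ℝ} (hX : X ≤ 2) : squarefreeForms X = ∅ := by
  refine Set.eq_empty_of_forall_notMem ?_
  rintro f ⟨a, -, c, d, -⟩
  have h1 := a.dsc_pos
  have h2 : ((dsc f : ℤ) : ℝ) < 8 := by linarith
  have h3 : dsc f < 8 := by exact_mod_cast h2
  omega

lemma exists_ncard_squarefreeForms {ε : ℝ} (hε : 0 < ε) (hε1 : ε ≤ 1 / 2) : ∃ C : ℝ, 0 ≤ C ∧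
    ∀ X : ℝ, 1 ≤ X →
      |((squarefreeForms X).ncard : ℝ) - 2 / Real.pi ^ 2 * X| ≤ C * X ^ ((19 : ℝ) / 20 + ε) := by
  obtain ⟨C, hC, h⟩ := exists_ncard_dyadicForms hε hε1
  set θ : ℝ := 19 / 20 + ε with hθ
  have hhalf : ((1 : ℝ) / 2) ^ θ ≤ 3 / 4 := by
    calc ((1 : ℝ) / 2) ^ θ ≤ (1 / 2) ^ ((1 : ℝ) / 2) :=
          Real.rpow_le_rpow_of_exponent_ge (by norm_num) (by norm_num) (by rw [hθ]; linarith)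
      _ = √(1 / 2) := (Real.sqrt_eq_rpow _).symm
      _ ≤ 3 / 4 := Real.sqrt_le_iff.2 (by norm_num)
  have hpi : 2 / Real.pi ^ 2 ≤ 1 / 2 := by
    rw [div_le_div_iff₀ (by positivity) (by norm_num)]
    nlinarith [Real.pi_gt_three]
  have hpi0 : 0 ≤ 2 / Real.pi ^ 2 := by positivity
  have hind : ∀ (n : ℕ) (X : ℝ), 1 ≤ X → X < 2 ^ (n + 1) →
      |((squarefreeForms X).ncard : ℝ) - 2 / Real.pi ^ 2 * X| ≤ (4 * C + 1) * X ^ θ := by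
    have hbase : ∀ X : ℝ, 1 ≤ X → X < 2 →
        |((squarefreeForms X).ncard : ℝ) - 2 / Real.pi ^ 2 * X| ≤ (4 * C + 1) * X ^ θ := by
      intro X hX1 hX2
      rw [squarefreeForms_eq_empty hX2.le, Set.ncard_empty, Nat.cast_zero, zero_sub, abs_neg,
        abs_of_nonneg (by positivity)]
      have h1 : 1 ≤ X ^ θ := Real.one_le_rpow hX1 (by positivity)
      nlinarith
    intro n
    induction n with
    | zero => intro X h1 h2; exact hbase X h1 (by simpa using h2)
    | succ n ih =>
      intro X h1 h2
      rcases lt_or_ge X 2 with h3 | h3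
      · exact hbase X h1 h3
      · have h4 := ih (X / 2) (by linarith) (by rw [pow_succ] at h2; linarith)
        have h5 := h X h1
        have h6 : (X / 2) ^ θ ≤ 3 / 4 * X ^ θ := by
          rw [show X / 2 = 1 / 2 * X by ring, Real.mul_rpow (by norm_num) (by linarith)]
          gcongr
        have h7 : (4 * C + 1) * (X / 2) ^ θ ≤ (4 * C + 1) * (3 / 4 * X ^ θ) := by gcongr
        have h8 : 0 ≤ X ^ θ := by positivity
        rw [ncard_squarefreeForms_eq_add (by linarith)]
        push_cast
        have e : 2 / Real.pi ^ 2 * X = 2 / Real.pi ^ 2 * (X / 2) + X / Real.pi ^ 2 := by ring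
        rw [e]
        rw [abs_le] at h4 h5 ⊢
        constructor <;> linarith
  refine ⟨4 * C + 1, by positivity, fun X hX => ?_⟩
  obtain ⟨n, hn⟩ := pow_unbounded_of_one_lt X (one_lt_two (α := ℝ))
  exact hind n X hX (hn.trans_le (pow_le_pow_right₀ one_le_two (Nat.le_succ n)))

lemma sum_h3_eq (X : ℝ) :
    ∑' D : ℕ, (if Squarefree D ∧ D % 4 = 2 ∧ (D : ℝ) < X then (h3 (-(D : ℤ)) : ℝ) else 0) =
      (((Finset.range ⌈X⌉₊).filter fun D => Squarefree D ∧ D % 4 = 2).card : ℝ) +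
        ((squarefreeForms X).ncard : ℝ) := by
  set S := (Finset.range ⌈X⌉₊).filter fun D => Squarefree D ∧ D % 4 = 2 with hS
  have hmem : ∀ D, D ∈ S ↔ Squarefree D ∧ D % 4 = 2 ∧ (D : ℝ) < X := by
    intro D
    rw [hS, Finset.mem_filter, Finset.mem_range, Nat.lt_ceil]
    tauto
  rw [tsum_eq_sum (s := S) fun D hD => if_neg fun h => hD ((hmem D).2 h)]
  have h1 : (squarefreeForms X).ncard =
      ∑ D ∈ S, {f : Fin 4 → ℤ | RedCubic f ∧ dsc f = 4 * D ∧ 0 < f 0}.ncard := by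
    rw [Set.ncard_eq_toFinset_card _ (squarefreeForms_finite X),
      Finset.card_eq_sum_card_fiberwise (f := fun f => (dsc f / 4).toNat) (t := S)]
    · refine Finset.sum_congr rfl fun D hD => ?_
      obtain ⟨hD1, hD2, hD3⟩ := (hmem D).1 hD
      rw [← Set.ncard_coe_finset]
      congr 1
      ext f
      simp only [squarefreeForms, Finset.coe_filter, Set.Finite.mem_toFinset, Set.mem_ofPred_eq]
      constructor
      · rintro ⟨⟨a, b, c, d, e⟩, h⟩
        have := a.dsc_pos
        exact ⟨a, by omega, b⟩
      · rintro ⟨a, b, c⟩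
        have h2 : (dsc f / 4).toNat = D := by omega
        refine ⟨⟨a, c, ?_, by omega, h2 ▸ hD1⟩, h2⟩
        rw [b]; push_cast; linarith
    · intro f hf
      simp only [Set.Finite.coe_toFinset] at hf
      obtain ⟨a, b, c, d, e⟩ := hf
      have := a.dsc_pos
      have hmod : (dsc f / 4).toNat % 4 = 2 := by omega
      refine (hmem _).2 ⟨e, hmod, ?_⟩
      have h2 : (((dsc f / 4).toNat : ℕ) : ℤ) * 4 = dsc f := by omega
      have h3 : (((dsc f / 4).toNat : ℕ) : ℝ) * 4 = ((dsc f : ℤ) : ℝ) := by exact_mod_cast h2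
      linarith
  rw [h1, Finset.card_eq_sum_ones]
  push_cast
  rw [← Finset.sum_add_distrib]
  refine Finset.sum_congr rfl fun D hD => ?_
  rw [if_pos ((hmem D).1 hD), (h3_eq_one_add ((hmem D).1 hD).1 ((hmem D).1 hD).2.1).2]
  push_cast
  rfl

end Average

/-- Hough's theorem: the sum of `#Cl_3(-D)` over squarefree positive integers `D < X`
with `D ≡ 2 (mod 4)` is `(4/π²) X + O(X^{19/20 + ε})`. -/
theorem hough_cl3_average :
    ∀ ε : ℝ, 0 < ε → ∃ Cε : ℝ, ∀ X : ℝ, 1 ≤ X →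
      |(∑' D : ℕ, if Squarefree D ∧ D % 4 = 2 ∧ (D : ℝ) < X then (h3 (-(D : ℤ)) : ℝ) else 0)
        - 4 / Real.pi ^ 2 * X| ≤ Cε * X ^ ((19 : ℝ)/20 + ε) := by
  intro ε hε
  obtain ⟨C, hC, h⟩ := exists_ncard_squarefreeForms (ε := min ε (1 / 2)) (by positivity)
    (min_le_right _ _)
  obtain ⟨C', hC', h'⟩ := card_squarefree_two_mod_four
  refine ⟨C + 2 * C' + 1, fun X hX => ?_⟩
  have h1 := (h X hX).trans (mul_le_mul_of_nonneg_left (Real.rpow_le_rpow_of_exponent_le hX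
    (by gcongr; exact min_le_left _ _ : (19 : ℝ) / 20 + min ε (1 / 2) ≤ 19 / 20 + ε)) hC)
  have hN1 : X ≤ (⌈X⌉₊ : ℝ) := Nat.le_ceil X
  have hN2 : (⌈X⌉₊ : ℝ) < X + 1 := Nat.ceil_lt_add_one (by linarith)
  have h2 := h' ⌈X⌉₊ (Nat.one_le_iff_ne_zero.2 (Nat.ceil_pos.2 (by linarith)).ne')
  set W := X ^ ((19 : ℝ) / 20 + ε) with hW
  have hW1 : 1 ≤ W := Real.one_le_rpow hX (by positivity)
  have h3 : (⌈X⌉₊ : ℝ) ^ ((19 : ℝ) / 20) ≤ 2 * W := by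
    calc (⌈X⌉₊ : ℝ) ^ ((19 : ℝ) / 20) ≤ (2 * X) ^ ((19 : ℝ) / 20) := by gcongr; linarith
      _ = 2 ^ ((19 : ℝ) / 20) * X ^ ((19 : ℝ) / 20) := Real.mul_rpow (by norm_num) (by linarith)
      _ ≤ 2 ^ (1 : ℝ) * W := by
          rw [hW]
          gcongr <;> first | exact hX | linarith
      _ = 2 * W := by rw [Real.rpow_one]
  have h4 := h2.trans (mul_le_mul_of_nonneg_left h3 hC')
  have hpi : 2 / Real.pi ^ 2 ≤ 1 := by
    rw [div_le_one (by positivity)]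
    nlinarith [Real.pi_gt_three]
  have hpi0 : 0 ≤ 2 / Real.pi ^ 2 := by positivity
  have h5 : 2 / Real.pi ^ 2 * (⌈X⌉₊ - X) ≤ 1 :=
    mul_le_one₀ hpi (by linarith) (by linarith)
  have h6 : 0 ≤ 2 / Real.pi ^ 2 * (⌈X⌉₊ - X) := mul_nonneg hpi0 (by linarith)
  rw [sum_h3_eq]
  have e : 4 / Real.pi ^ 2 * X = 2 / Real.pi ^ 2 * X + 2 / Real.pi ^ 2 * X := by ring
  rw [e]
  rw [abs_le] at h1 h4 ⊢
  constructor <;> linarith
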